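/- arXiv:1804.09418 — 2 statements merged into one kernel-verified Lean document; each statement's English description precedes it below -/
import Mathlib

section
/- Fix a ∈ [0,1), σ > 0, an excess-distortion probability ε ∈ (0,1) and a distortion d ∈ (0, d_max). Then the minimum achievable source coding rate of the Gauss-Markov source satisfies R(n, d, ε) = R_U(d) + √(V_U(d)/n)·Q⁻¹(ε) + o(1/√n) as n → ∞; equivalently, lim_{n→∞} √n·(R(n, d, ε) − R_U(d)) = √(V_U(d))·Q⁻¹(ε). -/
open MeasureTheory ProbabilityTheory Real Filter Matrix
open scoped NNReal ENNReal

noncomputable section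

namespace GM

/-- Law of `n` i.i.d. centered Gaussian random variables with variance `σ²`. -/
def gaussPi (σ : ℝ) (n : ℕ) : Measure (Fin n → ℝ) :=
  Measure.pi fun _ => gaussianReal 0 ⟨σ ^ 2, sq_nonneg σ⟩

/-- The Gauss-Markov evolution `U_{i+1} = ∑_{j ≤ i} a^(i-j) Z_{j+1}`
(equivalently `U_0 = 0`, `U_i = a U_{i-1} + Z_i`). -/
def evolve (a : ℝ) (n : ℕ) (z : Fin n → ℝ) : Fin n → ℝ :=
  fun i => ∑ j ∈ Finset.Iic i, a ^ ((i : ℕ) - (j : ℕ)) * z j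

/-- Law of the Gauss-Markov source vector `(U_1, …, U_n)`. -/
def sourceLaw (a σ : ℝ) (n : ℕ) : Measure (Fin n → ℝ) :=
  (gaussPi σ n).map (evolve a n)

/-- Mean squared error distortion. -/
def distortion (n : ℕ) (u v : Fin n → ℝ) : ℝ :=
  (1 / (n : ℝ)) * ∑ i, (u i - v i) ^ 2

/-- There exists an `(n, M, d, ε)` excess-distortion code for the Gauss-Markov source. -/
def IsCode (a σ : ℝ) (n M : ℕ) (d ε : ℝ) : Prop :=
  ∃ f : (Fin n → ℝ) → Fin M, ∃ g : Fin M → (Fin n → ℝ),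
    Measurable f ∧
    sourceLaw a σ n {u | d < distortion n u (g (f u))} ≤ ENNReal.ofReal ε

/-- Minimum achievable code size. -/
def Mstar (a σ : ℝ) (n : ℕ) (d ε : ℝ) : ℕ := sInf {M | IsCode a σ n M d ε}

/-- Minimum achievable source coding rate `R(n, d, ε)`. -/
def rate (a σ : ℝ) (n : ℕ) (d ε : ℝ) : ℝ := Real.log (Mstar a σ n d ε) / n

/-- Gaussian tail function `Q`. -/
def gaussQ (t : ℝ) : ℝ := ∫ s in Set.Ioi t, (Real.sqrt (2 * π))⁻¹ * Real.exp (-(s ^ 2) / 2)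

/-- Power spectrum of the Gauss-Markov source. -/
def S (a σ w : ℝ) : ℝ := σ ^ 2 / (1 + a ^ 2 - 2 * a * Real.cos w)

/-- The limiting reverse waterfilling equation relating distortion `d` and water level `θ`. -/
def waterEq (a σ θ d : ℝ) : Prop :=
  d = (1 / (2 * π)) * ∫ w in Set.Icc (-π) π, min θ (S a σ w)

/-- The rate-distortion function `R_U(d)`, parametrized by the water level `θ` matched to `d`. -/
def RU (a σ θ : ℝ) : ℝ :=
  (1 / (2 * π)) * ∫ w in Set.Icc (-π) π, max 0 ((1 / 2) * Real.log (S a σ w / θ))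

/-- The dispersion `V_U(d)`, parametrized by the water level `θ` matched to `d`. -/
def VU (a σ θ : ℝ) : ℝ :=
  (1 / (4 * π)) * ∫ w in Set.Icc (-π) π, min 1 ((S a σ w / θ) ^ 2)

/-- The lower bidiagonal matrix `A` with `1` on the diagonal, `-a` on the first subdiagonal. -/
def Amat (a : ℝ) (n : ℕ) : Matrix (Fin n) (Fin n) ℝ :=
  Matrix.of fun i j => if i = j then 1 else if (i : ℕ) = (j : ℕ) + 1 then -a else 0

/-- `μv` is the nondecreasing enumeration of the eigenvalues (with multiplicity) of the
real symmetric matrix `M`: it is monotone and `M = P D Pᵀ` for some orthogonal `P`. -/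
def IsEigs {n : ℕ} (μv : Fin n → ℝ) (M : Matrix (Fin n) (Fin n) ℝ) : Prop :=
  Monotone μv ∧ ∃ P : Matrix (Fin n) (Fin n) ℝ,
    P * Pᵀ = 1 ∧ Pᵀ * P = 1 ∧ M = P * Matrix.diagonal μv * Pᵀ

/-- The `i`-th entry of `u` (0-based), or `0` if out of range. -/
def entry {n : ℕ} (u : Fin n → ℝ) (i : ℕ) : ℝ := if h : i < n then u ⟨i, h⟩ else 0

/-- Maximum likelihood estimator `â(u) = (∑_{i=1}^{n-1} u_i u_{i+1}) / (∑_{i=1}^{n-1} u_i²)`. -/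
def mle {n : ℕ} (u : Fin n → ℝ) : ℝ :=
  (∑ i ∈ Finset.range (n - 1), entry u i * entry u (i + 1)) /
    ∑ i ∈ Finset.range (n - 1), entry u i ^ 2

/-- The `d`-tilted information expression, parametrized by a water level `θ`,
per-coordinate variances `sv`, evaluated at the point `x`. -/
def Jtilt {n : ℕ} (θ : ℝ) (sv : Fin n → ℝ) (x : Fin n → ℝ) : ℝ :=
  ∑ i, ((min θ (sv i) / (2 * θ)) * ((x i) ^ 2 / sv i - 1)
        + (1 / 2) * Real.log (max θ (sv i) / θ))

end GM

namespace GMP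

lemma exists_spec (a : ℝ) (n : ℕ) : ∃ (P : Matrix (Fin n) (Fin n) ℝ) (μ : Fin n → ℝ),
    P * Pᵀ = 1 ∧ Pᵀ * P = 1 ∧ (GM.Amat a n)ᵀ * GM.Amat a n = P * Matrix.diagonal μ * Pᵀ := by
  have hA : ((GM.Amat a n)ᵀ * GM.Amat a n).IsHermitian := by
    rw [Matrix.IsHermitian, Matrix.conjTranspose_eq_transpose_of_trivial]; simp
  refine ⟨hA.eigenvectorUnitary, hA.eigenvalues, ?_, ?_, ?_⟩
  · have := Unitary.coe_mul_star_self hA.eigenvectorUnitary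
    rwa [Unitary.coe_star, Matrix.star_eq_conjTranspose, Matrix.conjTranspose_eq_transpose_of_trivial] at this
  · have := Unitary.coe_star_mul_self hA.eigenvectorUnitary
    rwa [Matrix.star_eq_conjTranspose, Matrix.conjTranspose_eq_transpose_of_trivial] at this
  · have := hA.spectral_theorem
    rw [Unitary.conjStarAlgAut_apply, Matrix.star_eq_conjTranspose, Matrix.conjTranspose_eq_transpose_of_trivial] at this
    exact this

lemma Amat_zero (a : ℝ) (m : ℕ) (v : Fin (m+1) → ℝ) : (GM.Amat a (m+1) *ᵥ v) 0 = v 0 := by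
  rw [Matrix.mulVec, dotProduct, Fin.sum_univ_succ]
  rw [Finset.sum_eq_zero]
  · simp [GM.Amat]
  · intro i _
    simp [GM.Amat, (Fin.succ_ne_zero i).symm]

lemma Amat_succ (a : ℝ) (m : ℕ) (v : Fin (m+1) → ℝ) (i : Fin m) :
    (GM.Amat a (m+1) *ᵥ v) i.succ = v i.succ - a * v i.castSucc := by
  rw [Matrix.mulVec, dotProduct]
  have h : ∀ j : Fin (m+1), GM.Amat a (m+1) i.succ j * v j =
      (if j = i.succ then v j else 0) + (if j = i.castSucc then -a * v j else 0) := by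
    intro j
    by_cases h1 : j = i.succ
    · subst h1
      have : i.succ ≠ i.castSucc := by
        intro h; have := congrArg Fin.val h; simp at this
      simp [GM.Amat, this]
    · by_cases h2 : j = i.castSucc
      · subst h2
        simp [GM.Amat, Ne.symm h1, h1]
      · have : ¬ ((i.succ : Fin (m+1)) : ℕ) = (j : ℕ) + 1 := by
          intro h; apply h2; ext; simp at h ⊢; omega
        simp [GM.Amat, Ne.symm h1, h1, h2]
        intro h; exfalso; apply this; simpa using h
  simp_rw [h, Finset.sum_add_distrib]
  simp; ring

lemma Amat_sq (a : ℝ) (m : ℕ) (v : Fin (m+1) → ℝ) :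
    ∑ i, (GM.Amat a (m+1) *ᵥ v) i ^ 2 = v 0 ^ 2 + ∑ i : Fin m, (v i.succ - a * v i.castSucc)^2 := by
  rw [Fin.sum_univ_succ, Amat_zero]; simp_rw [Amat_succ]

lemma evolve_zero (a : ℝ) (m : ℕ) (z : Fin (m+1) → ℝ) : GM.evolve a (m+1) z 0 = z 0 := by
  have : Finset.Iic (0 : Fin (m+1)) = {0} := by ext x; simp
  simp [GM.evolve, this]

lemma evolve_succ (a : ℝ) (m : ℕ) (z : Fin (m+1) → ℝ) (i : Fin m) :
    GM.evolve a (m+1) z i.succ = a * GM.evolve a (m+1) z i.castSucc + z i.succ := by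
  have h : Finset.Iic (i.succ) = insert i.succ (Finset.Iic (i.castSucc)) := by
    ext x; simp [Fin.le_def, Fin.ext_iff]; omega
  have h2 : i.succ ∉ Finset.Iic (i.castSucc) := by simp [Fin.le_def]
  simp only [GM.evolve]
  rw [h, Finset.sum_insert h2, Finset.mul_sum, add_comm]
  congr 1
  · apply Finset.sum_congr rfl
    intro j hj
    have hj' : (j : ℕ) ≤ i := by simpa [Fin.le_def] using hj
    have : ((i.succ : Fin (m+1)) : ℕ) - (j : ℕ) = ((i.castSucc : Fin (m+1)) : ℕ) - j + 1 := by
      simp; omega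
    rw [this, pow_succ]; ring
  · simp

lemma evolve_Amat (a : ℝ) (m : ℕ) (v : Fin (m+1) → ℝ) :
    GM.evolve a (m+1) (GM.Amat a (m+1) *ᵥ v) = v := by
  funext i
  induction i using Fin.induction with
  | zero => rw [evolve_zero, Amat_zero]
  | succ i ih => rw [evolve_succ, ih, Amat_succ]; ring

lemma quad_form {n : ℕ} {B P : Matrix (Fin n) (Fin n) ℝ} {μ : Fin n → ℝ}
    (h : Bᵀ * B = P * Matrix.diagonal μ * Pᵀ) (v : Fin n → ℝ) :
    ∑ i, (B *ᵥ v) i ^ 2 = ∑ i, μ i * (Pᵀ *ᵥ v) i ^ 2 := by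
  have h1 : ∑ i, (B *ᵥ v) i ^ 2 = v ⬝ᵥ ((Bᵀ * B) *ᵥ v) := by
    rw [← Matrix.mulVec_mulVec, Matrix.dotProduct_mulVec, Matrix.vecMul_transpose, dotProduct]
    simp [sq]
  rw [h1, h, ← Matrix.mulVec_mulVec, ← Matrix.mulVec_mulVec, Matrix.dotProduct_mulVec,
    ← Matrix.mulVec_transpose, dotProduct]
  simp only [Matrix.mulVec_diagonal]
  exact Finset.sum_congr rfl fun i _ => by ring

lemma norm_form {n : ℕ} {P : Matrix (Fin n) (Fin n) ℝ} (h : P * Pᵀ = 1) (v : Fin n → ℝ) :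
    ∑ i, (Pᵀ *ᵥ v) i ^ 2 = ∑ i, v i ^ 2 := by
  have := quad_form (B := 1) (P := P) (μ := fun _ => 1) (by simp [h]) v
  simpa using this.symm

lemma Asq_bounds (a : ℝ) (ha0 : 0 ≤ a) (ha1 : a < 1) (m : ℕ) (v : Fin (m+1) → ℝ) :
    (1 - a)^2 * ∑ i, v i ^ 2 ≤ ∑ i, (GM.Amat a (m+1) *ᵥ v) i ^ 2 ∧
    ∑ i, (GM.Amat a (m+1) *ᵥ v) i ^ 2 ≤ (1 + a)^2 * ∑ i, v i ^ 2 := by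
  rw [Amat_sq]
  have e1 : ∑ i, v i ^ 2 = v 0 ^ 2 + ∑ i : Fin m, v i.succ ^ 2 := Fin.sum_univ_succ _
  have e2 : ∑ i, v i ^ 2 = ∑ i : Fin m, v i.castSucc ^ 2 + v (Fin.last m) ^ 2 := Fin.sum_univ_castSucc _
  set T := ∑ i, v i ^ 2
  have l1 : ∑ i : Fin m, (v i.succ - a * v i.castSucc)^2 ≤
      ∑ i : Fin m, ((1 + a) * v i.succ ^ 2 + (a + a^2) * v i.castSucc ^ 2) :=
    Finset.sum_le_sum fun i _ => by nlinarith [mul_nonneg ha0 (sq_nonneg (v i.succ + v i.castSucc))]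
  have l2 : ∑ i : Fin m, ((1 - a) * v i.succ ^ 2 + (-a + a^2) * v i.castSucc ^ 2) ≤
     ∑ i : Fin m, (v i.succ - a * v i.castSucc)^2 :=
    Finset.sum_le_sum fun i _ => by nlinarith [mul_nonneg ha0 (sq_nonneg (v i.succ - v i.castSucc))]
  rw [Finset.sum_add_distrib, ← Finset.mul_sum, ← Finset.mul_sum] at l1 l2
  have e1' : ∑ i : Fin m, v i.succ ^ 2 = T - v 0 ^ 2 := by linarith
  have e2' : ∑ i : Fin m, v i.castSucc ^ 2 = T - v (Fin.last m) ^ 2 := by linarith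
  rw [e1', e2'] at l1 l2
  have p0 := sq_nonneg (v 0)
  have pl := sq_nonneg (v (Fin.last m))
  constructor
  · nlinarith [mul_nonneg ha0 p0, mul_nonneg (mul_nonneg ha0 (by linarith : 0 ≤ 1 - a)) pl]
  · nlinarith [mul_nonneg ha0 p0, mul_nonneg ha0 pl, mul_nonneg (mul_nonneg ha0 ha0) pl]

lemma col_apply {n : ℕ} {P : Matrix (Fin n) (Fin n) ℝ} (h : Pᵀ * P = 1) (i : Fin n) :
    Pᵀ *ᵥ (fun k => P k i) = Pi.single i 1 := by
  have h1 : (fun k => P k i) = P *ᵥ Pi.single i 1 := by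
    simp [Matrix.col]; rfl
  rw [h1, Matrix.mulVec_mulVec, h, Matrix.one_mulVec]

lemma col_quad {n : ℕ} {B P : Matrix (Fin n) (Fin n) ℝ} {μ : Fin n → ℝ}
    (h : Bᵀ * B = P * Matrix.diagonal μ * Pᵀ) (h2 : Pᵀ * P = 1) (i : Fin n) :
    ∑ k, (B *ᵥ (fun k => P k i)) k ^ 2 = μ i := by
  rw [quad_form h, col_apply h2]
  simp [Pi.single_apply]

lemma col_norm {n : ℕ} {P : Matrix (Fin n) (Fin n) ℝ} (h1 : P * Pᵀ = 1)
     (h2 : Pᵀ * P = 1) (i : Fin n) : ∑ k, P k i ^ 2 = 1 := by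
  have := norm_form h1 (fun k => P k i)
  rw [col_apply h2] at this
  rw [← this]; simp [Pi.single_apply]

lemma row_norm {n : ℕ} {P : Matrix (Fin n) (Fin n) ℝ} (h1 : P * Pᵀ = 1) (k : Fin n) :
    ∑ i, P k i ^ 2 = 1 := by
  have := congrFun (congrFun h1 k) k
  rw [Matrix.mul_apply] at this
  simpa [sq] using this

lemma mu_bounds {a : ℝ} (ha0 : 0 ≤ a) (ha1 : a < 1) {m : ℕ}
    {P : Matrix (Fin (m+1)) (Fin (m+1)) ℝ} {μ : Fin (m+1) → ℝ} (h1 : P * Pᵀ = 1)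
     (h2 : Pᵀ * P = 1) (h : (GM.Amat a (m+1))ᵀ * GM.Amat a (m+1) = P * Matrix.diagonal μ * Pᵀ) (i) :
     (1 - a)^2 ≤ μ i ∧ μ i ≤ (1 + a)^2 := by
  have := Asq_bounds a ha0 ha1 m (fun k => P k i)
  rw [col_quad h h2, col_norm h1 h2] at this
  simpa using this

end GMP

namespace GMP

def CC {n : ℕ} (u : Fin n → ℝ) (w : ℝ) : ℝ := ∑ k, u k * Real.cos ((k : ℕ) * w)
def SS {n : ℕ} (u : Fin n → ℝ) (w : ℝ) : ℝ := ∑ k, u k * Real.sin ((k : ℕ) * w)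
def DD {n : ℕ} (u : Fin n → ℝ) (w : ℝ) : ℝ := CC u w ^ 2 + SS u w ^ 2
def ff (a w : ℝ) : ℝ := 1 + a ^ 2 - 2 * a * Real.cos w

lemma DD_nonneg {n : ℕ} (u : Fin n → ℝ) (w : ℝ) : 0 ≤ DD u w := by unfold DD; positivity

lemma DD_cont {n : ℕ} (u : Fin n → ℝ) : Continuous (DD u) := by
  unfold DD CC SS; fun_prop

lemma ff_cont (a : ℝ) : Continuous (ff a) := by unfold ff; fun_prop

lemma ff_bounds {a : ℝ} (ha0 : 0 ≤ a) (w : ℝ) :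
    ff a w ∈ Set.Icc ((1-a)^2) ((1+a)^2) := by
  unfold ff
  constructor <;> nlinarith [Real.cos_le_one w, Real.neg_one_le_cos w]

lemma DD_expand {n : ℕ} (u : Fin n → ℝ) (w : ℝ) :
    DD u w = ∑ k, ∑ l, u k * u l * Real.cos ((((k : ℕ) : ℝ) - ((l : ℕ) : ℝ)) * w) := by
  unfold DD CC SS
  rw [sq, sq, Finset.sum_mul_sum, Finset.sum_mul_sum, ← Finset.sum_add_distrib]
  refine Finset.sum_congr rfl fun k _ => ?_
  rw [← Finset.sum_add_distrib]
  refine Finset.sum_congr rfl fun l _ => ?_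
  rw [sub_mul, Real.cos_sub]; ring

lemma integral_cos_int (k l : ℕ) :
    ∫ w in (-π)..π, Real.cos (((k : ℝ) - (l : ℝ)) * w) = if k = l then 2 * π else 0 := by
  split_ifs with h
  · subst h; simp; ring
  · have hne : ((k : ℝ) - l) ≠ 0 := sub_ne_zero.mpr (by exact_mod_cast h)
    rw [intervalIntegral.integral_comp_mul_left (fun x => Real.cos x) hne, integral_cos]
    have e : ((k : ℝ) - l) * π = (((k : ℤ) - (l : ℤ) : ℤ) : ℝ) * π := by push_cast; ring
    rw [mul_neg, Real.sin_neg, e, Real.sin_int_mul_pi]; simp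

lemma integral_DD {n : ℕ} (u : Fin n → ℝ) :
    ∫ w in (-π)..π, DD u w = 2 * π * ∑ k, u k ^ 2 := by
  simp_rw [DD_expand]
  rw [intervalIntegral.integral_finsetSum]
  · rw [Finset.mul_sum]
    refine Finset.sum_congr rfl fun k _ => ?_
    rw [intervalIntegral.integral_finsetSum]
    · simp_rw [intervalIntegral.integral_const_mul, integral_cos_int]
      simp only [Fin.val_inj]
      simp; ring
    · intro l _; apply Continuous.intervalIntegrable; fun_prop
  · intro l _; apply Continuous.intervalIntegrable; fun_prop

lemma ff_DD (a : ℝ) (m : ℕ) (u : Fin (m+1) → ℝ) (w : ℝ) :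
    ff a w * DD u w = DD (GM.Amat a (m+2) *ᵥ (Fin.snoc u 0 : Fin (m+2) → ℝ)) w := by
  have hC : CC (GM.Amat a (m+2) *ᵥ (Fin.snoc u 0 : Fin (m+2) → ℝ)) w
      = CC u w - a * (CC u w * Real.cos w - SS u w * Real.sin w) := by
    have h0 : CC u w = CC (Fin.snoc u 0 : Fin (m+2) → ℝ) w := by
      unfold CC; rw [Fin.sum_univ_castSucc (n := m+1)]; simp
    conv_rhs => rw [show CC u w - a * (CC u w * Real.cos w - SS u w * Real.sin w) =
      CC (Fin.snoc u 0 : Fin (m+2) → ℝ) w - a * (CC u w * Real.cos w - SS u w * Real.sin w) by rw [← h0]]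
    unfold CC SS
    rw [Fin.sum_univ_succ, Fin.sum_univ_succ (n := m+1), Amat_zero, Finset.sum_mul, Finset.sum_mul,
      ← Finset.sum_sub_distrib, Finset.mul_sum, add_sub_assoc, ← Finset.sum_sub_distrib]
    congr 1
    refine Finset.sum_congr rfl fun i _ => ?_
    rw [Amat_succ]
    simp only [Fin.snoc_castSucc, Fin.val_succ]
    push_cast
    rw [add_mul, one_mul, Real.cos_add]; ring
  have hS : SS (GM.Amat a (m+2) *ᵥ (Fin.snoc u 0 : Fin (m+2) → ℝ)) w
      = SS u w - a * (SS u w * Real.cos w + CC u w * Real.sin w) := by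
    have h0 : SS u w = SS (Fin.snoc u 0 : Fin (m+2) → ℝ) w := by
      unfold SS; rw [Fin.sum_univ_castSucc (n := m+1)]; simp
    conv_rhs => rw [show SS u w - a * (SS u w * Real.cos w + CC u w * Real.sin w) =
      SS (Fin.snoc u 0 : Fin (m+2) → ℝ) w - a * (SS u w * Real.cos w + CC u w * Real.sin w) by rw [← h0]]
    unfold CC SS
    rw [Fin.sum_univ_succ, Fin.sum_univ_succ (n := m+1), Amat_zero, Finset.sum_mul, Finset.sum_mul,
      ← Finset.sum_add_distrib, Finset.mul_sum, add_sub_assoc, ← Finset.sum_sub_distrib]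
    congr 1
    refine Finset.sum_congr rfl fun i _ => ?_
    rw [Amat_succ]
    simp only [Fin.snoc_castSucc, Fin.val_succ]
    push_cast
    rw [add_mul, one_mul, Real.sin_add]; ring
  unfold DD
  rw [hC, hS]
  unfold ff
  linear_combination (-a^2 * (CC u w ^2 + SS u w ^2)) * (Real.sin_sq_add_cos_sq w)

lemma integral_ff_DD (a : ℝ) (m : ℕ) (u : Fin (m+1) → ℝ) :
    ∫ w in (-π)..π, ff a w * DD u w =
      2 * π * (∑ k, (GM.Amat a (m+1) *ᵥ u) k ^ 2 + a ^ 2 * u (Fin.last m) ^ 2) := by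
  simp_rw [ff_DD]
  rw [integral_DD, Amat_sq, Amat_sq, Fin.sum_univ_castSucc (n := m)]
  congr 1
  have h0 : (Fin.snoc u 0 : Fin (m+2) → ℝ) 0 = u 0 := by
    have : (0 : Fin (m+2)) = Fin.castSucc (0 : Fin (m+1)) := rfl
    rw [this, Fin.snoc_castSucc]
  have h1 : (Fin.snoc u 0 : Fin (m+2) → ℝ) (Fin.last m).succ = 0 := by
    rw [Fin.succ_last, Fin.snoc_last]
  have h2 : ∀ i : Fin m, (Fin.snoc u 0 : Fin (m+2) → ℝ) (i.castSucc).succ = u i.succ := by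
    intro i; rw [Fin.succ_castSucc, Fin.snoc_castSucc]
  rw [h0, h1]
  simp only [h2, Fin.snoc_castSucc]
  ring

section
variable {a : ℝ} {m : ℕ} {P : Matrix (Fin (m+1)) (Fin (m+1)) ℝ} {μ : Fin (m+1) → ℝ}

lemma sum_DD (h1 : P * Pᵀ = 1) (w : ℝ) : ∑ i, DD (fun k => P k i) w = (m + 1 : ℝ) := by
  have e1 := norm_form h1 (fun k : Fin (m+1) => Real.cos ((k:ℕ) * w))
  have e2 := norm_form h1 (fun k : Fin (m+1) => Real.sin ((k:ℕ) * w))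
  have : ∑ i, DD (fun k => P k i) w = ∑ i : Fin (m+1), (Real.cos ((i:ℕ) * w) ^ 2 + Real.sin ((i:ℕ)*w)^2) := by
    rw [Finset.sum_add_distrib, ← e1, ← e2, ← Finset.sum_add_distrib]
    rfl
  rw [this]; simp

lemma sum_mu_DD (h : (GM.Amat a (m+1))ᵀ * GM.Amat a (m+1) = P * Matrix.diagonal μ * Pᵀ) (w : ℝ) :
    ∑ i, μ i * DD (fun k => P k i) w = m * ff a w + 1 := by
  have e1 := quad_form h (fun k : Fin (m+1) => Real.cos ((k:ℕ) * w))
  have e2 := quad_form h (fun k : Fin (m+1) => Real.sin ((k:ℕ) * w))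
  have : ∑ i, μ i * DD (fun k => P k i) w = 
     ∑ i, μ i * (Pᵀ *ᵥ (fun k : Fin (m+1) => Real.cos ((k:ℕ) * w))) i ^ 2 +
     ∑ i, μ i * (Pᵀ *ᵥ (fun k : Fin (m+1) => Real.sin ((k:ℕ) * w))) i ^ 2 := by
    rw [← Finset.sum_add_distrib]
    refine Finset.sum_congr rfl fun i _ => ?_
    rw [← mul_add]; rfl
  rw [this, ← e1, ← e2, Amat_sq, Amat_sq]
  have : ∀ i : Fin m, (Real.cos (((i.succ : Fin (m+1)) : ℕ) * w) - a * Real.cos (((i.castSucc : Fin (m+1)) : ℕ) * w))^2 +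
     (Real.sin (((i.succ : Fin (m+1)) : ℕ) * w) - a * Real.sin (((i.castSucc : Fin (m+1)) : ℕ) * w))^2 = ff a w := by
    intro i
    simp only [Fin.val_succ, Fin.val_castSucc]
    push_cast
    rw [add_mul, one_mul, Real.cos_add, Real.sin_add]
    unfold ff
    have k1 := Real.sin_sq_add_cos_sq w
    have k2 := Real.sin_sq_add_cos_sq (i * w)
    generalize Real.sin (i*w) = S at *
    generalize Real.cos (i*w) = C at *
    generalize Real.sin w = s at *
    generalize Real.cos w = c at *
    linear_combination (C^2+S^2) * k1 + (1 + a^2 - 2 * a * c) * k2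
  rw [add_add_add_comm, ← Finset.sum_add_distrib, Finset.sum_congr rfl fun i _ => this i]
  simp; ring

/-- convex with slopes bounded by `L` on `[lo, hi]` -/
def Supp (φ : ℝ → ℝ) (lo hi L : ℝ) : Prop :=
  ∀ x ∈ Set.Icc lo hi, ∃ p, |p| ≤ L ∧ ∀ y ∈ Set.Icc lo hi, φ x + p * (y - x) ≤ φ y

theorem trace_bound (ha0 : 0 ≤ a) (ha1 : a < 1) (h1 : P * Pᵀ = 1) (h2 : Pᵀ * P = 1)
    (h : (GM.Amat a (m+1))ᵀ * GM.Amat a (m+1) = P * Matrix.diagonal μ * Pᵀ)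
    {φ : ℝ → ℝ} {L : ℝ} (hφ : Supp φ ((1-a)^2) ((1+a)^2) L) (hc : Continuous fun w => φ (ff a w)) :
    |∑ i, φ (μ i) - (m + 1 : ℝ) * ((1 / (2 * π)) * ∫ w in Set.Icc (-π) π, φ (ff a w))| ≤ 3 * L := by
  have hμ := mu_bounds ha0 ha1 h1 h2 h
  have hpi := Real.pi_pos
  rw [integral_Icc_eq_integral_Ioc, ← intervalIntegral.integral_of_le (by linarith)]
  set I := ∫ w in (-π)..π, φ (ff a w) with hI
  have hL : 0 ≤ L := by
    obtain ⟨p, hp, _⟩ := hφ _ (ff_bounds ha0 0)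
    exact (abs_nonneg p).trans hp
  have ci : ∀ {g : ℝ → ℝ}, Continuous g → IntervalIntegrable g volume (-π) π :=
    fun hg => hg.intervalIntegrable _ _
  have c1 : ∀ (c : ℝ) i, Continuous fun w => c * DD (fun k => P k i) w :=
    fun c i => continuous_const.mul (DD_cont _)
  have c2 : ∀ (c : ℝ) i, Continuous fun w => c * (ff a w * DD (fun k => P k i) w) :=
    fun c i => continuous_const.mul ((ff_cont a).mul (DD_cont _))
  have c3 : ∀ i, Continuous fun w => φ (ff a w) * DD (fun k => P k i) w :=
    fun i => hc.mul (DD_cont _)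
  have c4 : Continuous fun w => (m+1 : ℝ) * φ (ff a w) := continuous_const.mul hc
  -- lower bound
  have lower : (m+1 : ℝ) * I - 2 * π * (3 * L) ≤ 2 * π * ∑ i, φ (μ i) := by
    have e1 : ∫ w in (-π)..π, ∑ i, φ (μ i) * DD (fun k => P k i) w = 2 * π * ∑ i, φ (μ i) := by
      rw [intervalIntegral.integral_finsetSum]
      · rw [Finset.mul_sum]
        refine Finset.sum_congr rfl fun i _ => ?_
        rw [intervalIntegral.integral_const_mul, integral_DD, col_norm h1 h2]; ring
      · intro i _; exact ci (c1 _ _)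
    have e2 : ∫ w in (-π)..π, ((m+1 : ℝ) * φ (ff a w) - 3 * L) = (m+1 : ℝ) * I - 2 * π * (3 * L) := by
      rw [intervalIntegral.integral_sub (ci c4) (ci continuous_const),
        intervalIntegral.integral_const_mul]
      simp; ring
    rw [← e1, ← e2]
    apply intervalIntegral.integral_mono_on (by linarith) (ci (c4.sub continuous_const))
      (ci (continuous_finsetSum _ fun i _ => c1 _ _))
    intro w _
    obtain ⟨p, hp, hp2⟩ := hφ _ (ff_bounds ha0 w)
    have : ∑ i, (φ (ff a w) + p * (μ i - ff a w)) * DD (fun k => P k i) w ≤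
        ∑ i, φ (μ i) * DD (fun k => P k i) w :=
      Finset.sum_le_sum fun i _ => mul_le_mul_of_nonneg_right (hp2 _ (hμ i)) (DD_nonneg _ _)
    refine le_trans ?_ this
    have e3 : ∑ i, (φ (ff a w) + p * (μ i - ff a w)) * DD (fun k => P k i) w =
       (φ (ff a w) - p * ff a w) * ∑ i, DD (fun k => P k i) w + p * ∑ i, μ i * DD (fun k => P k i) w := by
      rw [Finset.mul_sum, Finset.mul_sum, ← Finset.sum_add_distrib]
      exact Finset.sum_congr rfl fun i _ => by ring
    rw [e3, sum_DD h1, sum_mu_DD h]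
    have hb := ff_bounds ha0 w
    have hb2 : |1 - ff a w| ≤ 3 := by
      rw [abs_le]; constructor <;> nlinarith [hb.1, hb.2]
    have : |p * (1 - ff a w)| ≤ L * 3 := by
      rw [abs_mul]; exact mul_le_mul hp hb2 (abs_nonneg _) hL
    have := (abs_le.mp this).1
    simp only [Pi.sub_apply]
    nlinarith
  have upper : 2 * π * ∑ i, φ (μ i) ≤ (m+1 : ℝ) * I + 2 * π * L := by
    have key : ∀ i, 2 * π * φ (μ i) - 2 * π * L * P (Fin.last m) i ^ 2 ≤
        ∫ w in (-π)..π, φ (ff a w) * DD (fun k => P k i) w := by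
      intro i
      obtain ⟨p, hp, hp2⟩ := hφ _ (hμ i)
      have e1 : ∫ w in (-π)..π, ((φ (μ i) - p * μ i) * DD (fun k => P k i) w + 
          p * (ff a w * DD (fun k => P k i) w)) = 2 * π * φ (μ i) + 2 * π * (p * a^2 * P (Fin.last m) i ^ 2) := by
        rw [intervalIntegral.integral_add (ci (c1 _ _))
          (ci (c2 _ _)), intervalIntegral.integral_const_mul,
          intervalIntegral.integral_const_mul, integral_DD, integral_ff_DD, col_quad h h2, col_norm h1 h2]
        ring
      have l1 : 2 * π * φ (μ i) - 2 * π * L * P (Fin.last m) i ^ 2 ≤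
         2 * π * φ (μ i) + 2 * π * (p * a^2 * P (Fin.last m) i ^ 2) := by
        have : -L ≤ p * a^2 := by
          have := (abs_le.mp hp).1
          nlinarith [mul_nonneg hL (by nlinarith : 0 ≤ 1 - a^2), sq_nonneg a]
        nlinarith [mul_le_mul_of_nonneg_right this (mul_nonneg (by linarith : 0 ≤ 2 * π) (sq_nonneg (P (Fin.last m) i)))]
      refine l1.trans ?_
      rw [← e1]
      apply intervalIntegral.integral_mono_on (by linarith)
        (ci ((c1 _ _).add (c2 _ _)))
        (ci (c3 _))
      intro w _
      have := mul_le_mul_of_nonneg_right (hp2 _ (ff_bounds ha0 w)) (DD_nonneg (fun k => P k i) w)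
      simp only [Pi.add_apply]
      nlinarith
    have s := Finset.sum_le_sum fun i (_ : i ∈ Finset.univ) => key i
    rw [Finset.sum_sub_distrib, ← Finset.mul_sum, ← Finset.mul_sum, row_norm h1,
      ← intervalIntegral.integral_finsetSum (fun i _ => ci (c3 _))] at s
    simp_rw [← Finset.mul_sum, sum_DD h1] at s
    rw [intervalIntegral.integral_mul_const] at s
    linarith
  have e : (m + 1 : ℝ) * (1 / (2 * π) * I) = ((m+1 : ℝ) * I) / (2 * π) := by field_simp
  rw [e, abs_le]
  constructor
  · rw [neg_le_sub_iff_le_add, div_le_iff₀ (by linarith)]; nlinarith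
  · rw [sub_le_iff_le_add, ← sub_le_iff_le_add', le_div_iff₀ (by linarith)]; nlinarith [mul_nonneg hL hpi.le]
end
end GMP

namespace GMP

lemma Supp.max {φ : ℝ → ℝ} {lo hi L : ℝ} (h : Supp φ lo hi L) (c : ℝ) :
    Supp (fun x => max c (φ x)) lo hi L := by
  intro x hx
  obtain ⟨p, hp, hp2⟩ := h x hx
  rcases le_total c (φ x) with hc | hc
  · refine ⟨p, hp, fun y hy => ?_⟩
    simp only [max_eq_right hc]
    exact (hp2 y hy).trans (le_max_right _ _)
  · refine ⟨0, by simpa using (abs_nonneg p).trans hp, fun y hy => ?_⟩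
    simp only [max_eq_left hc]
    simp

lemma supp_inv {κ lo hi : ℝ} (hκ : 0 ≤ κ) (hlo : 0 < lo) :
    Supp (fun x => κ / x) lo hi (κ / lo ^ 2) := by
  intro x hx
  have hx0 : 0 < x := hlo.trans_le hx.1
  refine ⟨-(κ / x^2), ?_, fun y hy => ?_⟩
  · rw [abs_neg, abs_of_nonneg (by positivity)]
    have := hx.1
    gcongr
  · have hy0 : 0 < y := hlo.trans_le hy.1
    have : κ / y - (κ / x + -(κ / x^2) * (y - x)) = κ * (y - x)^2 / (x^2 * y) := by
      field_simp; ring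
    have h2 : 0 ≤ κ * (y - x)^2 / (x^2 * y) := by positivity
    simp only
    linarith

lemma supp_sq {κ lo hi : ℝ} (hlo : 0 < lo) :
    Supp (fun x => (κ / x)^2) lo hi (2 * κ^2 / lo ^ 3) := by
  intro x hx
  have hx0 : 0 < x := hlo.trans_le hx.1
  refine ⟨-(2 * κ^2 / x^3), ?_, fun y hy => ?_⟩
  · rw [abs_neg, abs_of_nonneg (by positivity)]
    have := hx.1
    gcongr
  · have hy0 : 0 < y := hlo.trans_le hy.1
    have : (κ / y)^2 - ((κ / x)^2 + -(2 * κ^2 / x^3) * (y - x)) = 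
        κ^2 * ((y - x)^2 * (2 * y + x)) / (x^3 * y^2) := by
      field_simp; ring
    have h2 : 0 ≤ κ^2 * ((y - x)^2 * (2 * y + x)) / (x^3 * y^2) := by positivity
    simp only
    linarith

lemma supp_log {κ lo hi : ℝ} (hκ : 0 < κ) (hlo : 0 < lo) :
    Supp (fun x => 1 / 2 * Real.log (κ / x)) lo hi (1 / (2 * lo)) := by
  intro x hx
  have hx0 : 0 < x := hlo.trans_le hx.1
  refine ⟨-(1 / (2 * x)), ?_, fun y hy => ?_⟩
  · rw [abs_neg, abs_of_nonneg (by positivity)]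
    have := hx.1
    gcongr
  · have hy0 : 0 < y := hlo.trans_le hy.1
    simp only
    rw [Real.log_div hκ.ne' hx0.ne', Real.log_div hκ.ne' hy0.ne']
    have h1 := Real.log_le_sub_one_of_pos (div_pos hy0 hx0)
    rw [Real.log_div hy0.ne' hx0.ne'] at h1
    have : -(1 / (2 * x)) * (y - x) = -(1/2) * (y / x - 1) := by field_simp
    rw [this]; linarith

lemma S_eq (a σ w : ℝ) : GM.S a σ w = σ^2 / ff a w := rfl

theorem spectral {a σ θ d : ℝ} (ha0 : 0 ≤ a) (ha1 : a < 1) (hσ : 0 < σ) (hθ : 0 < θ)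
    (hw : GM.waterEq a σ θ d) : ∃ C : ℝ, 0 ≤ C ∧ ∀ m : ℕ, 
    ∃ (P : Matrix (Fin (m+1)) (Fin (m+1)) ℝ) (s : Fin (m+1) → ℝ), P * Pᵀ = 1 ∧ Pᵀ * P = 1 ∧
      (GM.Amat a (m+1))ᵀ * GM.Amat a (m+1) = P * Matrix.diagonal (fun i => σ^2 / s i) * Pᵀ ∧
      (∀ i, σ^2 / (1+a)^2 ≤ s i ∧ s i ≤ σ^2 / (1-a)^2) ∧
      |∑ i, min θ (s i) - (m+1 : ℝ) * d| ≤ C ∧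
      |∑ i, 1 / 2 * Real.log (max θ (s i) / θ) - (m+1 : ℝ) * GM.RU a σ θ| ≤ C ∧
      |∑ i, 1 / 2 * min 1 ((s i / θ)^2) - (m+1 : ℝ) * GM.VU a σ θ| ≤ C := by
  have hlo : 0 < (1 - a)^2 := by nlinarith
  have hff : ∀ w, 0 < ff a w := fun w => hlo.trans_le (ff_bounds ha0 w).1
  have hff0 : ∀ w, ff a w ≠ 0 := fun w => (hff w).ne'
  have hfc := ff_cont a
  set lo := (1-a)^2 with hlo_def
  set hi := (1+a)^2
  have sp1 : Supp (fun x => σ^2 / x) lo hi _ := supp_inv (by positivity) hlo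
  have sp2 : Supp (fun x => max θ (σ^2 / x)) lo hi _ := sp1.max θ
  have sp3 : Supp (fun x => max 0 (1 / 2 * Real.log ((σ^2/θ) / x))) lo hi _ :=
     (supp_log (by positivity) hlo).max 0
  have sp4 : Supp (fun x => ((σ^2 / θ) / x)^2) lo hi _ := supp_sq hlo
  have sp5 : Supp (fun x => max 1 (((σ^2 / θ) / x)^2)) lo hi _ := sp4.max 1
  have k1 : Continuous fun w => σ^2 / ff a w := continuous_const.div hfc hff0
  have k4' : Continuous fun w => (σ^2 / θ) / ff a w := continuous_const.div hfc hff0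
  have k2 : Continuous fun w => max θ (σ^2 / ff a w) := continuous_const.max k1
  have k3 : Continuous fun w => max 0 (1 / 2 * Real.log ((σ^2/θ) / ff a w)) :=
    continuous_const.max (continuous_const.mul (k4'.log fun w => by
      have := hff w; positivity))
  have k4 : Continuous fun w => ((σ^2 / θ) / ff a w)^2 := k4'.pow 2
  have k1' : Continuous fun w => σ^2 / ff a w + θ := k1.add continuous_const
  have k4'' : Continuous fun w => ((σ^2 / θ) / ff a w)^2 + 1 := k4.add continuous_const
  have k5 : Continuous fun w => max 1 (((σ^2 / θ) / ff a w)^2) := continuous_const.max k4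
  have ii : ∀ {g : ℝ → ℝ}, Continuous g → IntegrableOn g (Set.Icc (-π) π) :=
    fun hg => hg.continuousOn.integrableOn_Icc
  have hpi := Real.pi_pos
  have vol : ∀ c : ℝ, ∫ w in Set.Icc (-π) π, c = 2 * π * c := by
    intro c; simp [Measure.real]
    left
    rw [ENNReal.toReal_ofReal (by linarith)]; ring
  have hd : d = (1 / (2 * π)) * (∫ w in Set.Icc (-π) π, σ^2 / ff a w) + θ - 
      (1 / (2 * π)) * ∫ w in Set.Icc (-π) π, max θ (σ^2 / ff a w) := by
    have e : ∫ w in Set.Icc (-π) π, min θ (GM.S a σ w) = ∫ w in Set.Icc (-π) π,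
       ((σ^2 / ff a w) + θ - max θ (σ^2 / ff a w)) := by
      congr 1; funext w; rw [S_eq]
      have := min_add_max θ (σ^2 / ff a w); linarith
    rw [GM.waterEq, e, integral_sub (ii k1') (ii k2),
      integral_add (ii k1) (ii continuous_const), vol] at hw
    rw [hw]; field_simp
  have hR : GM.RU a σ θ = (1 / (2 * π)) * ∫ w in Set.Icc (-π) π, max 0 (1 / 2 * Real.log ((σ^2/θ) / ff a w)) := by
    unfold GM.RU
    congr 2; funext w; rw [S_eq, div_right_comm]
  have hV : 2 * GM.VU a σ θ = (1 / (2 * π)) * (∫ w in Set.Icc (-π) π, ((σ^2/θ) / ff a w)^2) + 1 - 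
      (1 / (2 * π)) * ∫ w in Set.Icc (-π) π, max 1 (((σ^2/θ) / ff a w)^2) := by
    have e : ∫ w in Set.Icc (-π) π, min 1 ((GM.S a σ w / θ)^2) = ∫ w in Set.Icc (-π) π,
       (((σ^2/θ) / ff a w)^2 + 1 - max 1 (((σ^2/θ) / ff a w)^2)) := by
      congr 1; funext w; rw [S_eq, div_right_comm]
      have := min_add_max 1 ((σ^2/θ / ff a w)^2); linarith
    rw [GM.VU, e, integral_sub (ii k4'') (ii k5),
      integral_add (ii k4) (ii continuous_const), vol]
    field_simp
    ring
  set L1 := σ^2 / lo ^ 2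
  set L3 := 1 / (2 * lo)
  set L4 := 2 * (σ^2/θ)^2 / lo ^ 3
  have hL1 : 0 ≤ L1 := by positivity
  have hL3 : 0 ≤ L3 := by positivity
  have hL4 : 0 ≤ L4 := by positivity
  refine ⟨6 * L1 + 3 * L3 + 6 * L4, by positivity, fun m => ?_⟩
  obtain ⟨P, μ, h1, h2, h⟩ := exists_spec a (m+1)
  have hμ := mu_bounds ha0 ha1 h1 h2 h
  have hμ0 : ∀ i, 0 < μ i := fun i => hlo.trans_le (hμ i).1
  have t1 := trace_bound ha0 ha1 h1 h2 h sp1 k1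
  have t2 := trace_bound ha0 ha1 h1 h2 h sp2 k2
  have t3 := trace_bound ha0 ha1 h1 h2 h sp3 k3
  have t4 := trace_bound ha0 ha1 h1 h2 h sp4 k4
  have t5 := trace_bound ha0 ha1 h1 h2 h sp5 k5
  refine ⟨P, fun i => σ^2 / μ i, h1, h2, ?_, ?_, ?_, ?_, ?_⟩
  · rw [h]; congr 3; funext i; have := (hμ0 i).ne'; field_simp
  · intro i
    exact ⟨div_le_div_of_nonneg_left (by positivity) (hμ0 i) (hμ i).2,
      div_le_div_of_nonneg_left (by positivity) hlo (hμ i).1⟩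
  · have e : ∑ i, min θ (σ^2 / μ i) = ∑ i, σ^2 / μ i + (m+1 : ℝ) * θ - ∑ i, max θ (σ^2 / μ i) := by
      have : (m+1 : ℝ) * θ = ∑ i : Fin (m+1), θ := by simp
      rw [this, ← Finset.sum_add_distrib, ← Finset.sum_sub_distrib]
      refine Finset.sum_congr rfl fun i _ => ?_
      have := min_add_max θ (σ^2 / μ i); linarith
    rw [e, hd]
    rw [abs_le] at *
    constructor <;> linarith [t1.1, t1.2, t2.1, t2.2]
  · have e : ∑ i, 1 / 2 * Real.log (max θ (σ^2 / μ i) / θ) = ∑ i, max 0 (1 / 2 * Real.log ((σ^2/θ) / μ i)) := by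
      refine Finset.sum_congr rfl fun i _ => ?_
      have := hμ0 i
      rw [div_right_comm (σ^2) θ]
      rcases le_total θ (σ^2 / μ i) with hc | hc
      · rw [max_eq_right hc, max_eq_right]
        have := Real.log_nonneg ((one_le_div hθ).2 hc); positivity
      · rw [max_eq_left hc, max_eq_left, div_self hθ.ne']; simp
        have := Real.log_nonpos (by positivity) ((div_le_one hθ).2 hc); linarith
    rw [e, hR]
    linarith
  · have e : ∑ i, 1 / 2 * min 1 ((σ^2 / μ i / θ)^2) = 1 / 2 * (∑ i, (σ^2 / θ / μ i)^2 + (m+1 : ℝ) * 1 - ∑ i, max 1 ((σ^2 / θ / μ i)^2)) := by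
      have : (m+1 : ℝ) * 1 = ∑ i : Fin (m+1), 1 := by simp
      rw [this, ← Finset.sum_add_distrib, ← Finset.sum_sub_distrib, Finset.mul_sum]
      refine Finset.sum_congr rfl fun i _ => ?_
      rw [div_right_comm (σ^2) θ]
      have := min_add_max 1 ((σ^2 / μ i/ θ)^2); linarith
    rw [e, show GM.VU a σ θ = 1/2 * (2 * GM.VU a σ θ) by ring, hV]
    rw [abs_le] at *
    constructor <;> linarith [t4.1, t4.2, t5.1, t5.2]

def gam (n : ℕ) : Measure (Fin n → ℝ) := Measure.pi fun _ => gaussianReal 0 1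

instance (n : ℕ) : IsProbabilityMeasure (gam n) := by unfold gam; infer_instance

lemma gam_orth {n : ℕ} {O : Matrix (Fin n) (Fin n) ℝ} (h : O * Oᵀ = 1) :
    (gam n).map (fun g => O *ᵥ g) = gam n := by
  have hO : O ∈ Matrix.unitaryGroup (Fin n) ℝ := by
    rw [Matrix.mem_unitaryGroup_iff, Matrix.star_eq_conjTranspose, Matrix.conjTranspose_eq_transpose_of_trivial]
    exact h
  have h' : Oᵀ * O = 1 := mul_eq_one_comm.mp h
  let f0 : EuclideanSpace ℝ (Fin n) →ₗᵢ[ℝ] EuclideanSpace ℝ (Fin n) :=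
    { toLinearMap := Matrix.toEuclideanLin O
      norm_map' := by
        intro x
        rw [EuclideanSpace.norm_eq, EuclideanSpace.norm_eq]
        congr 1
        simp only [Real.norm_eq_abs, sq_abs]
        have := norm_form (P := Oᵀ) (by simpa using h') (fun i => x i)
        simpa [Matrix.toLpLin_apply] using this }
  let f : EuclideanSpace ℝ (Fin n) ≃ₗᵢ[ℝ] EuclideanSpace ℝ (Fin n) :=
    f0.toLinearIsometryEquiv rfl
  have hf := stdGaussian_map (E := EuclideanSpace ℝ (Fin n)) f
  rw [← map_pi_eq_stdGaussian] at hf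
  have hm : Measurable (WithLp.ofLp : EuclideanSpace ℝ (Fin n) → _) := by fun_prop
  have := congrArg (Measure.map (WithLp.ofLp : EuclideanSpace ℝ (Fin n) → _)) hf
  have hm2 : Measurable (fun g : Fin n → ℝ => O *ᵥ g) := by
    apply Continuous.measurable; fun_prop
  rw [Measure.map_map (by fun_prop) (by fun_prop), Measure.map_map (by fun_prop) (by fun_prop),
    Measure.map_map (by fun_prop) (by fun_prop)] at this
  have e : (WithLp.ofLp : EuclideanSpace ℝ (Fin n) → _) ∘ (WithLp.toLp 2 : (Fin n → ℝ) → _) = id := rfl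
  rw [e, Measure.map_id] at this
  unfold gam
  exact this

lemma gaussPi_eq (σ : ℝ) (n : ℕ) : GM.gaussPi σ n = (gam n).map (fun g i => σ * g i) := by
  unfold GM.gaussPi gam
  rw [Measure.pi_map_pi (f := fun _ x => σ * x) (fun i => by fun_prop)]
  congr 1; funext i
  rw [gaussianReal_map_const_mul]; simp; rfl

lemma sourceLaw_eq {a σ : ℝ} {m : ℕ} (hσ : 0 < σ)
    {P : Matrix (Fin (m+1)) (Fin (m+1)) ℝ} {s : Fin (m+1) → ℝ} (h1 : P * Pᵀ = 1) (h2 : Pᵀ * P = 1)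
    (h : (GM.Amat a (m+1))ᵀ * GM.Amat a (m+1) = P * Matrix.diagonal (fun i => σ^2 / s i) * Pᵀ)
    (hs : ∀ i, 0 < s i) :
    GM.sourceLaw a σ (m+1) = (gam (m+1)).map (fun g => P *ᵥ (fun i => √(s i) * g i)) := by
  set E : Matrix (Fin (m+1)) (Fin (m+1)) ℝ := Matrix.diagonal (fun i => √(s i) / σ)
  set O := GM.Amat a (m+1) * P * E with hO
  have hOO : Oᵀ * O = 1 := by
    have : Oᵀ * O = Eᵀ * (Pᵀ * ((GM.Amat a (m+1))ᵀ * GM.Amat a (m+1)) * P) * E := by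
      simp only [hO, Matrix.transpose_mul, Matrix.mul_assoc]
    rw [this, h]
    have : Pᵀ * (P * Matrix.diagonal (fun i => σ^2 / s i) * Pᵀ) * P = Matrix.diagonal (fun i => σ^2 / s i) := by
      calc _ = (Pᵀ * P) * Matrix.diagonal (fun i => σ^2 / s i) * (Pᵀ * P) := by simp only [Matrix.mul_assoc]
        _ = _ := by rw [h2]; simp
    rw [this]
    simp only [E, Matrix.diagonal_transpose, Matrix.diagonal_mul_diagonal]
    rw [← Matrix.diagonal_one]
    congr 1; funext i
    have := hs i
    have h3 := Real.sq_sqrt (hs i).le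
    have : √(s i) / σ * (σ^2 / s i) * (√(s i) / σ) = √(s i)^2 / s i := by field_simp
    rw [this, h3, div_self (hs i).ne']
  have hO2 : O * Oᵀ = 1 := mul_eq_one_comm.mp hOO
  unfold GM.sourceLaw
  rw [gaussPi_eq]
  conv_lhs => rw [← gam_orth hO2]
  have hm : Measurable (GM.evolve a (m+1)) := by
    unfold GM.evolve; apply Continuous.measurable; fun_prop
  have hm2 : Measurable (fun g : Fin (m+1) → ℝ => O *ᵥ g) := by
    apply Continuous.measurable; fun_prop
  rw [Measure.map_map (by fun_prop) hm2, Measure.map_map hm (by fun_prop)]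
  congr 1
  funext g
  simp only [Function.comp]
  have : (fun i => σ * (O *ᵥ g) i) = GM.Amat a (m+1) *ᵥ (P *ᵥ (fun i => √(s i) * g i)) := by
    have e : (fun i => σ * (O *ᵥ g) i) = O *ᵥ (σ • g) := by
      rw [Matrix.mulVec_smul]; rfl
    rw [e, hO, ← Matrix.mulVec_mulVec, ← Matrix.mulVec_mulVec]
    congr 2; funext i
    simp only [E, Matrix.mulVec_diagonal, Pi.smul_apply, smul_eq_mul]
    field_simp
  rw [this, evolve_Amat]

end GMP

namespace GMP

/-- failure event of a codebook in the diagonalized coordinates -/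
def fail {n M : ℕ} (s : Fin n → ℝ) (d : ℝ) (c : Fin M → Fin n → ℝ) : Set (Fin n → ℝ) :=
  {g | ∀ j, (n : ℝ) * d < ∑ i, (√(s i) * g i - c j i)^2}

lemma orth_sum {n : ℕ} {P : Matrix (Fin n) (Fin n) ℝ} (h1 : P * Pᵀ = 1) (h2 : Pᵀ * P = 1)
    (x v : Fin n → ℝ) : ∑ i, ((P *ᵥ x) i - v i)^2 = ∑ i, (x i - (Pᵀ *ᵥ v) i)^2 := by
  rw [← norm_form h1 (fun i => (P *ᵥ x) i - v i)]
  refine Finset.sum_congr rfl fun i _ => ?_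
  have : (fun i => (P *ᵥ x) i - v i) = P *ᵥ x - v := rfl
  rw [this, Matrix.mulVec_sub, Matrix.mulVec_mulVec, h2, Matrix.one_mulVec]; rfl

lemma dist_iff (m : ℕ) (d : ℝ) (u v : Fin (m+1) → ℝ) :
    d < GM.distortion (m+1) u v ↔ ((m+1 : ℕ) : ℝ) * d < ∑ i, (u i - v i)^2 := by
  unfold GM.distortion
  have : (0:ℝ) < ((m+1 : ℕ) : ℝ) := by positivity
  rw [one_div, lt_inv_mul_iff₀ this]

variable {a σ d ε : ℝ} {m M : ℕ}

lemma words_of_code (hσ : 0 < σ)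
    {P : Matrix (Fin (m+1)) (Fin (m+1)) ℝ} {s : Fin (m+1) → ℝ} (h1 : P * Pᵀ = 1) (h2 : Pᵀ * P = 1)
    (h : (GM.Amat a (m+1))ᵀ * GM.Amat a (m+1) = P * Matrix.diagonal (fun i => σ^2 / s i) * Pᵀ)
    (hs : ∀ i, 0 < s i) (hc : GM.IsCode a σ (m+1) M d ε) : 
    0 < M ∧ ∃ c : Fin M → Fin (m+1) → ℝ, gam (m+1) (fail s d c) ≤ ENNReal.ofReal ε := by
  obtain ⟨f, g, hf, hfg⟩ := hc
  refine ⟨(f 0).pos, fun j => Pᵀ *ᵥ g j, le_trans ?_ hfg⟩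
  have hm2 : Measurable (fun g : Fin (m+1) → ℝ => P *ᵥ (fun i => √(s i) * g i)) := by
    apply Continuous.measurable; fun_prop
  rw [sourceLaw_eq hσ h1 h2 h hs]
  refine le_trans (measure_mono ?_) (Measure.le_map_apply hm2.aemeasurable _)
  intro x hx
  simp only [Set.mem_preimage, Set.mem_ofPred_eq]
  rw [dist_iff, orth_sum h1 h2]
  exact hx _

lemma code_of_words (hσ : 0 < σ) (hM : 0 < M)
    {P : Matrix (Fin (m+1)) (Fin (m+1)) ℝ} {s : Fin (m+1) → ℝ} (h1 : P * Pᵀ = 1) (h2 : Pᵀ * P = 1)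
    (h : (GM.Amat a (m+1))ᵀ * GM.Amat a (m+1) = P * Matrix.diagonal (fun i => σ^2 / s i) * Pᵀ)
    (hs : ∀ i, 0 < s i) (c : Fin M → Fin (m+1) → ℝ)
    (hc : gam (m+1) (fail s d c) ≤ ENNReal.ofReal ε) : GM.IsCode a σ (m+1) M d ε := by
  classical
  haveI : NeZero M := ⟨hM.ne'⟩
  let p : (Fin (m+1) → ℝ) → ℕ → Prop := fun u k => M ≤ k ∨ 
    ∑ i, (u i - (P *ᵥ c (Fin.ofNat M k)) i)^2 ≤ ((m+1 : ℕ) : ℝ) * d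
  have hp : ∀ u, ∃ k, p u k := fun u => ⟨M, Or.inl le_rfl⟩
  have hmp : ∀ k, MeasurableSet {u | p u k} := by
    intro k
    refine (MeasurableSet.const _).union ?_
    have : Measurable fun u : Fin (m+1) → ℝ => ∑ i, (u i - (P *ᵥ c (Fin.ofNat M k)) i)^2 := by fun_prop
    exact measurableSet_le this measurable_const
  have hf : Measurable fun u => Fin.ofNat M (Nat.find (hp u)) :=
    (Measurable.of_discrete (f := Fin.ofNat M)).comp (measurable_find hp hmp)
  refine ⟨_, fun j => P *ᵥ c j, hf, le_trans ?_ hc⟩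
  have hm2 : Measurable (fun g : Fin (m+1) → ℝ => P *ᵥ (fun i => √(s i) * g i)) := by
    apply Continuous.measurable; fun_prop
  have hmg : Measurable fun u : Fin (m+1) → ℝ => (P *ᵥ c (Fin.ofNat M (Nat.find (hp u)))) :=
    (Measurable.of_discrete (f := fun j => P *ᵥ c j)).comp hf
  rw [sourceLaw_eq hσ h1 h2 h hs, Measure.map_apply hm2]
  · refine measure_mono ?_
    intro x hx j
    simp only [Set.mem_preimage, Set.mem_ofPred_eq] at hx
    rw [dist_iff] at hx
    by_contra hcon
    set u := P *ᵥ (fun i => √(s i) * x i) with hu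
    have hpj : p u j := by
      right
      rw [orth_sum h1 h2, Matrix.mulVec_mulVec, h2, Matrix.one_mulVec]
      have : Fin.ofNat M j = j := by ext; simp
      rw [this]; exact not_lt.1 hcon
    have hle := Nat.find_min' (hp u) hpj
    rcases Nat.find_spec (hp u) with h3 | h3
    · exact absurd j.2 (by omega)
    · exact absurd hx (not_lt.2 h3)
  · simp only [dist_iff]
    exact measurableSet_lt (by fun_prop) (Finset.measurable_sum _ fun i _ => by
      have := (measurable_pi_apply i).comp hmg
      exact ((measurable_pi_apply i).sub this).pow_const 2)

end GMP

namespace GMP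

lemma lintegral_pi_prod {n : ℕ} (μ : Fin n → Measure ℝ) [∀ i, IsProbabilityMeasure (μ i)]
    (f : Fin n → ℝ → ℝ≥0∞) (hf : ∀ i, Measurable (f i)) :
    ∫⁻ g, ∏ i, f i (g i) ∂(Measure.pi μ) = ∏ i, ∫⁻ x, f i x ∂(μ i) := by
  have key := lintegral_prod_eq_prod_lintegral_of_indepFun (μ := Measure.pi μ) Finset.univ
    (fun i (g : Fin n → ℝ) => f i (g i))
    (iIndepFun_pi (X := f) fun i => (hf i).aemeasurable)
    (fun i => (hf i).comp (measurable_pi_apply i))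
  rw [key]
  refine Finset.prod_congr rfl fun i _ => ?_
  have h := (measurePreserving_eval μ i)
  rw [← h.map_eq, lintegral_map (hf i) (measurable_pi_apply i)]

/-- one coordinate of the tilted information -/
def j1 (θ s g : ℝ) : ℝ := min θ s / (2 * θ) * (g^2 - 1) + 1 / 2 * Real.log (max θ s / θ)

def jt {n : ℕ} (θ : ℝ) (s : Fin n → ℝ) (g : Fin n → ℝ) : ℝ := ∑ i, j1 θ (s i) (g i)

lemma one_dim {θ s : ℝ} (hθ : 0 < θ) (hs : 0 < s) (y : ℝ) :
    ∫⁻ g, ENNReal.ofReal (Real.exp (j1 θ s g + (1 / (2 * θ)) * (min θ s - (√s * g - y)^2)))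
      ∂(gaussianReal 0 1) ≤ 1 := by
  set r : ℝ := max θ s / θ with hr
  have hmx : 0 < max θ s := lt_max_of_lt_left hθ
  have hr0 : 0 < r := by positivity
  obtain ⟨v, hvr⟩ : ∃ v : ℝ≥0, (v : ℝ) = r⁻¹ := ⟨Real.toNNReal r⁻¹, Real.coe_toNNReal _ (by positivity)⟩
  have hv : v ≠ 0 := by
    rintro rfl
    have := inv_pos.2 hr0
    rw [← hvr] at this; simp at this
  rw [gaussianReal_of_var_ne_zero 0 one_ne_zero,
    lintegral_withDensity_eq_lintegral_mul _ (measurable_gaussianPDF _ _) (by unfold j1; fun_prop)]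
  rw [← lintegral_gaussianPDF_eq_one (√s * y / (max θ s)) hv]
  refine lintegral_mono fun g => ?_
  simp only [Pi.mul_apply, gaussianPDF]
  rw [← ENNReal.ofReal_mul (gaussianPDFReal_nonneg _ _ _)]
  refine ENNReal.ofReal_le_ofReal ?_
  simp only [gaussianPDFReal]
  have e1 : (√(2 * π * (v : ℝ)))⁻¹ = (√(2 * π))⁻¹ * √r := by
    rw [hvr, Real.sqrt_mul (by positivity), Real.sqrt_inv, mul_inv, inv_inv]
  have e2 : Real.exp (1 / 2 * Real.log r) = √r := by
    rw [mul_comm, Real.sqrt_eq_rpow, Real.rpow_def_of_pos hr0]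
  simp only [NNReal.coe_one, mul_one]
  rw [e1, ← e2, mul_assoc, mul_assoc, ← Real.exp_add, ← Real.exp_add]
  refine mul_le_mul_of_nonneg_left (Real.exp_le_exp.2 ?_) (by positivity)
  simp only [j1, ← hr]
  have hmm := min_add_max θ s
  have hq : √s * √s = s := Real.mul_self_sqrt hs.le
  set M := max θ s
  have hm : min θ s = θ + s - M := by linarith
  have hsM : s ≤ M := le_max_right _ _
  rw [hm]
  set q := √s
  have e3 : -(g - q * y / M)^2 / (2 * (v : ℝ)) = -(M * (g - q * y / M)^2 / (2 * θ)) := by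
    rw [hvr, hr]; field_simp
  rw [e3]
  have e4 : M * (g - q * y / M)^2 / (2*θ) = (M * g^2 - 2 * q * y * g + (q * q) * y^2 / M) / (2 * θ) := by
    field_simp; ring
  have e5 : -(g - 0)^2 / 2 + ((θ + s - M) / (2 * θ) * (g^2 - 1) + 1/2 * Real.log r + 1 / (2 * θ) * (θ + s - M - (q * g - y)^2)) = 1/2 * Real.log r - (M * g^2 - 2 * q * y * g + y^2) / (2 * θ) := by
    have : (q * g - y)^2 = s * g^2 - 2 * q * g * y + y^2 := by rw [← hq]; ring
    rw [this]; field_simp; ring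
  rw [e4, e5, hq]
  have : s * y^2 / M ≤ y^2 := by
    rw [div_le_iff₀ hmx]; nlinarith [sq_nonneg y]
  have : (M * g^2 - 2 * q * y * g + s * y^2 / M) / (2 * θ) ≤ (M * g^2 - 2 * q * y * g + y^2) / (2 * θ) := by
    gcongr
  linarith

lemma jt_meas {n : ℕ} (θ : ℝ) (s : Fin n → ℝ) : Measurable (jt θ s) := by
  unfold jt j1; fun_prop

lemma one_word {n : ℕ} {θ : ℝ} {s : Fin n → ℝ} (hθ : 0 < θ) (hs : ∀ i, 0 < s i) (y : Fin n → ℝ)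
    (L D : ℝ) : gam n {g | L ≤ jt θ s g ∧ ∑ i, (√(s i) * g i - y i)^2 ≤ D} ≤
      ENNReal.ofReal (Real.exp (-L + (D - ∑ i, min θ (s i)) / (2 * θ))) := by
  have h := lintegral_pi_prod (fun _ : Fin n => gaussianReal 0 1)
    (fun i g => ENNReal.ofReal (Real.exp (j1 θ (s i) g + (1 / (2 * θ)) * (min θ (s i) - (√(s i) * g - y i)^2))))
    (fun i => by unfold j1; fun_prop)
  have h2 : ∏ i, ∫⁻ g, ENNReal.ofReal (Real.exp (j1 θ (s i) g + (1 / (2 * θ)) * (min θ (s i) - (√(s i) * g - y i)^2)))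
      ∂(gaussianReal 0 1) ≤ 1 := Finset.prod_le_one' fun i _ => one_dim hθ (hs i) (y i)
  rw [← h] at h2
  set c := ENNReal.ofReal (Real.exp (-L + (D - ∑ i, min θ (s i)) / (2 * θ))) with hc
  calc _ ≤ ∫⁻ g, c * (∏ i, ENNReal.ofReal (Real.exp (j1 θ (s i) (g i) + (1 / (2 * θ)) * (min θ (s i) - (√(s i) * g i - y i)^2)))) ∂(gam n) := by
        refine meas_le_lintegral₀ ?_ ?_
        · refine (Measurable.const_mul ?_ _).aemeasurable
          refine Finset.measurable_prod _ fun i _ => ?_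
          unfold j1; fun_prop
        · rintro g ⟨h3, h4⟩
          rw [← ENNReal.ofReal_prod_of_nonneg (fun i _ => (Real.exp_pos _).le), ← Real.exp_sum, hc,
            ← ENNReal.ofReal_mul (Real.exp_pos _).le, ← Real.exp_add]
          refine ENNReal.one_le_ofReal.2 (Real.one_le_exp ?_)
          rw [Finset.sum_add_distrib, ← Finset.mul_sum, Finset.sum_sub_distrib]
          unfold jt at h3
          have : (D - ∑ i, min θ (s i)) / (2 * θ) + 1 / (2 * θ) * (∑ i, min θ (s i) - ∑ i, (√(s i) * g i - y i)^2) = (D - ∑ i, (√(s i) * g i - y i)^2) / (2 * θ) := by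
            field_simp; ring
          have h5 : 0 ≤ (D - ∑ i, (√(s i) * g i - y i)^2) / (2 * θ) := by
            apply div_nonneg; linarith; positivity
          linarith
    _ = c * ∫⁻ g, (∏ i, ENNReal.ofReal (Real.exp (j1 θ (s i) (g i) + (1 / (2 * θ)) * (min θ (s i) - (√(s i) * g i - y i)^2)))) ∂(gam n) := by
        refine lintegral_const_mul _ ?_
        refine Finset.measurable_prod _ fun i _ => ?_
        unfold j1; fun_prop
    _ ≤ c * 1 := by gcongr; exact h2
    _ = c := mul_one _

theorem converse {n M : ℕ} {θ d : ℝ} {s : Fin n → ℝ} (hθ : 0 < θ) (hs : ∀ i, 0 < s i)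
    (c : Fin M → Fin n → ℝ) (L : ℝ) :
    gam n {g | L ≤ jt θ s g} ≤ gam n (fail s d c) +
      ENNReal.ofReal (M * Real.exp (-L + (n * d - ∑ i, min θ (s i)) / (2 * θ))) := by
  have hsub : {g | L ≤ jt θ s g} ⊆ fail s d c ∪ ⋃ j, {g | L ≤ jt θ s g ∧ ∑ i, (√(s i) * g i - c j i)^2 ≤ n * d} := by
    intro g hg
    by_cases h : g ∈ fail s d c
    · exact Or.inl h
    · right
      simp only [fail, Set.mem_ofPred_eq, not_forall, not_lt] at h
      obtain ⟨j, hj⟩ := h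
      exact Set.mem_iUnion.2 ⟨j, hg, hj⟩
  refine (measure_mono hsub).trans ((measure_union_le _ _).trans ?_)
  gcongr
  refine (measure_iUnion_le _).trans ?_
  rw [tsum_fintype]
  refine (Finset.sum_le_sum fun j _ => one_word hθ hs (c j) L _).trans ?_
  simp only [Finset.sum_const, Finset.card_univ, Fintype.card_fin, nsmul_eq_mul]
  rw [ENNReal.ofReal_mul (by positivity)]
  simp

end GMP

namespace GMP

lemma deriv_pF {p q : ℝ → ℝ} (h : ∀ t, HasDerivAt p (q t) t) :
    deriv (fun t => p t * Real.exp (t^2/2)) = fun t => (q t + t * p t) * Real.exp (t^2/2) := by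
  funext t
  have h2 : HasDerivAt (fun t : ℝ => Real.exp (t^2/2)) (Real.exp (t^2/2) * t) t := by
    have : HasDerivAt (fun t : ℝ => t^2/2) t t := by
      have := (hasDerivAt_pow 2 t).div_const 2
      simpa using this
    exact this.exp
  have h3 : HasDerivAt (fun t => p t * Real.exp (t^2/2)) (q t * Real.exp (t^2/2) + p t * (Real.exp (t^2/2) * t)) t := (h t).mul h2
  rw [h3.deriv]; ring

lemma iter4 : iteratedDeriv 1 (fun t : ℝ => Real.exp (t^2/2)) = (fun t => t * Real.exp (t^2/2)) ∧
    iteratedDeriv 2 (fun t : ℝ => Real.exp (t^2/2)) = (fun t => (1 + t * t) * Real.exp (t^2/2)) ∧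
    iteratedDeriv 3 (fun t : ℝ => Real.exp (t^2/2)) = (fun t => (3*t + t^3) * Real.exp (t^2/2)) ∧
    iteratedDeriv 4 (fun t : ℝ => Real.exp (t^2/2)) = (fun t => (3 + 6 * t^2 + t^4) * Real.exp (t^2/2)) := by
  have h1 : iteratedDeriv 1 (fun t : ℝ => Real.exp (t^2/2)) = (fun t => t * Real.exp (t^2/2)) := by
    rw [iteratedDeriv_one]
    have := deriv_pF (p := fun _ => 1) (q := fun _ => 0) (fun t => hasDerivAt_const _ _)
    simpa using this
  have h2 : iteratedDeriv 2 (fun t : ℝ => Real.exp (t^2/2)) = (fun t => (1 + t * t) * Real.exp (t^2/2)) := by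
    rw [iteratedDeriv_succ, h1, deriv_pF (p := fun t => t) (q := fun _ => 1) (fun t => hasDerivAt_id _)]
  have h3 : iteratedDeriv 3 (fun t : ℝ => Real.exp (t^2/2)) = (fun t => (3*t + t^3) * Real.exp (t^2/2)) := by
    rw [iteratedDeriv_succ, h2, deriv_pF (p := fun t => 1 + t * t) (q := fun t => 2 * t)]
    · funext t; ring
    · intro t
      have : HasDerivAt (fun t : ℝ => 1 + t * t) (1 * t + t * 1) t :=
        ((hasDerivAt_id t).mul (hasDerivAt_id t)).const_add 1
      have e : 2 * t = 1 * t + t * 1 := by ring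
      rw [e]; exact this
  refine ⟨h1, h2, h3, ?_⟩
  rw [iteratedDeriv_succ, h3, deriv_pF (p := fun t => 3 * t + t^3) (q := fun t => 3 + 3 * t^2)]
  · funext t; ring
  · intro t
    have : HasDerivAt (fun t : ℝ => 3 * t + t^3) (3 * 1 + ((3 : ℕ) : ℝ) * t^(3-1)) t :=
      ((hasDerivAt_id t).const_mul 3).add (hasDerivAt_pow 3 t)
    have e : 3 + 3 * t^2 = 3 * 1 + ((3 : ℕ) : ℝ) * t^(3-1) := by norm_num
    rw [e]; exact this

abbrev γ1 : Measure ℝ := gaussianReal 0 1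

lemma moments : ∫ x, x ∂γ1 = 0 ∧ ∫ x, x^2 ∂γ1 = 1 ∧ ∫ x, x^3 ∂γ1 = 0 ∧ ∫ x, x^4 ∂γ1 = 3 := by
  have h : ∀ k : ℕ, ∫ x, x^k ∂γ1 = iteratedDeriv k (fun t : ℝ => Real.exp (t^2/2)) 0 := by
    intro k
    have := iteratedDeriv_mgf_zero (X := fun x : ℝ => x) (μ := γ1) (by simp) k
    rw [mgf_fun_id_gaussianReal] at this
    simp only [zero_mul, zero_add, NNReal.coe_one, one_mul] at this
    rw [this]; rfl
  obtain ⟨h1, h2, h3, h4⟩ := iter4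
  refine ⟨by simp, ?_, ?_, ?_⟩
  · rw [h, h2]; simp
  · rw [h, h3]; simp
  · rw [h, h4]; simp

lemma int_pow (k : ℕ) : Integrable (fun x : ℝ => x^k) γ1 := by
  have := (memLp_id_gaussianReal (μ := 0) (v := 1) k).integrable_norm_pow'
  refine this.mono (by fun_prop) (Eventually.of_forall fun x => ?_)
  simp

lemma memLp_quad (α γ : ℝ) : MemLp (fun x : ℝ => α * x + γ * (x^2 - 1)) 2 γ1 := by
  rw [memLp_two_iff_integrable_sq (by fun_prop)]
  have : (fun x : ℝ => (α * x + γ * (x^2-1))^2) = fun x => γ^2 * x^4 + 2 * α * γ * x^3 + (α^2 - 2 * γ^2) * x^2 + (-2 * α * γ) * x^1 + γ^2 * x^0 := by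
    funext x; ring
  rw [this]
  exact (((((int_pow 4).const_mul _).add ((int_pow 3).const_mul _)).add ((int_pow 2).const_mul _)).add ((int_pow 1).const_mul _)).add ((int_pow 0).const_mul _)

lemma mean_quad (α γ : ℝ) : ∫ x, (α * x + γ * (x^2 - 1)) ∂γ1 = 0 := by
  obtain ⟨h1, h2, -, -⟩ := moments
  have i1 : Integrable (fun x : ℝ => α * x) γ1 := by simpa using (int_pow 1).const_mul α
  have i2 : Integrable (fun x : ℝ => γ * (x^2 - 1)) γ1 := ((int_pow 2).sub (integrable_const 1)).const_mul _
  rw [integral_add i1 i2, integral_const_mul, integral_const_mul, integral_sub (int_pow 2) (integrable_const 1), h1, h2]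
  simp

lemma var_quad (α γ : ℝ) : Var[fun x : ℝ => α * x + γ * (x^2 - 1); γ1] = α^2 + 2 * γ^2 := by
  rw [variance_of_integral_eq_zero (by fun_prop) (mean_quad α γ)]
  have e : (fun x : ℝ => (α * x + γ * (x^2-1))^2) = fun x => γ^2 * x^4 + (2 * α * γ * x^3 + ((α^2 - 2 * γ^2) * x^2 + ((-2 * α * γ) * x + γ^2))) := by
    funext x; ring
  obtain ⟨h1, h2, h3, h4⟩ := moments
  have j4 := (int_pow 4).const_mul (γ^2)
  have j3 := (int_pow 3).const_mul (2 * α * γ)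
  have j2 := (int_pow 2).const_mul (α^2 - 2 * γ^2)
  have j1 : Integrable (fun x : ℝ => (-2 * α * γ) * x) γ1 := by simpa using (int_pow 1).const_mul (-2 * α * γ)
  have j0 : Integrable (fun x : ℝ => γ^2) γ1 := integrable_const _
  have k1 : Integrable (fun x : ℝ => (-2 * α * γ) * x + γ^2) γ1 := j1.add j0
  have k2 : Integrable (fun x : ℝ => (α^2 - 2 * γ^2) * x^2 + ((-2 * α * γ) * x + γ^2)) γ1 := j2.add k1
  have k3 : Integrable (fun x : ℝ => 2 * α * γ * x^3 + ((α^2 - 2 * γ^2) * x^2 + ((-2 * α * γ) * x + γ^2))) γ1 := j3.add k2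
  rw [e, integral_add j4 k3, integral_add j3 k2, integral_add j2 k1, integral_add j1 j0]
  have z1 : ∫ x, (-2 * α * γ) * x ∂γ1 = 0 := by rw [integral_const_mul, h1, mul_zero]
  rw [z1]
  simp only [integral_const_mul, h2, h3, h4, integral_const]
  simp; ring

lemma cheb {n : ℕ} (α γ : Fin n → ℝ) {V c : ℝ} (hc : 0 < c) (hV : ∑ i, (α i^2 + 2 * γ i^2) ≤ V) :
    gam n {g | c ≤ |∑ i, (α i * g i + γ i * ((g i)^2 - 1))|} ≤ ENNReal.ofReal (V / c^2) := by
  have hm : ∀ i, MemLp (fun x : ℝ => α i * x + γ i * (x^2 - 1)) 2 γ1 := fun i => memLp_quad _ _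
  have hv := variance_sum_pi (μ := fun _ : Fin n => γ1) hm
  have e : (∑ i, fun g : Fin n → ℝ => α i * g i + γ i * ((g i)^2 - 1)) = 
    fun g => ∑ i, (α i * g i + γ i * ((g i)^2 - 1)) := by funext g; simp
  rw [e] at hv
  simp only [var_quad] at hv
  have hL : ∀ i, MemLp (fun g : Fin n → ℝ => α i * g i + γ i * ((g i)^2 - 1)) 2 (gam n) := 
    fun i => (hm i).comp_measurePreserving (measurePreserving_eval (fun _ : Fin n => γ1) i)
  have hL2 : MemLp (fun g : Fin n → ℝ => ∑ i, (α i * g i + γ i * ((g i)^2 - 1))) 2 (gam n) := 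
    memLp_finsetSum _ fun i _ => hL i
  have h0 : ∫ g, ∑ i, (α i * g i + γ i * ((g i)^2 - 1)) ∂(gam n) = 0 := by
    rw [integral_finsetSum _ fun i _ => (hL i).integrable (by norm_num)]
    refine Finset.sum_eq_zero fun i _ => ?_
    rw [gam, integral_comp_eval (μ := fun _ : Fin n => γ1) (f := fun x => α i * x + γ i * (x^2 - 1)) (hm i).1]
    exact mean_quad _ _
  have := meas_ge_le_variance_div_sq hL2 hc
  rw [h0] at this
  simp only [sub_zero] at this
  refine this.trans (ENNReal.ofReal_le_ofReal ?_)
  gcongr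
  rw [gam, hv]; exact hV

/-- greedy covering -/
lemma covering {n : ℕ} (B : Set ((Fin n → ℝ) × (Fin n → ℝ))) (hB : MeasurableSet B)
    (G : Set (Fin n → ℝ)) (hG : MeasurableSet G) {p : ℝ} (hp0 : 0 ≤ p) (hp1 : p ≤ 1)
    (hp : ∀ h ∈ G, ENNReal.ofReal p ≤ gam n {g | (h, g) ∈ B}) (M : ℕ) :
    ∃ c : Fin M → Fin n → ℝ, gam n (G ∩ {h | ∀ j, (h, c j) ∉ B}) ≤ ENNReal.ofReal ((1 - p)^M) := by
  induction M with
  | zero => exact ⟨Fin.elim0, by simpa using prob_le_one⟩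
  | succ M ih =>
    obtain ⟨c, hc⟩ := ih
    set E := G ∩ {h | ∀ j, (h, c j) ∉ B} with hE
    have hsec : ∀ y, MeasurableSet {h | (h, y) ∈ B} := fun y => hB.preimage (by fun_prop)
    have hEm : MeasurableSet E := by
      refine hG.inter ?_
      have : {h | ∀ j, (h, c j) ∉ B} = ⋂ j, {h | (h, c j) ∈ B}ᶜ := by ext; simp
      rw [this]
      exact MeasurableSet.iInter fun j => (hsec _).compl
    have hB' : MeasurableSet (B ∩ (E ×ˢ Set.univ)) := hB.inter (hEm.prod MeasurableSet.univ)
    have f1 := Measure.prod_apply (μ := gam n) (ν := gam n) hB'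
    have f2 := Measure.prod_apply_symm (μ := gam n) (ν := gam n) hB'
    have low : ENNReal.ofReal p * gam n E ≤ (gam n).prod (gam n) (B ∩ (E ×ˢ Set.univ)) := by
      rw [f1, ← setLIntegral_const, ← lintegral_indicator hEm]
      refine lintegral_mono fun h => ?_
      by_cases hh : h ∈ E
      · rw [Set.indicator_of_mem hh]
        refine (hp h hh.1).trans (measure_mono ?_)
        intro g hg; exact ⟨hg, hh, trivial⟩
      · rw [Set.indicator_of_notMem hh]; exact zero_le
    obtain ⟨y, hy⟩ : ∃ y, ENNReal.ofReal p * gam n E ≤ gam n ((fun h => (h, y)) ⁻¹' (B ∩ (E ×ˢ Set.univ))) := by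
      by_contra hcon
      push Not at hcon
      have : (gam n).prod (gam n) (B ∩ (E ×ˢ Set.univ)) < ENNReal.ofReal p * gam n E := by
        rw [f2]
        have hfin : ∫⁻ y, gam n ((fun h => (h, y)) ⁻¹' (B ∩ (E ×ˢ Set.univ))) ∂(gam n) ≠ ∞ := by
          rw [← f2]; exact measure_ne_top _ _
        have := lintegral_strict_mono (μ := gam n) (f := fun y => gam n ((fun h => (h, y)) ⁻¹' (B ∩ (E ×ˢ Set.univ)))) (g := fun _ => ENNReal.ofReal p * gam n E) (IsProbabilityMeasure.ne_zero _) aemeasurable_const hfin (Eventually.of_forall hcon)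
        simpa using this
      exact absurd low (not_le.2 this)
    have e1 : (fun h => (h, y)) ⁻¹' (B ∩ (E ×ˢ Set.univ)) = E ∩ {h | (h, y) ∈ B} := by
      ext h; simp [and_comm]
    rw [e1] at hy
    refine ⟨Fin.cons y c, ?_⟩
    have e2 : G ∩ {h | ∀ j : Fin (M+1), (h, (Fin.cons y c : Fin (M+1) → Fin n → ℝ) j) ∉ B} = E \ (E ∩ {h | (h, y) ∈ B}) := by
      ext h; simp only [hE, Fin.forall_fin_succ, Fin.cons_zero, Fin.cons_succ, Set.mem_inter_iff, Set.mem_ofPred_eq, Set.mem_sdiff]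
      tauto
    rw [e2, measure_sdiff Set.inter_subset_left (hEm.inter (hsec y)).nullMeasurableSet (measure_ne_top _ _)]
    calc gam n E - gam n (E ∩ {h | (h, y) ∈ B}) ≤ gam n E - ENNReal.ofReal p * gam n E := by gcongr
      _ = ENNReal.ofReal (1 - p) * gam n E := by
          rw [ENNReal.ofReal_sub _ hp0, ENNReal.sub_mul (fun _ _ => measure_ne_top _ _)]; simp
      _ ≤ ENNReal.ofReal (1 - p) * ENNReal.ofReal ((1 - p)^M) := by gcongr
      _ = _ := by rw [← ENNReal.ofReal_mul (by linarith), pow_succ']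

end GMP

namespace GMP

def rho (r q g : ℝ) : ℝ := r * Real.exp (g^2/2 - (r * g + q)^2/2)

lemma rho_pos {r : ℝ} (hr : 0 < r) (q g : ℝ) : 0 < rho r q g := by unfold rho; positivity

lemma rho_meas (r q : ℝ) : Measurable (rho r q) := by unfold rho; fun_prop

lemma aff_cm {r : ℝ} (hr : 0 < r) (q : ℝ) :
    γ1 = (γ1.withDensity (fun g => ENNReal.ofReal (rho r q g))).map (fun g => r * g + q) := by
  have hm : Measurable fun g : ℝ => r * g + q := by fun_prop
  have hρ : Measurable fun g => ENNReal.ofReal (rho r q g) := (rho_meas r q).ennreal_ofReal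
  refine Measure.ext_of_lintegral _ fun f hf => ?_
  have hfm : Measurable fun g => f (r * g + q) := hf.comp hm
  rw [lintegral_map hf hm, lintegral_withDensity_eq_lintegral_mul _ hρ hfm]
  obtain ⟨v, hv⟩ : ∃ v : ℝ≥0, (v : ℝ) = r^2 := ⟨Real.toNNReal (r^2), Real.coe_toNNReal _ (by positivity)⟩
  have hv0 : v ≠ 0 := by
    rintro rfl
    have : 0 < r^2 := by positivity
    rw [← hv] at this; simp at this
  have hmap : γ1.map (fun g => r * g + q) = gaussianReal q v := by
    have e : (fun g : ℝ => r * g + q) = (fun x => x + q) ∘ (fun g => r * g) := rfl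
    rw [e, ← Measure.map_map (by fun_prop) (by fun_prop), gaussianReal_map_const_mul, gaussianReal_map_add_const]
    congr 1
    · simp
    · rw [mul_one]; ext; rw [hv]; rfl
  have hF : Measurable fun y => f y * ENNReal.ofReal (rho r q ((y - q)/r)) := by
    refine hf.mul ?_
    exact ((rho_meas r q).comp (by fun_prop)).ennreal_ofReal
  have : ∫⁻ g, ((fun g => ENNReal.ofReal (rho r q g)) * (fun g => f (r * g + q))) g ∂γ1 = 
      ∫⁻ y, f y * ENNReal.ofReal (rho r q ((y - q)/r)) ∂(γ1.map (fun g => r * g + q)) := by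
    rw [lintegral_map hF hm]
    refine lintegral_congr fun g => ?_
    have : (r * g + q - q) / r = g := by field_simp; ring
    rw [this]
    simp only [Pi.mul_apply]; rw [mul_comm]
  refine Eq.trans ?_ this.symm
  rw [hmap, γ1, gaussianReal_of_var_ne_zero 0 one_ne_zero, gaussianReal_of_var_ne_zero q hv0,
    lintegral_withDensity_eq_lintegral_mul _ (measurable_gaussianPDF _ _) hf,
    lintegral_withDensity_eq_lintegral_mul _ (measurable_gaussianPDF _ _) hF]
  refine lintegral_congr fun y => ?_
  simp only [Pi.mul_apply, gaussianPDF]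
  rw [mul_comm, mul_comm (ENNReal.ofReal (gaussianPDFReal q v y)), mul_assoc, ← ENNReal.ofReal_mul (rho_pos hr _ _).le]
  congr 2
  simp only [gaussianPDFReal, rho, hv]
  have e1 : r * ((y - q)/r) + q = y := by field_simp; ring
  rw [e1]
  have e2 : √(2 * π * r^2) = √(2 * π) * r := by
    rw [Real.sqrt_mul (by positivity), Real.sqrt_sq hr.le]
  rw [e2]
  simp only [NNReal.coe_one, mul_one]
  have e3 : r * Real.exp (((y-q)/r)^2/2 - y^2/2) * ((√(2 * π) * r)⁻¹ * Real.exp (-(y-q)^2/(2 * r^2))) =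
     (√(2*π))⁻¹ * (Real.exp (((y-q)/r)^2/2 - y^2/2) * Real.exp (-(y-q)^2/(2 * r^2))) := by
    field_simp
  rw [e3, ← Real.exp_add]
  congr 2
  field_simp; ring

lemma pi_withDensity {n : ℕ} (f : Fin n → ℝ → ℝ≥0∞) (hf : ∀ i, Measurable (f i))
    [∀ i, IsProbabilityMeasure (γ1.withDensity (f i))] :
    Measure.pi (fun i => γ1.withDensity (f i)) = (gam n).withDensity (fun g => ∏ i, f i (g i)) := by
  refine Measure.pi_eq fun s hs => ?_
  have hbox : MeasurableSet (Set.univ.pi s) := MeasurableSet.univ_pi hs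
  rw [withDensity_apply _ hbox, ← lintegral_indicator hbox]
  have : ∀ g : Fin n → ℝ, (Set.univ.pi s).indicator (fun g => ∏ i, f i (g i)) g = ∏ i, (s i).indicator (f i) (g i) := by
    intro g
    classical
    by_cases h : g ∈ Set.univ.pi s
    · rw [Set.indicator_of_mem h]
      refine Finset.prod_congr rfl fun i _ => ?_
      rw [Set.indicator_of_mem (h i trivial)]
    · rw [Set.indicator_of_notMem h]
      simp only [Set.mem_pi, Set.mem_univ, true_implies, not_forall] at h
      obtain ⟨i, hi⟩ := h
      rw [Finset.prod_eq_zero (Finset.mem_univ i) (Set.indicator_of_notMem hi _)]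
  simp only [this]
  rw [gam, lintegral_pi_prod (fun _ => γ1) _ (fun i => (hf i).indicator (hs i))]
  refine Finset.prod_congr rfl fun i _ => ?_
  rw [lintegral_indicator (hs i), withDensity_apply _ (hs i)]

lemma shift_bound {n : ℕ} {r q : Fin n → ℝ} (hr : ∀ i, 0 < r i) {A B : Set (Fin n → ℝ)}
    (hA : MeasurableSet A) (hB : MeasurableSet B) {c : ℝ}
    (hAB : ∀ g ∈ A, (fun i => r i * g i + q i) ∈ B)
    (hc : ∀ g ∈ A, c ≤ ∏ i, rho (r i) (q i) (g i)) :
    ENNReal.ofReal c * gam n A ≤ gam n B := by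
  set f : Fin n → ℝ → ℝ≥0∞ := fun i g => ENNReal.ofReal (rho (r i) (q i) g)
  have hf : ∀ i, Measurable (f i) := fun i => (rho_meas _ _).ennreal_ofReal
  have hone : ∀ i, γ1 = (γ1.withDensity (f i)).map (fun g => r i * g + q i) := fun i => aff_cm (hr i) (q i)
  have hmm : ∀ i, Measurable (fun g => r i * g + q i) := fun i => by fun_prop
  have hprob : ∀ i, IsProbabilityMeasure (γ1.withDensity (f i)) := by
    intro i
    constructor
    have := congrArg (fun μ : Measure ℝ => μ Set.univ) (hone i)
    simp only [measure_univ] at this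
    rw [Measure.map_apply (hmm i) MeasurableSet.univ] at this
    simpa using this.symm
  have hgam : gam n = ((gam n).withDensity (fun g => ∏ i, f i (g i))).map (fun g i => r i * g i + q i) := by
    rw [← pi_withDensity f hf, Measure.pi_map_pi (fun i => (hmm i).aemeasurable)]
    unfold gam
    congr 1; funext i; exact hone i
  have hM : Measurable (fun (g : Fin n → ℝ) i => r i * g i + q i) := by fun_prop
  conv_rhs => rw [hgam]
  rw [Measure.map_apply hM hB]
  calc ENNReal.ofReal c * gam n A = ∫⁻ g in A, ENNReal.ofReal c ∂(gam n) := by rw [setLIntegral_const]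
    _ ≤ ∫⁻ g in A, ∏ i, f i (g i) ∂(gam n) := by
        refine setLIntegral_mono' hA fun g hg => ?_
        simp only [f]
        rw [← ENNReal.ofReal_prod_of_nonneg (fun i _ => (rho_pos (hr i) _ _).le)]
        exact ENNReal.ofReal_le_ofReal (hc g hg)
    _ = ((gam n).withDensity (fun g => ∏ i, f i (g i))) A := (withDensity_apply _ hA).symm
    _ ≤ _ := measure_mono hAB

end GMP

namespace GMP

def rr (θ s : ℝ) : ℝ := √(min θ s / s)
def kap (θ s : ℝ) : ℝ := √(max 0 (s - θ))
def kk (θ s : ℝ) : ℝ := kap θ s / √s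
def bb (θ s h : ℝ) : ℝ := min θ s / √s * h
def tau (θ s : ℝ) : ℝ := kap θ s * rr θ s

variable {θ s : ℝ}

lemma rr_pos (hθ : 0 < θ) (hs : 0 < s) : 0 < rr θ s := by
  have : 0 < min θ s := lt_min hθ hs
  unfold rr; positivity

lemma rr_sq (hθ : 0 < θ) (hs : 0 < s) : rr θ s ^ 2 = min θ s / s := by
  have : 0 < min θ s := lt_min hθ hs
  unfold rr; rw [Real.sq_sqrt (by positivity)]

lemma kap_sq : kap θ s ^ 2 = max 0 (s - θ) := Real.sq_sqrt (le_max_left _ _)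

lemma kap_sq' : kap θ s ^ 2 = s - min θ s := by
  rw [kap_sq]
  rcases le_total θ s with h | h
  · rw [max_eq_right (by linarith), min_eq_left h]
  · rw [max_eq_left (by linarith), min_eq_right h]; ring

lemma tau_nonneg : 0 ≤ tau θ s := mul_nonneg (Real.sqrt_nonneg _) (Real.sqrt_nonneg _)

lemma tau_sq (hθ : 0 < θ) (hs : 0 < s) : tau θ s ^ 2 = min θ s * (1 - min θ s / s) := by
  unfold tau; rw [mul_pow, rr_sq hθ hs, kap_sq']; field_simp

lemma tau_sq_le (hθ : 0 < θ) (hs : 0 < s) : tau θ s ^ 2 ≤ θ := by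
  rw [tau_sq hθ hs]
  have h1 : 0 < min θ s := lt_min hθ hs
  have h2 : min θ s ≤ θ := min_le_left _ _
  have : 0 < min θ s / s := by positivity
  nlinarith

lemma err_eq (hs : 0 < s) (h u : ℝ) :
    √s * h - kap θ s * (rr θ s * u + kk θ s * h) = bb θ s h - tau θ s * u := by
  have h2 := kap_sq' (θ := θ) (s := s)
  have hq : √s ^ 2 = s := Real.sq_sqrt hs.le
  have hq0 : 0 < √s := Real.sqrt_pos.2 hs
  have : kap θ s * (kk θ s * h) = (s - min θ s) / √s * h := by
    rw [← h2]; unfold kk; ring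
  have e : s / √s = √s := by rw [div_eq_iff hq0.ne']; linarith
  unfold bb tau
  rw [mul_add, this, sub_div, e]; ring

lemma log_id (hθ : 0 < θ) (hs : 0 < s) (h u : ℝ) :
    rr θ s * Real.exp (u^2/2 - (rr θ s * u + kk θ s * h)^2/2) =
    Real.exp (-j1 θ s h - (1 / (2 * θ)) * (min θ s - (bb θ s h - tau θ s * u)^2)) := by
  have hm : 0 < min θ s := lt_min hθ hs
  have hM : 0 < max θ s := lt_max_of_lt_left hθ
  have hmM : min θ s * max θ s = θ * s := min_mul_max θ s
  have e0 : rr θ s = Real.exp (-(1/2 * Real.log (max θ s / θ))) := by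
    have : min θ s / s = (max θ s / θ)⁻¹ := by
      rw [inv_div, div_eq_div_iff hs.ne' hM.ne']; exact hmM
    unfold rr
    rw [this, Real.sqrt_inv, Real.exp_neg, mul_comm, Real.sqrt_eq_rpow, Real.rpow_def_of_pos (by positivity)]
  have e1 : rr θ s * Real.exp (u^2/2 - (rr θ s * u + kk θ s * h)^2/2) = 
     Real.exp (-(1/2 * Real.log (max θ s / θ)) + (u^2/2 - (rr θ s * u + kk θ s * h)^2/2)) := by
    rw [Real.exp_add, ← e0]
  rw [e1]
  congr 1
  unfold j1
  have hq : √s ^ 2 = s := Real.sq_sqrt hs.le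
  have hq0 : 0 < √s := Real.sqrt_pos.2 hs
  have hr2 := rr_sq hθ hs
  have hk2 := kap_sq' (θ := θ) (s := s)
  have ex1 : (rr θ s * u + kk θ s * h)^2 = rr θ s ^2 * u^2 + 2 * (rr θ s * kap θ s) / √s * u * h + kap θ s ^ 2 / √s ^ 2 * h^2 := by
    unfold kk; field_simp; ring
  have ex2 : (bb θ s h - tau θ s * u)^2 = min θ s ^ 2 / √s ^ 2 * h^2 - 2 * min θ s * (rr θ s * kap θ s) / √s * u * h + kap θ s ^ 2 * rr θ s ^2 * u^2 := by
    unfold bb tau; field_simp; ring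
  rw [ex1, ex2, hr2, hk2, hq]
  rcases le_total θ s with hc | hc
  · rw [min_eq_left hc]
    field_simp
    ring
  · have hk0 : kap θ s = 0 := by
      unfold kap; rw [max_eq_left (by linarith)]; simp
    rw [min_eq_right hc, hk0]
    field_simp
    ring

lemma rho_id (hθ : 0 < θ) (hs : 0 < s) (h v g : ℝ) :
    rho (rr θ s) (kk θ s * h + rr θ s * v) g =
    Real.exp (-j1 θ s h - (1 / (2 * θ)) * (min θ s - (bb θ s h - tau θ s * (g + v))^2) - v * g - v^2/2) := by
  have e : -j1 θ s h - (1 / (2 * θ)) * (min θ s - (bb θ s h - tau θ s * (g + v))^2) - v * g - v^2/2 =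
    (-j1 θ s h - (1 / (2 * θ)) * (min θ s - (bb θ s h - tau θ s * (g + v))^2)) + (- v * g - v^2/2) := by ring
  rw [e, Real.exp_add, ← log_id hθ hs]
  unfold rho
  rw [mul_assoc, ← Real.exp_add]
  congr 2
  ring

def ball {n : ℕ} (θ : ℝ) (s : Fin n → ℝ) (D : ℝ) (h : Fin n → ℝ) : Set (Fin n → ℝ) :=
  {g | ∑ i, (√(s i) * h i - kap θ (s i) * g i)^2 ≤ D}

def SS1 {n : ℕ} (θ : ℝ) (s h g : Fin n → ℝ) : ℝ := ∑ i, (bb θ (s i) (h i) - tau θ (s i) * g i)^2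

lemma ball_meas {n : ℕ} (θ : ℝ) (s : Fin n → ℝ) (D : ℝ) (h : Fin n → ℝ) : MeasurableSet (ball θ s D h) := by
  have : Measurable fun g : Fin n → ℝ => ∑ i, (√(s i) * h i - kap θ (s i) * g i)^2 := by fun_prop
  exact measurableSet_le this measurable_const

lemma ball_shift {n : ℕ} {θ : ℝ} {s : Fin n → ℝ} (hθ : 0 < θ) (hs : ∀ i, 0 < s i) (h v : Fin n → ℝ)
    {A : Set (Fin n → ℝ)} (hA : MeasurableSet A) {D w K1 K2 : ℝ}
    (hA1 : ∀ g ∈ A, SS1 θ s h (fun i => g i + v i) ≤ D)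
    (hA2 : ∀ g ∈ A, D - w ≤ SS1 θ s h (fun i => g i + v i))
    (hA3 : ∀ g ∈ A, ∑ i, v i * g i ≤ K1) (hK2 : ∑ i, (v i)^2 ≤ K2) :
    ENNReal.ofReal (Real.exp (-jt θ s h - (1 / (2*θ)) * (∑ i, min θ (s i) - D + w) - K1 - K2/2)) * gam n A ≤
      gam n (ball θ s D h) := by
  refine shift_bound (r := fun i => rr θ (s i)) (q := fun i => kk θ (s i) * h i + rr θ (s i) * v i)
    (fun i => rr_pos hθ (hs i)) hA (ball_meas _ _ _ _) ?_ ?_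
  · intro g hg
    have := hA1 g hg
    have e : ∀ i, √(s i) * h i - kap θ (s i) * (rr θ (s i) * g i + (kk θ (s i) * h i + rr θ (s i) * v i)) = bb θ (s i) (h i) - tau θ (s i) * (g i + v i) := by
      intro i; rw [← err_eq (hs i)]; ring
    show ∑ i, (√(s i) * h i - kap θ (s i) * (rr θ (s i) * g i + (kk θ (s i) * h i + rr θ (s i) * v i)))^2 ≤ D
    simp only [e]
    exact this
  · intro g hg
    simp only [rho_id hθ (hs _)]
    rw [← Real.exp_sum]
    refine Real.exp_le_exp.2 ?_
    have e : ∑ i, (-j1 θ (s i) (h i) - (1 / (2 * θ)) * (min θ (s i) - (bb θ (s i) (h i) - tau θ (s i) * (g i + v i))^2) - v i * g i - v i^2/2) = 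
      -jt θ s h - (1/(2*θ)) * (∑ i, min θ (s i) - SS1 θ s h (fun i => g i + v i)) - ∑ i, v i * g i - (∑ i, v i^2)/2 := by
      simp only [jt, SS1, Finset.sum_sub_distrib, Finset.mul_sum, Finset.sum_div, Finset.sum_neg_distrib, mul_sub]
    rw [e]
    have h1 := hA2 g hg
    have h2 := hA3 g hg
    have h3 : (1/(2*θ)) * (∑ i, min θ (s i) - SS1 θ s h (fun i => g i + v i)) ≤ (1 / (2*θ)) * (∑ i, min θ (s i) - D + w) := by
      gcongr; linarith
    linarith

end GMP

namespace GMP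

lemma cheb_real {n : ℕ} (α γ : Fin n → ℝ) {V c p : ℝ} (hc : 0 < c) (hV : ∑ i, (α i^2 + 2 * γ i^2) ≤ V)
    (hp : V ≤ p * c^2) :
    (gam n).real {g | c ≤ |∑ i, (α i * g i + γ i * ((g i)^2 - 1))|} ≤ p := by
  have h := cheb α γ hc hV
  have h0 : 0 ≤ ∑ i, (α i^2 + 2 * γ i^2) := Finset.sum_nonneg fun i _ => by positivity
  have h1 : V / c^2 ≤ p := by rw [div_le_iff₀ (by positivity)]; exact hp
  have h2 : 0 ≤ V / c^2 := div_nonneg (h0.trans hV) (by positivity)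
  exact (ENNReal.toReal_le_of_le_ofReal h2 h).trans h1

def WW {n : ℕ} (θ : ℝ) (s h : Fin n → ℝ) : ℝ := ∑ i, (bb θ (s i) (h i) * tau θ (s i))^2

lemma SS1_shift {n : ℕ} (θ : ℝ) (s h g : Fin n → ℝ) (ζ : ℝ) :
    SS1 θ s h (fun i => g i + ζ * (bb θ (s i) (h i) * tau θ (s i))) = SS1 θ s h g - 2 * ζ * WW θ s h
      + ∑ i, ((2 * ζ * (bb θ (s i) (h i) * tau θ (s i)) * tau θ (s i)^2) * g i + 0 * ((g i)^2 - 1))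
      + ζ^2 * ∑ i, (bb θ (s i) (h i) * tau θ (s i))^2 * tau θ (s i)^2 := by
  unfold SS1 WW
  simp only [Finset.mul_sum]
  rw [← Finset.sum_sub_distrib, ← Finset.sum_add_distrib, ← Finset.sum_add_distrib]
  refine Finset.sum_congr rfl fun i _ => ?_
  ring

lemma SS1_dev {n : ℕ} (θ : ℝ) (s h g : Fin n → ℝ) :
    SS1 θ s h g = ∑ i, (bb θ (s i) (h i) ^ 2 + tau θ (s i)^2) + 
      ∑ i, ((-2 * (bb θ (s i) (h i) * tau θ (s i))) * g i + tau θ (s i)^2 * ((g i)^2 - 1)) := by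
  unfold SS1
  rw [← Finset.sum_add_distrib]
  refine Finset.sum_congr rfl fun i _ => ?_
  ring

lemma pigeon {n N : ℕ} (S : (Fin n → ℝ) → ℝ) {x0 step t : ℝ} (hN0 : (0:ℝ) < N) (hx : 0 < step)
    (B : Set (Fin n → ℝ)) (hB : (gam n).real B ≤ 1/4) (ht : t ≤ N * step)
    (hS : ∀ g, g ∉ B → x0 ≤ S g ∧ S g < x0 + t) :
    ∃ k : Fin N, 3/(4 * N) ≤ (gam n).real {g | x0 + k * step ≤ S g ∧ S g ≤ x0 + k * step + step} := by
  by_contra hcon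
  push Not at hcon
  set bin : Fin N → Set (Fin n → ℝ) := fun k => {g | x0 + k * step ≤ S g ∧ S g ≤ x0 + k * step + step} with hbin
  have hcov : (Set.univ : Set (Fin n → ℝ)) ⊆ B ∪ ⋃ k, bin k := by
    intro g _
    by_cases hg : g ∈ B
    · exact Or.inl hg
    · right
      obtain ⟨l1, l2⟩ := hS g hg
      set z := (S g - x0) / step with hz
      have hz0 : 0 ≤ z := div_nonneg (by linarith) hx.le
      have hzN : z < N := by
        rw [hz, div_lt_iff₀ hx]; linarith
      have hzz : S g - x0 = z * step := by rw [hz]; field_simp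
      have f1 := mul_le_mul_of_nonneg_right (Nat.floor_le hz0) hx.le
      have f2 := mul_le_mul_of_nonneg_right (Nat.lt_floor_add_one z).le hx.le
      refine Set.mem_iUnion.2 ⟨⟨⌊z⌋₊, (Nat.floor_lt hz0).2 hzN⟩, ?_, ?_⟩
      · show x0 + (⌊z⌋₊ : ℝ) * step ≤ S g
        linarith
      · show S g ≤ x0 + (⌊z⌋₊ : ℝ) * step + step
        linarith
  have h1 := measureReal_mono (μ := gam n) hcov
  have h2 := (measureReal_union_le (μ := gam n) B (⋃ k, bin k))
  have h3 := measureReal_iUnion_fintype_le (μ := gam n) bin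
  have : Nonempty (Fin N) := ⟨⟨0, by exact_mod_cast hN0⟩⟩
  have h4 : ∑ k, (gam n).real (bin k) < ∑ k : Fin N, 3/(4 * (N:ℝ)) := Finset.sum_lt_sum_of_nonempty Finset.univ_nonempty fun k _ => hcon k
  have h5 : ∑ k : Fin N, 3/(4 * (N:ℝ)) = 3/4 := by simp; field_simp
  rw [h5] at h4
  simp at h1
  linarith

set_option maxHeartbeats 4000000 in
theorem ball_bound {θ δ K0 c Cw C : ℝ} (hθ : 0 < θ) (hδ : 0 < δ) (hK0 : 0 ≤ K0) (hc : 0 < c)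
    (hCw : 0 < Cw) : ∃ c0 : ℝ, 0 < c0 ∧ ∃ N0 : ℕ, ∀ n : ℕ, N0 ≤ n → ∀ (s h : Fin n → ℝ) (D : ℝ), 
      (∀ i, 0 < s i) → |∑ i, min θ (s i) - D| ≤ C → 
      |∑ i, (bb θ (s i) (h i) ^ 2 + tau θ (s i)^2) - D| ≤ K0 * √n →
      c * n ≤ WW θ s h → WW θ s h ≤ Cw * n →
      ENNReal.ofReal (c0 * Real.exp (-jt θ s h - (1/(2*θ)) * (δ * √n))) ≤ gam n (ball θ s D h) := by
  obtain ⟨K, hK, hKK⟩ : ∃ K : ℝ, 0 < K ∧ 4 * Cw + 2 * θ^2 = 1/4 * K^2 := by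
    refine ⟨√(4 * (4 * Cw + 2 * θ^2)), Real.sqrt_pos.2 (by positivity), ?_⟩
    rw [Real.sq_sqrt (by positivity)]; ring
  set K' := K + K0 with hK'
  have hK'0 : 0 < K' := by positivity
  obtain ⟨N, hN⟩ : ∃ N : ℕ, 4 * K' / δ < N := exists_nat_gt _
  have hN' : 2 * K' ≤ N * (δ/2) := by
    rw [div_lt_iff₀ hδ] at hN; linarith
  have hN0 : (0:ℝ) < N := lt_trans (by positivity) hN
  set K2 := K' + N * (δ/2) + δ with hK2
  have hK20 : 0 < K2 := by positivity
  set V1 := (θ^2 + 1) * K2^2 / c with hV1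
  have hV10 : 0 < V1 := by positivity
  obtain ⟨K1, hK1, hKK1⟩ : ∃ K : ℝ, 0 < K ∧ V1 = 1/(4*N) * K^2 := by
    refine ⟨√(4 * N * V1), Real.sqrt_pos.2 (by positivity), ?_⟩
    rw [Real.sq_sqrt (by positivity)]; field_simp
  set T := K1 + θ * (K2^2 / (4 * c)) with hT
  have hT0 : 0 < T := by positivity
  obtain ⟨N0, hN0'⟩ : ∃ N0 : ℕ, (4 * T / δ)^2 < N0 := exists_nat_gt _
  refine ⟨Real.exp (-(1/(2*θ)) * C - K1 - (K2^2/(4 * c))/2) * (1/(4 * N)), by positivity, N0, ?_⟩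
  intro n hn s h D hs hC hm0 hW1 hW2
  set R := √(n:ℝ) with hR
  have hnpos : (0:ℝ) < n := lt_of_lt_of_le (lt_of_le_of_lt (sq_nonneg _) hN0') (by exact_mod_cast hn)
  have hR0 : 0 < R := Real.sqrt_pos.2 hnpos
  have hR2 : R^2 = n := Real.sq_sqrt hnpos.le
  have hTR : T ≤ δ / 4 * R := by
    have : (4 * T/δ)^2 < R^2 := by rw [hR2]; exact lt_of_lt_of_le hN0' (by exact_mod_cast hn)
    have := lt_of_pow_lt_pow_left₀ 2 hR0.le this
    rw [div_lt_iff₀ hδ] at this; linarith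
  have hW0 : 0 < WW θ s h := lt_of_lt_of_le (by positivity) hW1
  have hτ : ∀ i, tau θ (s i)^2 ≤ θ := fun i => tau_sq_le hθ (hs i)
  set b : Fin n → ℝ := fun i => bb θ (s i) (h i) * tau θ (s i) with hb
  have hWb : WW θ s h = ∑ i, b i ^ 2 := rfl
  -- the deviation event
  have dev : (gam n).real {g | K * R ≤ |SS1 θ s h g - ∑ i, (bb θ (s i) (h i) ^ 2 + tau θ (s i)^2)|} ≤ 1/4 := by
    have := cheb_real (n := n) (fun i => -2 * b i) (fun i => tau θ (s i)^2) (V := (4 * Cw + 2 * θ^2) * n)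
      (c := K * R) (p := 1/4) (by positivity) ?_ ?_
    · simp only [SS1_dev θ s h, add_sub_cancel_left]; exact this
    · rw [Finset.sum_add_distrib]
      have e1 : ∑ i, (-2 * b i)^2 = 4 * WW θ s h := by
        rw [hWb, Finset.mul_sum]; exact Finset.sum_congr rfl fun i _ => by ring
      have e2 : ∑ i, 2 * (tau θ (s i)^2)^2 ≤ ∑ i : Fin n, 2 * θ^2 := by
        refine Finset.sum_le_sum fun i _ => ?_
        have := hτ i
        gcongr
      rw [e1]; simp at e2
      nlinarith
    · rw [hKK, mul_pow, hR2]; linarith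
  -- pigeonhole
  set bin : Fin N → Set (Fin n → ℝ) := fun k => {g | D - K' * R + k * (δ/2 * R) ≤ SS1 θ s h g ∧ 
     SS1 θ s h g ≤ D - K' * R + k * (δ/2 * R) + δ/2 * R} with hbin
  have hSm : Measurable (SS1 θ s h) := by unfold SS1; fun_prop
  have binm : ∀ k, MeasurableSet (bin k) := fun k => 
    (measurableSet_le measurable_const hSm).inter (measurableSet_le hSm measurable_const)
  obtain ⟨k, hk⟩ : ∃ k, 3/(4 * N) ≤ (gam n).real (bin k) := by
    refine pigeon (SS1 θ s h) (t := 2 * K' * R) hN0 (by positivity) _ dev ?_ ?_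
    · have := mul_le_mul_of_nonneg_right hN' hR0.le
      linarith
    · intro g hg
      have hg' : ¬ (K * R ≤ |SS1 θ s h g - ∑ i, (bb θ (s i) (h i) ^ 2 + tau θ (s i)^2)|) := hg
      rw [not_le, abs_lt] at hg'
      rw [abs_le] at hm0
      have e : K' * R = K * R + K0 * R := by rw [hK']; ring
      constructor
      · linarith [hg'.1, hm0.1]
      · linarith [hg'.2, hm0.2]
  set κ := -K' + k * (δ/2) + 3/4 * δ with hκ
  have hκ2 : κ^2 ≤ K2^2 := by
    have hkN : ((k : ℕ) : ℝ) ≤ N := by exact_mod_cast k.2.le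
    have hk0 : (0:ℝ) ≤ ((k : ℕ) : ℝ) := by positivity
    have : ((k : ℕ) : ℝ) * (δ/2) ≤ N * (δ/2) := by gcongr
    have : 0 ≤ ((k : ℕ) : ℝ) * (δ/2) := by positivity
    apply sq_le_sq'
    · rw [hκ, hK2]; linarith
    · rw [hκ, hK2]; linarith
  set ζ := R * κ / (2 * WW θ s h) with hζ
  have hζW : 2 * ζ * WW θ s h = R * κ := by rw [hζ]; field_simp
  have hζ2 : ζ^2 * WW θ s h ≤ K2^2 / (4 * c) := by
    have : ζ^2 * WW θ s h = n * κ^2 / (4 * WW θ s h) := by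
      rw [hζ, ← hR2]; field_simp; ring
    rw [this, div_le_div_iff₀ (by positivity) (by positivity)]
    calc n * κ^2 * (4 * c) = κ^2 * (4 * (c * n)) := by ring
      _ ≤ K2^2 * (4 * WW θ s h) := by gcongr
  set v : Fin n → ℝ := fun i => ζ * b i with hv
  have hv2 : ∑ i, v i^2 = ζ^2 * WW θ s h := by
    rw [hWb, Finset.mul_sum]; exact Finset.sum_congr rfl fun i _ => by simp only [hv]; ring
  have n1 := cheb_real (n := n) (fun i => 2 * ζ * b i * tau θ (s i)^2) (fun i => 0) (V := V1)
      (c := K1) (p := 1/(4 * N)) hK1 (by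
        calc ∑ i, ((2 * ζ * b i * tau θ (s i)^2)^2 + 2 * 0^2) = ∑ i, 4 * ζ^2 * b i^2 * (tau θ (s i)^2)^2 := 
              Finset.sum_congr rfl fun i _ => by ring
          _ ≤ ∑ i, 4 * ζ^2 * b i^2 * θ^2 := Finset.sum_le_sum fun i _ => by
              have := hτ i
              gcongr
          _ = 4 * θ^2 * (ζ^2 * WW θ s h) := by
              rw [hWb, Finset.mul_sum, Finset.mul_sum]; exact Finset.sum_congr rfl fun i _ => by ring
          _ ≤ 4 * θ^2 * (K2^2 / (4 * c)) := by gcongr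
          _ = θ^2 * (K2^2 / c) := by field_simp
          _ ≤ V1 := by
              rw [hV1, mul_div_assoc]
              have : 0 < K2^2 / c := by positivity
              nlinarith) hKK1.le
  have n2 := cheb_real (n := n) v (fun i => 0) (V := V1)
      (c := K1) (p := 1/(4 * N)) hK1 (by
        calc ∑ i, (v i^2 + 2 * 0^2) = ζ^2 * WW θ s h := by rw [← hv2]; simp
          _ ≤ (K2^2 / (4 * c)) := hζ2
          _ = (1/4) * (K2^2 / c) := by field_simp
          _ ≤ V1 := by
              rw [hV1, mul_div_assoc]
              have : 0 < K2^2 / c := by positivity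
              nlinarith [sq_nonneg θ]) hKK1.le
  set B1 : Set (Fin n → ℝ) := {g | K1 ≤ |∑ i, (2 * ζ * b i * tau θ (s i)^2 * g i + 0 * ((g i)^2 - 1))|}
  set B2 : Set (Fin n → ℝ) := {g | K1 ≤ |∑ i, (v i * g i + 0 * ((g i)^2 - 1))|}
  have hB1 : MeasurableSet B1 := by
    have : Measurable fun g : Fin n → ℝ => |∑ i, (2 * ζ * b i * tau θ (s i)^2 * g i + 0 * ((g i)^2 - 1))| := by fun_prop
    exact measurableSet_le measurable_const this
  have hB2 : MeasurableSet B2 := by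
    have : Measurable fun g : Fin n → ℝ => |∑ i, (v i * g i + 0 * ((g i)^2 - 1))| := by fun_prop
    exact measurableSet_le measurable_const this
  set A := bin k \ (B1 ∪ B2) with hA
  have hAm : MeasurableSet A := MeasurableSet.diff (binm k) (hB1.union hB2)
  have hAp : 1/(4 * N) ≤ (gam n).real A := by
    have h1 : bin k ⊆ A ∪ (B1 ∪ B2) := by
      intro g hg
      by_cases hg' : g ∈ B1 ∪ B2
      · exact Or.inr hg'
      · exact Or.inl ⟨hg, hg'⟩
    have h2 := measureReal_mono (μ := gam n) h1
    have h3 := measureReal_union_le (μ := gam n) A (B1 ∪ B2)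
    have h4 := measureReal_union_le (μ := gam n) B1 B2
    have : 3/(4 * (N:ℝ)) = 1/(4 * N) + 1/(4*N) + 1/(4*N) := by ring
    linarith
  have hdet : ζ^2 * ∑ i, b i ^2 * tau θ (s i)^2 ≤ θ * (K2^2/(4*c)) := by
    calc ζ^2 * ∑ i, b i ^2 * tau θ (s i)^2 ≤ ζ^2 * ∑ i, b i ^2 * θ := by
          gcongr with i _; exact hτ i
      _ = θ * (ζ^2 * WW θ s h) := by rw [← Finset.sum_mul, hWb]; ring
      _ ≤ _ := by gcongr
  have hdet0 : 0 ≤ ζ^2 * ∑ i, b i ^2 * tau θ (s i)^2 :=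
    mul_nonneg (sq_nonneg _) (Finset.sum_nonneg fun i _ => by positivity)
  have key : ∀ g ∈ A, SS1 θ s h (fun i => g i + v i) ≤ D ∧ D - δ * R ≤ SS1 θ s h (fun i => g i + v i) ∧ ∑ i, v i * g i ≤ K1 := by
    rintro g ⟨hg, hg'⟩
    have hg1 : g ∉ B1 := fun h => hg' (Or.inl h)
    have hg2 : g ∉ B2 := fun h => hg' (Or.inr h)
    simp only [B1, B2, Set.mem_ofPred_eq, not_le, abs_lt] at hg1 hg2
    obtain ⟨hb1, hb2⟩ := hg
    have e := SS1_shift θ s h g ζ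
    rw [show (fun i => g i + v i) = fun i => g i + ζ * (bb θ (s i) (h i) * tau θ (s i)) from rfl, e, hζW]
    have e2 : R * κ = - K' * R + k * (δ/2 * R) + 3/4 * δ * R := by rw [hκ]; ring
    refine ⟨?_, ?_, ?_⟩
    · linarith [hg1.2]
    · have : θ * (K2^2 / (4 * c)) ≥ 0 := by positivity
      linarith [hg1.1]
    · have := hg2.2
      simp only [zero_mul, add_zero] at this
      exact this.le
  have fin := ball_shift hθ hs h v hAm (D := D) (w := δ * R) (K1 := K1) (K2 := K2^2/(4*c)) (fun g hg => (key g hg).1)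
    (fun g hg => (key g hg).2.1) (fun g hg => (key g hg).2.2) (by rw [hv2]; exact hζ2)
  refine le_trans ?_ fin
  rw [← ofReal_measureReal (μ := gam n) (s := A), ← ENNReal.ofReal_mul (Real.exp_pos _).le]
  refine ENNReal.ofReal_le_ofReal ?_
  rw [mul_right_comm, ← Real.exp_add]
  refine mul_le_mul (Real.exp_le_exp.2 ?_) hAp (by positivity) (Real.exp_pos _).le
  have := (abs_le.1 hC).2
  have h3 : (1/(2*θ)) * (∑ i, min θ (s i) - D + δ * R) ≤ (1/(2*θ)) * (C + δ * R) := by gcongr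
  rw [mul_add] at h3
  linarith

end GMP

namespace GMP

def ca (θ s : ℝ) : ℝ := min θ s ^ 2 / s

lemma ca_bd {θ s : ℝ} (hθ : 0 < θ) (hs : 0 < s) : 0 ≤ ca θ s ∧ ca θ s ≤ θ := by
  have h1 : 0 < min θ s := lt_min hθ hs
  have h2 : min θ s ≤ θ := min_le_left _ _
  have h3 : min θ s ≤ s := min_le_right _ _
  unfold ca
  refine ⟨by positivity, ?_⟩
  rw [div_le_iff₀ hs]
  nlinarith

lemma bt_id {θ s : ℝ} (hθ : 0 < θ) (hs : 0 < s) (h : ℝ) :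
    bb θ s h ^ 2 + tau θ s ^ 2 = min θ s + ca θ s * (h^2 - 1) := by
  rw [tau_sq hθ hs]
  unfold bb ca
  rw [mul_pow, div_pow, Real.sq_sqrt hs.le]
  field_simp
  ring

lemma ww_id {θ s : ℝ} (hs : 0 < s) (h : ℝ) :
    (bb θ s h * tau θ s) ^ 2 = ca θ s * tau θ s^2 + ca θ s * tau θ s ^ 2 * (h^2 - 1) := by
  unfold bb ca
  rw [mul_pow, mul_pow, div_pow, Real.sq_sqrt hs.le]
  ring

lemma ww_lower {θ s hi : ℝ} (hθ : 0 < θ) (hs : 0 < s) (hhi : s ≤ hi) :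
    2 * θ^4 / hi^2 * (1/2 * Real.log (max θ s / θ)) ≤ ca θ s * tau θ s ^ 2 := by
  have hh : 0 < hi := hs.trans_le hhi
  rcases le_total s θ with h | h
  · rw [max_eq_left h, div_self hθ.ne', Real.log_one]
    simp only [mul_zero]
    exact mul_nonneg (ca_bd hθ hs).1 (sq_nonneg _)
  · rw [tau_sq hθ hs, ca, max_eq_right h, min_eq_left h]
    have l := Real.log_le_sub_one_of_pos (div_pos hs hθ)
    have hs1 : s / θ - 1 ≥ 0 := by
      rw [ge_iff_le, sub_nonneg, le_div_iff₀ hθ]; linarith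
    calc 2 * θ^4 / hi^2 * (1/2 * Real.log (s/θ)) ≤ 2 * θ^4/hi^2 * (1/2 * (s/θ - 1)) := by gcongr
      _ ≤ 2 * θ^4 / s^2 * (1/2 * (s/θ-1)) := by gcongr
      _ = θ^2/s * (θ * (1 - θ/s)) := by field_simp

lemma wbd {θ s : ℝ} (hθ : 0 < θ) (hs : 0 < s) : 0 ≤ ca θ s * tau θ s ^2 ∧ ca θ s * tau θ s ^ 2 ≤ θ^2 := by
  have h1 := ca_bd hθ hs
  have h2 := tau_sq_le hθ hs
  refine ⟨mul_nonneg h1.1 (sq_nonneg _), ?_⟩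
  rw [sq θ]
  exact mul_le_mul h1.2 h2 (sq_nonneg _) hθ.le

theorem achiev {θ δ η R0 hi C d : ℝ} (hθ : 0 < θ) (hδ : 0 < δ) (hη : 0 < η) (hR0 : 0 < R0) (hhi : 0 < hi) (hC : 0 ≤ C) :
    ∃ N0 : ℕ, ∀ n : ℕ, N0 ≤ n → ∀ s : Fin n → ℝ, (∀ i, 0 < s i ∧ s i ≤ hi) →
      |∑ i, min θ (s i) - n * d| ≤ C → n * R0 - C ≤ ∑ i, 1/2 * Real.log (max θ (s i) / θ) →
      ∀ (L : ℝ) (M : ℕ), Real.exp (L + δ * √n) ≤ M → ∃ c : Fin M → Fin n → ℝ,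
        gam n (fail s d c) ≤ gam n {g | L < jt θ s g} + ENNReal.ofReal η := by
  obtain ⟨K, hK, hKK⟩ : ∃ K : ℝ, 0 < K ∧ 2 * θ^2 = η/4 * K^2 := by
    refine ⟨√(2 * θ^2 / (η/4)), Real.sqrt_pos.2 (by positivity), ?_⟩
    rw [Real.sq_sqrt (by positivity)]; field_simp
  set c1 := θ^4 * R0 / hi^2 with hc1
  have hc10 : 0 < c1 := by positivity
  obtain ⟨c0, hc0, N1, hball⟩ := ball_bound (θ := θ) (δ := θ * δ) (K0 := K + C) (c := c1/2) (Cw := θ^2 + c1) (C := C) hθ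
    (by positivity) (by positivity) (by positivity) (by positivity)
  have hlim : Tendsto (fun n : ℕ => Real.exp (-(c0 * Real.exp (δ/2 * √n)))) atTop (nhds 0) := by
    refine Real.tendsto_exp_neg_atTop_nhds_zero.comp ?_
    refine Tendsto.const_mul_atTop hc0 (Real.tendsto_exp_atTop.comp ?_)
    exact Tendsto.const_mul_atTop (by positivity) (Real.tendsto_sqrt_atTop.comp tendsto_natCast_atTop_atTop)
  obtain ⟨N2, hN2⟩ := eventually_atTop.1 (hlim.eventually (gt_mem_nhds (show (0:ℝ) < η/2 by positivity)))
  obtain ⟨N3, hN3⟩ := exists_nat_gt (2 * C / R0)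
  obtain ⟨N4, hN4⟩ := exists_nat_gt (2 * θ^4 / (η/4 * (c1/2)^2))
  refine ⟨max (max N1 N2) (max (max N3 N4) 1), ?_⟩
  intro n hn s hs hmin hlog L M hM
  simp only [max_le_iff] at hn
  obtain ⟨⟨hn1, hn2⟩, ⟨hn3, hn4⟩, hn5⟩ := hn
  have hn0 : (1:ℝ) ≤ n := by exact_mod_cast hn5
  have hnpos : (0:ℝ) < n := by linarith
  have hR1 : 1 ≤ √(n:ℝ) := by rw [Real.one_le_sqrt]; exact hn0
  have hRpos : 0 < √(n:ℝ) := by linarith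
  have hR2 : √(n:ℝ)^2 = n := Real.sq_sqrt hnpos.le
  have hn3' : 2 * C < n * R0 := by
    rw [div_lt_iff₀ hR0] at hN3
    have : (N3:ℝ) * R0 ≤ n * R0 := by gcongr
    linarith
  have hn4' : 2 * θ^4 ≤ n * (η/4 * (c1/2)^2) := by
    rw [div_lt_iff₀ (by positivity)] at hN4
    have : (N4:ℝ) * (η/4 * (c1/2)^2) ≤ n * (η/4 * (c1/2)^2) := by gcongr
    linarith
  set B1 : Set (Fin n → ℝ) := {g | K * √n ≤ |∑ i, (0 * g i + ca θ (s i) * ((g i)^2 - 1))|} with hB1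
  set B2 : Set (Fin n → ℝ) := {g | c1/2 * n ≤ |∑ i, (0 * g i + ca θ (s i) * tau θ (s i)^2 * ((g i)^2 - 1))|} with hB2
  have p1 : (gam n).real B1 ≤ η/4 := by
    refine cheb_real (n := n) (fun _ => 0) (fun i => ca θ (s i)) (V := n * (2 * θ^2)) (by positivity) ?_ ?_
    · calc ∑ i, ((0:ℝ)^2 + 2 * ca θ (s i)^2) ≤ ∑ i : Fin n, 2 * θ^2 := Finset.sum_le_sum fun i _ => by
            have := ca_bd hθ (hs i).1
            have := pow_le_pow_left₀ this.1 this.2 2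
            linarith
        _ = _ := by simp
    · rw [hKK, mul_pow, hR2]; linarith
  have p2 : (gam n).real B2 ≤ η/4 := by
    refine cheb_real (n := n) (fun _ => 0) (fun i => ca θ (s i) * tau θ (s i)^2) (V := n * (2 * θ^4)) (by positivity) ?_ ?_
    · calc ∑ i, ((0:ℝ)^2 + 2 * (ca θ (s i) * tau θ (s i)^2)^2) ≤ ∑ i : Fin n, 2 * θ^4 := Finset.sum_le_sum fun i _ => by
            have := wbd hθ (hs i).1
            have := pow_le_pow_left₀ this.1 this.2 2
            have e : (θ^2)^2 = θ^4 := by ring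
            linarith
        _ = _ := by simp
    · have := mul_le_mul_of_nonneg_left hn4' hnpos.le
      linarith
  have m1 : MeasurableSet B1 := by
    have : Measurable fun g : Fin n → ℝ => |∑ i, (0 * g i + ca θ (s i) * ((g i)^2 - 1))| := by fun_prop
    exact measurableSet_le measurable_const this
  have m2 : MeasurableSet B2 := by
    have : Measurable fun g : Fin n → ℝ => |∑ i, (0 * g i + ca θ (s i) * tau θ (s i)^2 * ((g i)^2 - 1))| := by fun_prop
    exact measurableSet_le measurable_const this
  have hjm : Measurable (jt θ s) := jt_meas θ s
  have m3 : MeasurableSet {g : Fin n → ℝ | jt θ s g ≤ L} := measurableSet_le hjm measurable_const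
  set G : Set (Fin n → ℝ) := (B1ᶜ ∩ B2ᶜ) ∩ {g | jt θ s g ≤ L} with hG
  have mG : MeasurableSet G := (m1.compl.inter m2.compl).inter m3
  set p := c0 * Real.exp (-L - δ/2 * √n) with hp
  have hp0 : 0 < p := by positivity
  have hGb : ∀ h ∈ G, ENNReal.ofReal p ≤ gam n (ball θ s (n*d) h) := by
    rintro h ⟨⟨h1, h2⟩, h3⟩
    simp only [B1, B2, Set.mem_compl_iff, Set.mem_ofPred_eq, not_le, zero_mul, zero_add] at h1 h2 h3
    have b := hball n hn1 s h (n * d) (fun i => (hs i).1) hmin ?_ ?_ ?_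
    · refine le_trans (ENNReal.ofReal_le_ofReal ?_) b
      rw [hp]
      have : 1/(2*θ) * (θ * δ * √n) = δ/2 * √n := by field_simp
      rw [this]
      gcongr
    · simp only [bt_id hθ (hs _).1, Finset.sum_add_distrib]
      rw [abs_le] at hmin
      rw [abs_lt] at h1
      have : C ≤ C * √n := by nlinarith
      rw [abs_le, add_mul]
      constructor <;> linarith [hmin.1, hmin.2, h1.1, h1.2]
    · unfold WW
      simp only [ww_id (hs _).1, Finset.sum_add_distrib]
      rw [abs_lt] at h2
      have : 2 * θ^4/hi^2 * (∑ i, 1/2 * Real.log (max θ (s i) / θ)) ≤ ∑ i, ca θ (s i) * tau θ (s i)^2 := by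
        rw [Finset.mul_sum]
        exact Finset.sum_le_sum fun i _ => ww_lower hθ (hs i).1 (hs i).2
      have h4 : 2 * θ^4/hi^2 * (n * R0 / 2) ≤ 2 * θ^4/hi^2 * (∑ i, 1/2 * Real.log (max θ (s i) / θ)) := by
        gcongr; linarith
      have h5 : 2 * θ^4/hi^2 * (n * R0 / 2) = c1 * n := by rw [hc1]; field_simp
      linarith [h2.1]
    · unfold WW
      simp only [ww_id (hs _).1, Finset.sum_add_distrib]
      rw [abs_lt] at h2
      have : ∑ i, ca θ (s i) * tau θ (s i)^2 ≤ n * θ^2 := by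
        calc _ ≤ ∑ i : Fin n, θ^2 := Finset.sum_le_sum fun i _ => (wbd hθ (hs i).1).2
          _ = _ := by simp
      have : 0 < c1 * n := by positivity
      linarith [h2.2]
  have hB : MeasurableSet {q : (Fin n → ℝ) × (Fin n → ℝ) | ∑ i, (√(s i) * q.1 i - kap θ (s i) * q.2 i)^2 ≤ n * d} := by
    have : Measurable fun q : (Fin n → ℝ) × (Fin n → ℝ) => ∑ i, (√(s i) * q.1 i - kap θ (s i) * q.2 i)^2 := by fun_prop
    exact measurableSet_le this measurable_const
  obtain ⟨c, hc⟩ : ∃ c : Fin M → Fin n → ℝ, gam n (G ∩ {h | ∀ j, ¬ (∑ i, (√(s i) * h i - kap θ (s i) * c j i)^2 ≤ n * d)}) ≤ ENNReal.ofReal (η/2) := by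
    rcases G.eq_empty_or_nonempty with hGe | ⟨h, hh⟩
    · exact ⟨fun _ _ => 0, by rw [hGe]; simp⟩
    · have hp1 : p ≤ 1 := by
        have := (hGb h hh).trans prob_le_one
        exact ENNReal.ofReal_le_one.1 this
      obtain ⟨c, hc⟩ := covering _ hB G mG hp0.le hp1 hGb M
      refine ⟨c, le_trans hc (ENNReal.ofReal_le_ofReal ?_)⟩
      calc (1-p)^M ≤ (Real.exp (-p))^M := by
            gcongr
            · exact Real.one_sub_le_exp_neg p
        _ = Real.exp (-(p * M)) := by rw [← Real.exp_nat_mul]; congr 1; ring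
        _ ≤ Real.exp (-(c0 * Real.exp (δ/2 * √n))) := by
            refine Real.exp_le_exp.2 (neg_le_neg ?_)
            calc c0 * Real.exp (δ/2 * √n) = p * Real.exp (L + δ * √n) := by
                  rw [hp, mul_assoc, ← Real.exp_add]; congr 2; ring
              _ ≤ p * M := by gcongr
        _ ≤ η/2 := (hN2 n hn2).le
  refine ⟨fun j i => kap θ (s i) * c j i, ?_⟩
  have hsub : fail s d (fun j i => kap θ (s i) * c j i) ⊆ ({g | L < jt θ s g} ∪ (B1 ∪ B2)) ∪ (G ∩ {h | ∀ j, ¬ (∑ i, (√(s i) * h i - kap θ (s i) * c j i)^2 ≤ n * d)}) := by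
    intro g hg
    by_cases h1 : g ∈ B1
    · exact Or.inl (Or.inr (Or.inl h1))
    by_cases h2 : g ∈ B2
    · exact Or.inl (Or.inr (Or.inr h2))
    by_cases h3 : L < jt θ s g
    · exact Or.inl (Or.inl h3)
    · exact Or.inr ⟨⟨⟨h1, h2⟩, not_lt.1 h3⟩, fun j => not_le.2 (hg j)⟩
  have p1' : gam n B1 ≤ ENNReal.ofReal (η/4) := by
    rw [← ofReal_measureReal (μ := gam n) (s := B1)]; exact ENNReal.ofReal_le_ofReal p1
  have p2' : gam n B2 ≤ ENNReal.ofReal (η/4) := by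
    rw [← ofReal_measureReal (μ := gam n) (s := B2)]; exact ENNReal.ofReal_le_ofReal p2
  calc _ ≤ _ := measure_mono hsub
    _ ≤ _ := measure_union_le _ _
    _ ≤ (gam n {g | L < jt θ s g} + (gam n B1 + gam n B2)) + ENNReal.ofReal (η/2) := by
        gcongr
        refine (measure_union_le _ _).trans ?_
        gcongr
        exact measure_union_le _ _
    _ ≤ (gam n {g | L < jt θ s g} + (ENNReal.ofReal (η/4) + ENNReal.ofReal (η/4))) + ENNReal.ofReal (η/2) := by gcongr
    _ = _ := by
        rw [← ENNReal.ofReal_add (by positivity) (by positivity), add_assoc, ← ENNReal.ofReal_add (by positivity) (by positivity)]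
        congr 2; ring

end GMP

namespace GMP

lemma prod_diff {ι : Type*} (s : Finset ι) (z w : ι → ℂ) (hz : ∀ i, ‖z i‖ ≤ 1) (hw : ∀ i, ‖w i‖ ≤ 1) :
    ‖∏ i ∈ s, z i - ∏ i ∈ s, w i‖ ≤ ∑ i ∈ s, ‖z i - w i‖ := by
  classical
  induction s using Finset.induction_on with
  | empty => simp
  | insert a s ha ih =>
    rw [Finset.prod_insert ha, Finset.prod_insert ha, Finset.sum_insert ha]
    have e : z a * ∏ i ∈ s, z i - w a * ∏ i ∈ s, w i = (z a - w a) * ∏ i ∈ s, z i + w a * (∏ i ∈ s, z i - ∏ i ∈ s, w i) := by ring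
    rw [e]
    refine (norm_add_le _ _).trans ?_
    rw [norm_mul, norm_mul]
    have h1 : ‖∏ i ∈ s, z i‖ ≤ 1 := by
      rw [norm_prod]; exact Finset.prod_le_one (fun i _ => norm_nonneg _) fun i _ => hz i
    gcongr
    · exact mul_le_of_le_one_right (norm_nonneg _) h1
    · exact (mul_le_of_le_one_left (norm_nonneg _) (hw a)).trans ih

def XX (x : ℝ) : ℝ := (√2)⁻¹ * (x^2 - 1)

lemma XX_meas : Measurable XX := by unfold XX; fun_prop

def phi (u : ℝ) : ℂ := charFun (γ1.map XX) u

lemma phi_eq (u : ℝ) : phi u = ∫ x, Complex.exp (u * XX x * Complex.I) ∂γ1 := by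
  unfold phi
  rw [charFun_apply_real, integral_map XX_meas.aemeasurable (by fun_prop)]

lemma phi_le (u : ℝ) : ‖phi u‖ ≤ 1 := by
  have : IsProbabilityMeasure (γ1.map XX) := Measure.isProbabilityMeasure_map XX_meas.aemeasurable
  exact norm_charFun_le_one u

lemma gau_eq (u : ℝ) : charFun γ1 u = Complex.exp (-(u^2/2 : ℝ)) := by
  rw [charFun_gaussianReal]; congr 1; push_cast; ring

lemma phi_o {e : ℝ} (he : 0 < e) : ∃ ρ > 0, ∀ u : ℝ, |u| < ρ → ‖phi u - charFun γ1 u‖ ≤ e * u^2 := by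
  have t1 := taylor_charFun_two (P := γ1) (X := XX) XX_meas.aemeasurable (by
    have := mean_quad 0 (√2)⁻¹
    simpa [XX] using this) (by
    have h := var_quad 0 (√2)⁻¹
    rw [variance_of_integral_eq_zero (by fun_prop) (mean_quad _ _)] at h
    have e2 : (√2:ℝ)^2 = 2 := Real.sq_sqrt (by norm_num)
    rw [inv_pow, e2] at h
    norm_num at h
    simpa [XX] using h)
  have t2 := taylor_charFun_two (P := γ1) (X := id) aemeasurable_id (by simp) (by
    have := moments.2.1; simpa using this)
  rw [Measure.map_id] at t2
  have t3 := (t1.sub t2).def he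
  rw [Metric.eventually_nhds_iff] at t3
  obtain ⟨ρ, hρ, h⟩ := t3
  refine ⟨ρ, hρ, fun u hu => ?_⟩
  have := h (y := u) (by simpa using hu)
  rw [sub_sub_sub_cancel_right] at this
  simpa [phi] using this

lemma charFun_sum {n : ℕ} (w : Fin n → ℝ) (r t : ℝ) :
    charFun ((gam n).map (fun g => r * ∑ i, w i * ((g i)^2 - 1))) t = ∏ i, phi (√2 * (r * t * w i)) := by
  have hm : Measurable (fun g : Fin n → ℝ => r * ∑ i, w i * ((g i)^2 - 1)) := by fun_prop
  rw [charFun_apply_real, integral_map hm.aemeasurable (by fun_prop)]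
  simp only [phi_eq]
  unfold gam
  rw [← integral_fintype_prod_eq_prod (fun i x => Complex.exp (((√2 * (r * t * w i) : ℝ) : ℂ) * XX x * Complex.I))]
  congr 1
  funext g
  rw [← Complex.exp_sum]
  congr 1
  rw [← Finset.sum_mul]
  congr 1
  rw [← Complex.ofReal_mul]
  simp only [← Complex.ofReal_mul]
  rw [← Complex.ofReal_sum, Complex.ofReal_inj, Finset.mul_sum, Finset.mul_sum]
  refine Finset.sum_congr rfl fun i _ => ?_
  unfold XX
  have : √2 * (√2)⁻¹ = 1 := mul_inv_cancel₀ (by positivity)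
  linear_combination (-(t * r * w i * ((g i)^2-1))) * this

theorem clt {B : ℝ} (w : ∀ k : ℕ, Fin (k+1) → ℝ) (hB : ∀ k i, |w k i| ≤ B)
    (hV : Tendsto (fun k => (∑ i, 2 * (w k i)^2) / ((k+1 : ℕ) : ℝ)) atTop (nhds 1)) (y : ℝ) :
    Tendsto (fun k => gam (k+1) {g | √((k+1 : ℕ) : ℝ) * y ≤ ∑ i, w k i * ((g i)^2 - 1)}) atTop
      (nhds (ENNReal.ofReal (GM.gaussQ y))) := by
  have hB0 : 0 ≤ B := (abs_nonneg _).trans (hB 0 0)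
  set F : ∀ k : ℕ, (Fin (k+1) → ℝ) → ℝ := fun k g => (√((k+1 : ℕ) : ℝ))⁻¹ * ∑ i, w k i * ((g i)^2 - 1) with hF
  have Fm : ∀ k, Measurable (F k) := fun k => by simp only [hF]; fun_prop
  have : ∀ k, IsProbabilityMeasure ((gam (k+1)).map (F k)) := fun k => Measure.isProbabilityMeasure_map (Fm k).aemeasurable
  set μ : ℕ → ProbabilityMeasure ℝ := fun k => ⟨(gam (k+1)).map (F k), this k⟩ with hμ
  set μ0 : ProbabilityMeasure ℝ := ⟨γ1, inferInstance⟩ with hμ0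
  have conv : Tendsto μ atTop (nhds μ0) := by
    refine ProbabilityMeasure.tendsto_iff_tendsto_charFun.2 fun t => ?_
    have e1 : ∀ k, charFun (μ k : Measure ℝ) t = ∏ i, phi (√2 * ((√((k+1 : ℕ) : ℝ))⁻¹ * t * w k i)) := fun k => charFun_sum (w k) _ t
    have e2 : charFun (μ0 : Measure ℝ) t = Complex.exp (-(t^2/2 : ℝ)) := gau_eq t
    simp only [e1, e2]
    have e3 : ∀ k, ∏ i, charFun γ1 (√2 * ((√((k+1 : ℕ) : ℝ))⁻¹ * t * w k i)) = Complex.exp (-(((∑ i, 2 * (w k i)^2) / ((k+1 : ℕ) : ℝ)) * (t^2/2) : ℝ)) := by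
      intro k
      simp only [gau_eq]
      rw [← Complex.exp_sum]
      congr 1
      rw [Finset.sum_neg_distrib, ← Complex.ofReal_sum, Finset.sum_div, Finset.sum_mul]
      congr 2
      refine Finset.sum_congr rfl fun i _ => ?_
      rw [mul_pow, mul_pow, mul_pow, inv_pow, Real.sq_sqrt (by positivity), Real.sq_sqrt (by positivity)]
      field_simp
    have l1 : Tendsto (fun k => ∏ i, charFun γ1 (√2 * ((√((k+1 : ℕ) : ℝ))⁻¹ * t * w k i))) atTop (nhds (Complex.exp (-(t^2/2 : ℝ)))) := by
      simp only [e3]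
      have : Tendsto (fun k : ℕ => (∑ i, 2 * (w k i)^2) / ((k+1 : ℕ) : ℝ) * (t^2/2)) atTop (nhds (1 * (t^2/2))) := hV.mul_const _
      rw [one_mul] at this
      exact (Complex.continuous_exp.tendsto _).comp (((Complex.continuous_ofReal.tendsto _).comp this).neg)
    have l2 : Tendsto (fun k => ∏ i, phi (√2 * ((√((k+1 : ℕ) : ℝ))⁻¹ * t * w k i)) - ∏ i, charFun γ1 (√2 * ((√((k+1 : ℕ) : ℝ))⁻¹ * t * w k i))) atTop (nhds 0) := by
      rw [tendsto_zero_iff_norm_tendsto_zero, Metric.tendsto_atTop]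
      intro e he
      obtain ⟨ρ, hρ, hphi⟩ := phi_o (e := e / (2 * (2 * t^2 * B^2 + 1))) (by positivity)
      have hsm : Tendsto (fun k : ℕ => √2 * ((√((k+1 : ℕ) : ℝ))⁻¹ * |t| * B)) atTop (nhds (√2 * (0 * |t| * B))) := by
        refine Tendsto.const_mul _ (Tendsto.mul_const _ (Tendsto.mul_const _ ?_))
        exact tendsto_inv_atTop_zero.comp (Real.tendsto_sqrt_atTop.comp (tendsto_natCast_atTop_atTop.comp (tendsto_add_atTop_nat 1)))
      rw [zero_mul, zero_mul, mul_zero] at hsm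
      obtain ⟨N, hN⟩ := eventually_atTop.1 (hsm.eventually (gt_mem_nhds hρ))
      refine ⟨N, fun k hk => ?_⟩
      rw [Real.dist_eq, sub_zero, abs_norm]
      refine (prod_diff _ _ _ (fun i => phi_le _) (fun i => norm_charFun_le_one _)).trans_lt ?_
      have hb : ∀ i, ‖phi (√2 * ((√((k+1 : ℕ) : ℝ))⁻¹ * t * w k i)) - charFun γ1 (√2 * ((√((k+1 : ℕ) : ℝ))⁻¹ * t * w k i))‖ ≤ e / (2 * (2 * t^2 * B^2 + 1)) * (2 * t^2 * B^2 / ((k+1 : ℕ) : ℝ)) := by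
        intro i
        have habs : |√2 * ((√((k+1 : ℕ) : ℝ))⁻¹ * t * w k i)| ≤ √2 * ((√((k+1 : ℕ) : ℝ))⁻¹ * |t| * B) := by
          rw [abs_mul, abs_mul, abs_mul, abs_inv, abs_of_nonneg (Real.sqrt_nonneg _), abs_of_nonneg (Real.sqrt_nonneg _)]
          have := hB k i
          gcongr
        refine (hphi _ (habs.trans_lt (hN k hk))).trans ?_
        gcongr
        rw [← sq_abs]
        refine (pow_le_pow_left₀ (abs_nonneg _) habs 2).trans (le_of_eq ?_)
        rw [mul_pow, mul_pow, mul_pow, inv_pow, Real.sq_sqrt (by positivity), Real.sq_sqrt (by positivity), sq_abs]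
        field_simp
      refine (Finset.sum_le_sum fun i _ => hb i).trans_lt ?_
      rw [Finset.sum_const, Finset.card_univ, Fintype.card_fin, nsmul_eq_mul]
      have : ((k+1 : ℕ) : ℝ) * (e / (2 * (2 * t^2 * B^2 + 1)) * (2 * t^2 * B^2 / ((k+1 : ℕ) : ℝ))) = e / 2 * (2 * t^2 * B^2 / (2 * t^2 * B^2 + 1)) := by
        field_simp
      rw [this]
      have : 2 * t^2 * B^2 / (2 * t^2 * B^2 + 1) ≤ 1 := by
        rw [div_le_one (by positivity)]; linarith
      nlinarith
    have := l2.add l1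
    simpa using this
  have port := ProbabilityMeasure.tendsto_measure_of_null_frontier_of_tendsto' conv (E := Set.Ici y) (by
    rw [frontier_Ici]
    have := nullSingletonClass_gaussianReal (μ := 0) (v := 1) one_ne_zero
    show γ1 {y} = 0
    exact measure_singleton y)
  have e0 : (μ0 : Measure ℝ) (Set.Ici y) = ENNReal.ofReal (GM.gaussQ y) := by
    show γ1 (Set.Ici y) = _
    rw [gaussianReal_apply_eq_integral 0 one_ne_zero, integral_Ici_eq_integral_Ioi]
    unfold GM.gaussQ gaussianPDFReal
    simp
  rw [e0] at port
  refine port.congr fun k => ?_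
  show ((gam (k+1)).map (F k)) (Set.Ici y) = _
  rw [Measure.map_apply (Fm k) measurableSet_Ici]
  congr 1
  ext g
  show y ≤ (√((k+1 : ℕ) : ℝ))⁻¹ * ∑ i, w k i * ((g i)^2 - 1) ↔ _
  rw [inv_mul_eq_div, le_div_iff₀ (Real.sqrt_pos.2 (by positivity)), mul_comm]
  rfl

lemma gaussQ_eq (y : ℝ) : ENNReal.ofReal (GM.gaussQ y) = γ1 (Set.Ioi y) := by
  rw [gaussianReal_apply_eq_integral 0 one_ne_zero]
  unfold GM.gaussQ gaussianPDFReal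
  simp

lemma gaussQ_lt {x y : ℝ} (h : x < y) : ENNReal.ofReal (GM.gaussQ y) < ENNReal.ofReal (GM.gaussQ x) := by
  rw [gaussQ_eq, gaussQ_eq, ← Set.Ioc_union_Ioi_eq_Ioi h.le, measure_union (Set.Ioc_disjoint_Ioi le_rfl) measurableSet_Ioi]
  have : 0 < γ1 (Set.Ioc x y) := by
    rw [pos_iff_ne_zero]
    intro h0
    have := gaussianReal_absolutelyContinuous' 0 (v := 1) one_ne_zero h0
    simp at this
    linarith
  rw [add_comm]
  exact ENNReal.lt_add_right (measure_ne_top _ _) this.ne'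

end GMP

namespace GMP

lemma S_int {a σ : ℝ} (ha0 : 0 ≤ a) (ha1 : a < 1) :
    (1 / (2 * π)) * ∫ w in Set.Icc (-π) π, GM.S a σ w = σ^2 / (1 - a^2) := by
  have h := InnerProductSpace.HarmonicOnNhd.circleAverage_poissonKernel_smul (f := fun _ : ℂ => (1:ℝ)) (c := 0) (R := 1) (fun x _ => InnerProductSpace.harmonicAt_const (1:ℝ))
    (w := (a:ℂ)) (by simpa [abs_of_nonneg ha0] using ha1)
  rw [Real.circleAverage_def] at h
  have h1 : 0 < 1 - a^2 := by nlinarith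
  have e : ∀ t : ℝ, (poissonKernel 0 (a:ℂ) • fun _ => (1:ℝ)) (circleMap 0 1 t) = (1 - a^2)/ ff a t := by
    intro t
    have : ‖circleMap 0 1 t - (a:ℂ)‖^2 = ff a t := by
      rw [← Complex.normSq_eq_norm_sq, Complex.normSq_apply, circleMap_zero]
      simp [Complex.exp_ofReal_mul_I_re, Complex.exp_ofReal_mul_I_im]
      unfold ff
      nlinarith [Real.sin_sq_add_cos_sq t]
    simp [poissonKernel_def, this]
  simp only [e] at h
  have hp : Function.Periodic (fun t => (1 - a^2)/ ff a t) (2 * π) := by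
    intro t; simp [ff]
  have h2 := hp.intervalIntegral_add_eq (-π) 0
  rw [zero_add, show -π + 2 * π = π by ring] at h2
  rw [← h2, intervalIntegral.integral_of_le (by linarith [Real.pi_pos]), ← integral_Icc_eq_integral_Ioc] at h
  have e3 : ∀ w, GM.S a σ w = σ^2 / (1-a^2) * ((1 - a^2)/ ff a w) := by
    intro w; rw [S_eq]; field_simp
  simp only [e3, integral_const_mul]
  rw [smul_eq_mul] at h
  calc _ = σ^2 / (1-a^2) * ((2 * π)⁻¹ * ∫ (x : ℝ) in Set.Icc (-π) π, (1 - a ^ 2) / ff a x) := by ring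
    _ = _ := by rw [h, mul_one]

lemma S_bd {a σ : ℝ} (ha0 : 0 ≤ a) (ha1 : a < 1) (hσ : 0 < σ) (w : ℝ) :
    0 < GM.S a σ w ∧ σ^2/(1+a)^2 ≤ GM.S a σ w ∧ GM.S a σ w ≤ σ^2/(1-a)^2 := by
  have h := ff_bounds ha0 w
  have h1 : 0 < (1-a)^2 := by nlinarith
  have h2 : 0 < ff a w := h1.trans_le h.1
  rw [S_eq]
  have h3 := h.1
  have h4 := h.2
  refine ⟨by positivity, by gcongr, by gcongr⟩

lemma S_cont {a σ : ℝ} (ha0 : 0 ≤ a) (ha1 : a < 1) : Continuous (GM.S a σ) := by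
  have h1 : 0 < (1-a)^2 := by nlinarith
  have : GM.S a σ = fun w => σ^2 / ff a w := rfl
  rw [this]
  exact continuous_const.div (ff_cont a) fun w => (h1.trans_le (ff_bounds ha0 w).1).ne'

lemma VU_pos {a σ θ : ℝ} (ha0 : 0 ≤ a) (ha1 : a < 1) (hσ : 0 < σ) (hθ : 0 < θ) : 0 < GM.VU a σ θ := by
  set k := min 1 ((σ^2/(1+a)^2/θ)^2) with hk
  have hk0 : 0 < k := lt_min one_pos (by positivity)
  have hc : Continuous fun w => min 1 ((GM.S a σ w / θ)^2) := by
    have := S_cont (σ := σ) ha0 ha1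
    fun_prop
  have hi : ∫ w in Set.Icc (-π) π, k ≤ ∫ w in Set.Icc (-π) π, min 1 ((GM.S a σ w / θ)^2) := by
    refine setIntegral_mono_on (by simp) (hc.continuousOn.integrableOn_compact isCompact_Icc) measurableSet_Icc fun w _ => ?_
    have := (S_bd ha0 ha1 hσ w).2.1
    exact min_le_min_left _ (by gcongr)
  have : ∫ w in Set.Icc (-π) π, k = 2 * π * k := by
    have : max (π + π) 0 = 2 * π := by rw [max_eq_left (by positivity)]; ring
    simp [this]
  unfold GM.VU
  have hp := Real.pi_pos
  have : 0 < 2 * π * k := by positivity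
  have : 0 < ∫ w in Set.Icc (-π) π, min 1 ((GM.S a σ w / θ)^2) := by linarith
  positivity

lemma RU_pos {a σ θ d : ℝ} (ha0 : 0 ≤ a) (ha1 : a < 1) (hσ : 0 < σ) (hθ : 0 < θ) (hw : GM.waterEq a σ θ d)
    (hd : d < σ^2/(1-a^2)) : 0 < GM.RU a σ θ := by
  set hi := σ^2/(1-a)^2 with hhi
  have h1 : 0 < (1-a)^2 := by nlinarith
  have hhi0 : 0 < hi := by positivity
  have hS := S_cont (σ := σ) ha0 ha1
  have hSpos := fun w => S_bd ha0 ha1 hσ w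
  have hlog : Continuous fun w => Real.log (GM.S a σ w / θ) :=
    (hS.div_const θ).log fun w => (div_pos (hSpos w).1 hθ).ne'
  have hc : Continuous fun w => 2 * hi * max 0 (1/2 * Real.log (GM.S a σ w / θ)) := by fun_prop
  have hc2 : Continuous fun w => min θ (GM.S a σ w) := by fun_prop
  have ii : ∀ f : ℝ → ℝ, Continuous f → IntegrableOn f (Set.Icc (-π) π) := fun f hf => hf.continuousOn.integrableOn_compact isCompact_Icc
  have key : ∫ w in Set.Icc (-π) π, GM.S a σ w - min θ (GM.S a σ w) ≤ ∫ w in Set.Icc (-π) π, 2 * hi * max 0 (1/2 * Real.log (GM.S a σ w / θ)) := by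
    refine setIntegral_mono_on (ii _ (hS.sub hc2)) (ii _ hc) measurableSet_Icc fun w _ => ?_
    obtain ⟨p, -, q⟩ := hSpos w
    set S := GM.S a σ w
    rcases le_total S θ with h | h
    · rw [min_eq_right h, sub_self]; positivity
    · rw [min_eq_left h]
      have l := Real.one_sub_inv_le_log_of_pos (div_pos p hθ)
      rw [inv_div] at l
      have : S - θ = S * (1 - θ/S) := by field_simp
      have h0 : 0 ≤ 1 - θ/S := by rw [sub_nonneg, div_le_one p]; exact h
      calc S - θ = S * (1 - θ/S) := this
        _ ≤ hi * Real.log (S/θ) := mul_le_mul q l h0 hhi0.le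
        _ = 2 * hi * (1/2 * Real.log (S/θ)) := by ring
        _ ≤ _ := by gcongr; exact le_max_right _ _
  rw [integral_sub (ii _ hS) (ii _ hc2), integral_const_mul] at key
  have e := S_int (σ := σ) ha0 ha1
  unfold GM.waterEq at hw
  have hp : 0 < 1 / (2 * π) := by positivity
  have k2 := mul_le_mul_of_nonneg_left key hp.le
  rw [mul_sub, e, ← hw] at k2
  have : 1/(2*π) * (2 * hi * ∫ w in Set.Icc (-π) π, max 0 (1/2 * Real.log (GM.S a σ w / θ))) = 2 * hi * GM.RU a σ θ := by
    unfold GM.RU; ring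
  rw [this] at k2
  have : 0 < 2 * hi * GM.RU a σ θ := by linarith
  exact pos_of_mul_pos_right this (by positivity)

end GMP

namespace GMP

lemma gaussQ_nonneg (y : ℝ) : 0 ≤ GM.gaussQ y := by
  unfold GM.gaussQ
  exact integral_nonneg fun s => by positivity

lemma gaussQ_lt' {x y : ℝ} (h : x < y) : GM.gaussQ y < GM.gaussQ x :=
  (ENNReal.ofReal_lt_ofReal_iff_of_nonneg (gaussQ_nonneg y)).1 (gaussQ_lt h)

lemma sqrt_lim : Tendsto (fun k : ℕ => √((k+1 : ℕ) : ℝ)) atTop atTop :=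
  Real.tendsto_sqrt_atTop.comp (tendsto_natCast_atTop_atTop.comp (tendsto_add_atTop_nat 1))

lemma min_sq {θ s : ℝ} (hθ : 0 < θ) (hs : 0 < s) : min 1 ((s/θ)^2) = (min θ s / θ)^2 := by
  rcases le_total θ s with h | h
  · rw [min_eq_left h, div_self hθ.ne', min_eq_left, one_pow]
    have : 1 ≤ s/θ := by rw [le_div_iff₀ hθ]; linarith
    exact one_le_pow₀ this
  · rw [min_eq_right h, min_eq_right]
    have : s/θ ≤ 1 := by rw [div_le_one hθ]; exact h
    exact pow_le_one₀ (by positivity) this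

theorem main_bounds {a σ ε d θ q δ : ℝ} (ha0 : 0 ≤ a) (ha1 : a < 1) (hσ : 0 < σ)
    (hε : ε ∈ Set.Ioo (0 : ℝ) 1) (hdmax : d < σ ^ 2 / (1 - a ^ 2))
    (hθ : 0 < θ) (hw : GM.waterEq a σ θ d) (hq : GM.gaussQ q = ε) (hδ : 0 < δ) :
    ∃ K : ℝ, ∀ᶠ k : ℕ in atTop,
      ((k+1 : ℕ) : ℝ) * GM.RU a σ θ + √((k+1 : ℕ) : ℝ) * (√(GM.VU a σ θ) * (q - δ)) - K ≤ Real.log (GM.Mstar a σ (k+1) d ε) ∧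
      Real.log (GM.Mstar a σ (k+1) d ε) ≤ ((k+1 : ℕ) : ℝ) * GM.RU a σ θ + √((k+1 : ℕ) : ℝ) * (√(GM.VU a σ θ) * (q + δ) + δ) + K := by
  have hV := VU_pos ha0 ha1 hσ hθ
  have hR := RU_pos ha0 ha1 hσ hθ hw hdmax
  set V := GM.VU a σ θ
  set R := GM.RU a σ θ
  set r := √V with hr
  have hr0 : 0 < r := Real.sqrt_pos.2 hV
  have hr2 : r^2 = V := Real.sq_sqrt hV.le
  obtain ⟨C, hC, hsp⟩ := spectral ha0 ha1 hσ hθ hw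
  choose P s hP1 hP2 hA hs hmin hlog hvar using hsp
  have hlo : 0 < σ^2/(1+a)^2 := by positivity
  have h1a : 0 < (1-a)^2 := by nlinarith
  have hhi : 0 < σ^2/(1-a)^2 := by positivity
  have hspos : ∀ k i, 0 < s k i := fun k i => hlo.trans_le (hs k i).1
  set w : ∀ k : ℕ, Fin (k+1) → ℝ := fun k i => min θ (s k i) / (2*θ) / r with hwdef
  have hwB : ∀ k i, |w k i| ≤ 1 / 2 / r := by
    intro k i
    have h1 : 0 < min θ (s k i) := lt_min hθ (hspos k i)
    have h2 : min θ (s k i) ≤ θ := min_le_left _ _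
    simp only [hwdef]
    rw [abs_of_nonneg (by positivity)]
    gcongr 1
    rw [div_le_div_iff₀ (by positivity) (by positivity)]
    linarith
  have hnp : ∀ k : ℕ, (0:ℝ) < ((k+1 : ℕ) : ℝ) := fun k => by positivity
  have hwV : Tendsto (fun k => (∑ i, 2 * (w k i)^2) / ((k+1 : ℕ) : ℝ)) atTop (nhds 1) := by
    have hz : Tendsto (fun k : ℕ => C / V * (((k+1 : ℕ) : ℝ))⁻¹) atTop (nhds (C/V * 0)) :=
      Tendsto.const_mul _ (tendsto_inv_atTop_zero.comp (tendsto_natCast_atTop_atTop.comp (tendsto_add_atTop_nat 1)))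
    rw [mul_zero] at hz
    rw [tendsto_iff_norm_sub_tendsto_zero]
    refine squeeze_zero (fun _ => norm_nonneg _) (fun k => ?_) hz
    have e : ∑ i, 2 * (w k i)^2 = (∑ i, 1/2 * min 1 ((s k i/θ)^2)) / V := by
      rw [Finset.sum_div]
      refine Finset.sum_congr rfl fun i _ => ?_
      rw [min_sq hθ (hspos k i), ← hr2]
      simp only [hwdef]
      field_simp
    have hv := hvar k
    have hn : (k:ℝ) + 1 = ((k+1 : ℕ):ℝ) := by push_cast; ring
    rw [hn] at hv
    rw [e, Real.norm_eq_abs]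
    have : (∑ i, 1/2 * min 1 ((s k i/θ)^2)) / V / ((k+1 : ℕ) : ℝ) - 1 = (∑ i, 1/2 * min 1 ((s k i/θ)^2) - ((k+1 : ℕ) : ℝ) * V) * (1 / V * (((k+1 : ℕ) : ℝ))⁻¹) := by
      have := (hnp k).ne'
      field_simp
    rw [this, abs_mul, abs_of_nonneg (a := 1 / V * (((k+1 : ℕ) : ℝ))⁻¹) (by positivity)]
    calc _ ≤ C * (1 / V * (((k+1 : ℕ) : ℝ))⁻¹) := by gcongr
      _ = _ := by ring
  have hclt := clt w hwB hwV
  set Λ : ℕ → ℝ := fun k => ∑ i, 1/2 * Real.log (max θ (s k i) / θ) with hΛ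
  have hΛb : ∀ k, |Λ k - ((k+1 : ℕ) : ℝ) * R| ≤ C := by
    intro k; have := hlog k; push_cast; exact this
  have hminb : ∀ k, |∑ i, min θ (s k i) - ((k+1 : ℕ) : ℝ) * d| ≤ C := by
    intro k; have := hmin k; push_cast; exact this
  have hjt : ∀ k g, jt θ (s k) g = r * ∑ i, w k i * ((g i)^2 - 1) + Λ k := by
    intro k g
    simp only [jt, j1, hΛ, hwdef, Finset.mul_sum, ← Finset.sum_add_distrib]
    refine Finset.sum_congr rfl fun i _ => ?_
    field_simp
  have hev : ∀ k y, {g | √((k+1 : ℕ) : ℝ) * y ≤ ∑ i, w k i * ((g i)^2 - 1)} = {g | r * √((k+1 : ℕ) : ℝ) * y + Λ k ≤ jt θ (s k) g} := by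
    intro k y
    ext g
    simp only [Set.mem_ofPred_eq]
    rw [hjt, add_le_add_iff_right, mul_assoc, mul_le_mul_iff_right₀ hr0]
  simp only [hev] at hclt
  -- achievability part
  set η := (ε - GM.gaussQ (q + δ)) / 2 with hη
  have hQ1 : GM.gaussQ (q+δ) < ε := by rw [← hq]; exact gaussQ_lt' (by linarith)
  have hQ1' := gaussQ_nonneg (q+δ)
  have hη0 : 0 < η := by rw [hη]; linarith
  have hη1 : GM.gaussQ (q+δ) < ε - η := by rw [hη]; linarith
  have hη2 : 0 < ε - η := by linarith
  have up := (hclt (q+δ)).eventually (gt_mem_nhds (show ENNReal.ofReal (GM.gaussQ (q+δ)) < ENNReal.ofReal (ε - η) from (ENNReal.ofReal_lt_ofReal_iff hη2).2 hη1))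
  obtain ⟨N0, hach⟩ := achiev (θ := θ) (δ := δ) (η := η) (R0 := R) (C := C) (d := d) hθ hδ hη0 hR hhi hC
  have hbig : ∀ᶠ k : ℕ in atTop, -(r * (q+δ) + δ) / R ≤ √((k+1 : ℕ) : ℝ) := sqrt_lim.eventually_ge_atTop _
  -- converse part
  set ξ := (GM.gaussQ (q - δ) - ε) / 2 with hξ
  have hQ2 : ε < GM.gaussQ (q-δ) := by rw [← hq]; exact gaussQ_lt' (by linarith)
  have hξ0 : 0 < ξ := by rw [hξ]; linarith
  have hξ1 : ε + ξ < GM.gaussQ (q-δ) := by rw [hξ]; linarith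
  have lw := (hclt (q-δ)).eventually (lt_mem_nhds (a := ENNReal.ofReal (ε + ξ)) ((ENNReal.ofReal_lt_ofReal_iff_of_nonneg (by linarith [hε.1])).2 hξ1))
  refine ⟨max (C + Real.log 2) (C + C/(2*θ) - Real.log ξ), ?_⟩
  filter_upwards [up, lw, hbig, eventually_ge_atTop N0] with k hup hlw hb hk
  set n : ℝ := ((k+1 : ℕ) : ℝ) with hn
  have hn0 : 0 < n := hnp k
  have hs0 : 0 < √n := Real.sqrt_pos.2 hn0
  have hs2 : √n * √n = n := Real.mul_self_sqrt hn0.le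
  have hΛ1 := abs_le.1 (hΛb k)
  have hm1 := abs_le.1 (hminb k)
  -- construct the code
  set x := r * √n * (q + δ) + Λ k + δ * √n with hx
  set M := ⌈Real.exp (max x 0)⌉₊ with hM
  have hMpos : 0 < M := Nat.ceil_pos.2 (Real.exp_pos _)
  have hMx : Real.exp (r * √n * (q+δ) + Λ k + δ * √n) ≤ M :=
    (Real.exp_le_exp.2 (le_max_left _ _)).trans (Nat.le_ceil _)
  obtain ⟨c, hc⟩ := hach (k+1) (by omega) (s k) (fun i => ⟨hspos k i, (hs k i).2⟩) (hminb k) (by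
    show n * R - C ≤ Λ k
    linarith [hΛ1.1]) _ M hMx
  have hcode : GM.IsCode a σ (k+1) M d ε := by
    refine code_of_words hσ hMpos (hP1 k) (hP2 k) (hA k) (hspos k) c (hc.trans ?_)
    calc _ ≤ ENNReal.ofReal (ε - η) + ENNReal.ofReal η := by
          gcongr
          refine le_trans (measure_mono fun g hg => ?_) hup.le
          simp only [Set.mem_ofPred_eq] at hg ⊢
          exact le_of_lt hg
      _ = ENNReal.ofReal ε := by rw [← ENNReal.ofReal_add hη2.le hη0.le]; congr 1; ring
  have hMs : GM.Mstar a σ (k+1) d ε ≤ M := Nat.sInf_le hcode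
  have hMsc : GM.IsCode a σ (k+1) (GM.Mstar a σ (k+1) d ε) d ε := by
    have h0 : sInf {M | GM.IsCode a σ (k+1) M d ε} ∈ {M | GM.IsCode a σ (k+1) M d ε} := Nat.sInf_mem ⟨M, hcode⟩
    exact h0
  set Ms := GM.Mstar a σ (k+1) d ε with hMsdef
  obtain ⟨hMspos, c', hc'⟩ := words_of_code hσ (hP1 k) (hP2 k) (hA k) (hspos k) hMsc
  have hMsp : (0:ℝ) < Ms := by exact_mod_cast hMspos
  constructor
  · have cv := converse hθ (hspos k) c' (d := d) (r * √n * (q - δ) + Λ k)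
    have h1 := hlw.trans_le (cv.trans (add_le_add_left hc' _))
    rw [← ENNReal.ofReal_add hε.1.le (by positivity), ENNReal.ofReal_lt_ofReal_iff_of_nonneg (by linarith [hε.1])] at h1
    have h2 : ξ < Ms * Real.exp (-(r * √n * (q - δ) + Λ k) + (n * d - ∑ i, min θ (s k i)) / (2*θ)) := by linarith
    have h3 := Real.log_lt_log hξ0 h2
    rw [Real.log_mul hMsp.ne' (Real.exp_pos _).ne', Real.log_exp] at h3
    have h4 : (n * d - ∑ i, min θ (s k i)) / (2*θ) ≤ C / (2*θ) := by
      gcongr; linarith [hm1.1]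
    have h5 := le_max_right (C + Real.log 2) (C + C/(2*θ) - Real.log ξ)
    linarith [hΛ1.1]
  · have h1 : Real.log Ms ≤ Real.log M := Real.log_le_log hMsp (by exact_mod_cast hMs)
    have h2 : (M:ℝ) ≤ 2 * Real.exp (max x 0) := by
      have e1 := (Nat.ceil_lt_add_one (Real.exp_pos (max x 0)).le).le
      have e2 := Real.one_le_exp (le_max_right x 0)
      linarith
    have h3 := Real.log_le_log (by exact_mod_cast hMpos) h2
    rw [Real.log_mul (by norm_num) (Real.exp_pos _).ne', Real.log_exp] at h3
    have h4 : max x 0 ≤ n * R + √n * (r * (q+δ) + δ) + C := by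
      refine max_le ?_ ?_
      · rw [hx]; linarith [hΛ1.2]
      · rw [div_le_iff₀ hR] at hb
        have : 0 ≤ √n * (√n * R + (r * (q+δ) + δ)) := mul_nonneg hs0.le (by linarith)
        have e : √n * (√n * R + (r * (q+δ) + δ)) = n * R + √n * (r * (q+δ) + δ) := by
          rw [mul_add, ← mul_assoc, hs2]
        linarith
    have h5 := le_max_left (C + Real.log 2) (C + C/(2*θ) - Real.log ξ)
    linarith

theorem final {a σ ε d θ q : ℝ} (ha0 : 0 ≤ a) (ha1 : a < 1) (hσ : 0 < σ)
    (hε : ε ∈ Set.Ioo (0 : ℝ) 1) (hdmax : d < σ ^ 2 / (1 - a ^ 2))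
    (hθ : 0 < θ) (hw : GM.waterEq a σ θ d) (hq : GM.gaussQ q = ε) :
    Filter.Tendsto
      (fun n : ℕ => Real.sqrt n * (GM.rate a σ n d ε - GM.RU a σ θ))
      Filter.atTop (nhds (Real.sqrt (GM.VU a σ θ) * q)) := by
  rw [← tendsto_add_atTop_iff_nat 1, Metric.tendsto_atTop']
  intro e he
  set r := √(GM.VU a σ θ) with hr
  have hr0 : 0 ≤ r := Real.sqrt_nonneg _
  obtain ⟨δ, hδ, hδe⟩ : ∃ δ : ℝ, 0 < δ ∧ (r + 1) * δ = e/2 := ⟨e / 2 / (r+1), by positivity, by field_simp⟩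
  obtain ⟨K, hK⟩ := main_bounds ha0 ha1 hσ hε hdmax hθ hw hq hδ
  have hb : ∀ᶠ k : ℕ in atTop, 2 * |K| / e + 1 ≤ √((k+1 : ℕ) : ℝ) := sqrt_lim.eventually_ge_atTop _
  obtain ⟨N, hN⟩ := eventually_atTop.1 (hK.and hb)
  refine ⟨N, fun k hk => ?_⟩
  obtain ⟨⟨h1, h2⟩, h3⟩ := hN k hk.le
  rw [← hr] at h1 h2
  unfold GM.rate
  set n : ℝ := ((k+1 : ℕ) : ℝ) with hn
  have hn0 : 0 < n := by positivity
  have hs0 : 0 < √n := Real.sqrt_pos.2 hn0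
  have hs2 : √n * √n = n := Real.mul_self_sqrt hn0.le
  set l := Real.log (GM.Mstar a σ (k+1) d ε)
  set R := GM.RU a σ θ
  have hKs : |K| < e/2 * √n := by
    have : 2 * |K| / e < √n := by linarith
    rw [div_lt_iff₀ he] at this
    linarith
  have hK1 := abs_lt.1 hKs
  have ex : √n * (l / n - R) - r * q = (l - n * R - √n * (r * q)) / √n := by
    rw [eq_div_iff hs0.ne']
    have : l / n * n = l := by field_simp
    linear_combination (l/n - R) * hs2 + this
  rw [Real.dist_eq, ex, abs_lt, lt_div_iff₀ hs0, div_lt_iff₀ hs0]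
  have hd' : √n * (r * δ + δ) = √n * (e/2) := by rw [← hδe]; ring
  have hd2 : 0 < √n * δ := by positivity
  constructor
  · linarith [hK1.1, hK1.2]
  · linarith [hK1.1, hK1.2]

end GMP

theorem stmt0 (a σ ε d θ Qinv : ℝ)
    (ha0 : 0 ≤ a) (ha1 : a < 1) (hσ : 0 < σ)
    (hε : ε ∈ Set.Ioo (0 : ℝ) 1)
    (hd0 : 0 < d) (hdmax : d < σ ^ 2 / (1 - a ^ 2))
    (hθ : 0 < θ) (hwater : GM.waterEq a σ θ d)
    (hQinv : GM.gaussQ Qinv = ε) :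
    Filter.Tendsto
      (fun n : ℕ => Real.sqrt n * (GM.rate a σ n d ε - GM.RU a σ θ))
      Filter.atTop (nhds (Real.sqrt (GM.VU a σ θ) * Qinv)) := by
  exact GMP.final ha0 ha1 hσ hε hdmax hθ hwater hQinv

end
end

section
/- Fix a ∈ [0,1), σ > 0 and d ∈ (0, d_max). For each n, let θ_n > 0 be the n-th order water level determined by d = (1/n)Σ_{i=1}^n min(θ_n, σ_i²). Then lim_{n→∞} (1/n) Σ_{i=1}^n (1/2) min(1, (σ_i²/θ_n)²) = (1/4π)∫_{−π}^{π} min(1, (S(w)/θ)²) dw, where θ > 0 is the unique solution of d = (1/2π)∫_{−π}^{π} min(θ, S(w)) dw. In other words, the per-letter variance of the d-tilted information of the Gauss-Markov source converges to the dispersion V_U(d). -/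
open MeasureTheory ProbabilityTheory Real Filter Matrix
open scoped NNReal ENNReal

noncomputable section

namespace GM

lemma Amat_mulVec_zero (a : ℝ) (n : ℕ) (u : Fin n → ℝ) (h : 0 < n) :
    (Amat a n *ᵥ u) ⟨0, h⟩ = u ⟨0, h⟩ := by
  rw [Matrix.mulVec, dotProduct, Finset.sum_eq_single ⟨0, h⟩]
  · simp [Amat]
  · intro b _ hb
    simp [Amat, Ne.symm hb]
  · simp

lemma Amat_mulVec_succ (a : ℝ) (n : ℕ) (u : Fin n → ℝ) (i : ℕ) (h : i + 1 < n) :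
    (Amat a n *ᵥ u) ⟨i + 1, h⟩ = u ⟨i + 1, h⟩ - a * u ⟨i, by omega⟩ := by
  rw [Matrix.mulVec, dotProduct,
    Finset.sum_eq_add (⟨i + 1, h⟩ : Fin n) ⟨i, by omega⟩ (by simp)]
  · simp [Amat]; ring
  · intro b _ hb
    have h1 : (b : ℕ) ≠ i + 1 := fun hh => hb.1 (Fin.ext hh)
    have h2 : (b : ℕ) ≠ i := fun hh => hb.2 (Fin.ext hh)
    simp [Amat, Ne.symm hb.1, Ne.symm h2]
  · simp
  · simp

lemma AmatT_mulVec (a : ℝ) (n : ℕ) (u : Fin n → ℝ) (i : ℕ) (h : i + 1 < n) :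
    ((Amat a n)ᵀ *ᵥ u) ⟨i, by omega⟩ = u ⟨i, by omega⟩ - a * u ⟨i + 1, h⟩ := by
  rw [Matrix.mulVec, dotProduct,
    Finset.sum_eq_add (⟨i, by omega⟩ : Fin n) ⟨i + 1, h⟩ (by simp)]
  · simp [Amat]; ring
  · intro b _ hb
    have h1 : (b : ℕ) ≠ i + 1 := fun hh => hb.2 (Fin.ext hh)
    simp [Amat, hb.1, h1]
  · simp
  · simp

lemma M_mulVec (a : ℝ) (n : ℕ) (u : Fin n → ℝ) (i : ℕ) (h : i + 2 < n) :
    (((Amat a n)ᵀ * Amat a n) *ᵥ u) ⟨i + 1, by omega⟩ =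
      (1 + a ^ 2) * u ⟨i + 1, by omega⟩ - a * u ⟨i, by omega⟩ - a * u ⟨i + 2, h⟩ := by
  rw [← Matrix.mulVec_mulVec, AmatT_mulVec a n _ (i + 1) h, Amat_mulVec_succ, Amat_mulVec_succ]
  ring

lemma Mpow_mulVec (a w φ : ℝ) (n k : ℕ) : ∀ (j : Fin n), k ≤ (j : ℕ) → (j : ℕ) + k < n →
    ((((Amat a n)ᵀ * Amat a n) ^ k) *ᵥ (fun l : Fin n => Real.cos (l * w + φ))) j =
      (1 + a ^ 2 - 2 * a * Real.cos w) ^ k * Real.cos (j * w + φ) := by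
  induction k with
  | zero => intro j _ _; simp
  | succ k ih =>
    rintro ⟨j, hj⟩ h1 h2
    obtain ⟨i, rfl⟩ : ∃ i, j = i + 1 := ⟨j - 1, by simp at h1; omega⟩
    simp only at h1 h2
    rw [pow_succ', ← Matrix.mulVec_mulVec, M_mulVec a n _ i (by omega),
      ih _ (by simp; omega) (by simp; omega), ih _ (by simp; omega) (by simp; omega),
      ih _ (by simp; omega) (by simp; omega)]
    have e1 : ((i : ℕ) : ℝ) * w + φ = ((i + 1 : ℕ) : ℝ) * w + φ - w := by push_cast; ring
    have e2 : ((i + 2 : ℕ) : ℝ) * w + φ = ((i + 1 : ℕ) : ℝ) * w + φ + w := by push_cast; ring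
    simp only [e1, e2, Real.cos_sub, Real.cos_add]
    ring

lemma integral_cos_int (m : ℤ) :
    ∫ w in (-π)..π, Real.cos (m * w) = if m = 0 then 2 * π else 0 := by
  split_ifs with h
  · subst h; simp; ring
  · have hm : (m : ℝ) ≠ 0 := by exact_mod_cast h
    rw [intervalIntegral.integral_comp_mul_left _ hm, integral_cos]
    simp [Real.sin_int_mul_pi]

def cm (a : ℝ) (F : ℝ → ℝ) : ℝ :=
  (1 / (2 * π)) * ∫ w in (-π)..π, F (1 + a ^ 2 - 2 * a * Real.cos w)

lemma Mpow_diag (a : ℝ) (n k : ℕ) (j : Fin n) (h1 : k ≤ (j : ℕ)) (h2 : (j : ℕ) + k < n) :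
    (((Amat a n)ᵀ * Amat a n) ^ k) j j = cm a (fun x => x ^ k) := by
  set M := ((Amat a n)ᵀ * Amat a n) ^ k with hM
  have key : ∀ w : ℝ, (1 + a ^ 2 - 2 * a * Real.cos w) ^ k =
      ∑ l : Fin n, M j l * Real.cos ((((l : ℕ) : ℤ) - ((j : ℕ) : ℤ) : ℤ) * w) := by
    intro w
    have := Mpow_mulVec a w (-(j * w)) n k j h1 h2
    rw [add_neg_cancel, Real.cos_zero, mul_one] at this
    rw [← this, Matrix.mulVec, dotProduct]
    refine Finset.sum_congr rfl fun l _ => ?_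
    congr 2
    push_cast; ring
  unfold cm
  simp only [key]
  rw [intervalIntegral.integral_finsetSum]
  · simp only [intervalIntegral.integral_const_mul, integral_cos_int]
    rw [Finset.sum_eq_single j]
    · simp; field_simp
    · intro b _ hb
      have : ((b : ℕ) : ℤ) - ((j : ℕ) : ℤ) ≠ 0 := by
        intro h; apply hb; ext; omega
      simp [this]
    · simp
  · intro i _
    exact Continuous.intervalIntegrable (by fun_prop) _ _

lemma eig_bounds (a : ℝ) (ha0 : 0 ≤ a) (ha1 : a < 1) (n : ℕ) (μ : Fin n → ℝ)
    (h : IsEigs μ ((Amat a n)ᵀ * Amat a n)) (i : Fin n) :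
    μ i ∈ Set.Icc ((1 - a) ^ 2) ((1 + a) ^ 2) := by
  obtain ⟨_, P, hP1, hP2, hM⟩ := h
  set p : Fin n → ℝ := fun j => P j i with hp
  have hpp : ∑ j, p j ^ 2 = 1 := by
    have := congrFun (congrFun hP2 i) i
    simp [Matrix.mul_apply] at this
    rw [← this]; refine Finset.sum_congr rfl fun j _ => by simp [hp]; ring
  have hq : ∑ j, ((Amat a n *ᵥ p) j) ^ 2 = μ i := by
    have h1 : (Amat a n * P)ᵀ * (Amat a n * P) = Matrix.diagonal μ := by
      rw [Matrix.transpose_mul, Matrix.mul_assoc, ← Matrix.mul_assoc (Amat a n)ᵀ, hM,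
        Matrix.mul_assoc, Matrix.mul_assoc, hP2, Matrix.mul_one, ← Matrix.mul_assoc, hP2,
        Matrix.one_mul]
    have := congrFun (congrFun h1 i) i
    rw [Matrix.mul_apply, Matrix.diagonal_apply_eq] at this
    rw [← this]
    refine Finset.sum_congr rfl fun j _ => ?_
    rw [Matrix.transpose_apply, Matrix.mul_apply, Matrix.mulVec, dotProduct, pow_two]
  obtain ⟨m, rfl⟩ : ∃ m, n = m + 1 := ⟨n - 1, by have := i.2; omega⟩
  have e0 := Amat_mulVec_zero a (m + 1) p (by omega)
  have e1 : ∀ j : Fin m, (Amat a (m + 1) *ᵥ p) j.succ = p j.succ - a * p j.castSucc := by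
    intro j
    exact Amat_mulVec_succ a (m + 1) p j (by omega)
  have e0' : (Amat a (m + 1) *ᵥ p) 0 = p 0 := e0
  rw [Fin.sum_univ_succ, e0'] at hq
  simp only [e1] at hq
  have s1 := hpp
  rw [Fin.sum_univ_succ] at s1
  have s2 := hpp
  rw [Fin.sum_univ_castSucc] at s2
  have l1 : ∑ j : Fin m, ((1 - a) * p j.succ ^ 2 - a * (1 - a) * p j.castSucc ^ 2) ≤
      ∑ j : Fin m, (p j.succ - a * p j.castSucc) ^ 2 := by
    refine Finset.sum_le_sum fun j _ => ?_
    nlinarith [mul_nonneg ha0 (sq_nonneg (p j.succ - p j.castSucc))]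
  have l2 : ∑ j : Fin m, (p j.succ - a * p j.castSucc) ^ 2 ≤
      ∑ j : Fin m, ((1 + a) * p j.succ ^ 2 + a * (1 + a) * p j.castSucc ^ 2) := by
    refine Finset.sum_le_sum fun j _ => ?_
    nlinarith [mul_nonneg ha0 (sq_nonneg (p j.succ + p j.castSucc))]
  rw [Finset.sum_sub_distrib, ← Finset.mul_sum, ← Finset.mul_sum] at l1
  rw [Finset.sum_add_distrib, ← Finset.mul_sum, ← Finset.mul_sum] at l2
  have t1 : ∑ j : Fin m, p j.succ ^ 2 = 1 - p 0 ^ 2 := by linarith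
  have t2 : ∑ j : Fin m, p j.castSucc ^ 2 = 1 - p (Fin.last m) ^ 2 := by linarith
  rw [t1, t2] at l1 l2
  have q1 := sq_nonneg (p 0)
  have q2 := sq_nonneg (p (Fin.last m))
  have q3 := mul_nonneg ha0 q1
  have q4 := mul_nonneg ha0 q2
  have q5 : 0 ≤ a * (1 - a) * p (Fin.last m) ^ 2 := by
    have : 0 ≤ 1 - a := by linarith
    positivity
  have q6 : 0 ≤ a * (1 + a) * p (Fin.last m) ^ 2 := by positivity
  constructor
  · nlinarith
  · nlinarith

lemma Mpow_eq {n : ℕ} (μ : Fin n → ℝ) (M : Matrix (Fin n) (Fin n) ℝ) (P : Matrix (Fin n) (Fin n) ℝ)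
    (hP2 : Pᵀ * P = 1) (hP1 : P * Pᵀ = 1)
    (hM : M = P * Matrix.diagonal μ * Pᵀ) (k : ℕ) :
    M ^ k = P * Matrix.diagonal (fun i => μ i ^ k) * Pᵀ := by
  induction k with
  | zero => simp [hP1]
  | succ k ih =>
    rw [pow_succ, ih, hM]
    calc P * Matrix.diagonal (fun i => μ i ^ k) * Pᵀ * (P * Matrix.diagonal μ * Pᵀ)
        = P * Matrix.diagonal (fun i => μ i ^ k) * (Pᵀ * P) * Matrix.diagonal μ * Pᵀ := by
          simp only [Matrix.mul_assoc]
      _ = _ := by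
          rw [hP2, Matrix.mul_one, Matrix.mul_assoc P, Matrix.diagonal_mul_diagonal]
          simp only [pow_succ]

lemma moment_bound (a : ℝ) (ha0 : 0 ≤ a) (ha1 : a < 1) (n k : ℕ) (μ : Fin n → ℝ)
    (h : IsEigs μ ((Amat a n)ᵀ * Amat a n)) :
    |∑ i, μ i ^ k - n * cm a (fun x => x ^ k)| ≤
      2 * k * (((1 + a) ^ 2) ^ k + |cm a (fun x => x ^ k)|) := by
  have hb := eig_bounds a ha0 ha1 n μ h
  obtain ⟨_, P, hP1, hP2, hM⟩ := h
  set M := (Amat a n)ᵀ * Amat a n with hMdef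
  have hk := Mpow_eq μ M P hP2 hP1 hM k
  set c := cm a (fun x => x ^ k) with hc
  have htr : ∑ i, μ i ^ k = ∑ j, (M ^ k) j j := by
    have : (M ^ k).trace = ∑ i, μ i ^ k := by
      rw [hk, Matrix.trace_mul_comm, ← Matrix.mul_assoc, hP2, Matrix.one_mul, Matrix.trace_diagonal]
    rw [← this]; rfl
  have hent : ∀ j, |(M ^ k) j j| ≤ ((1 + a) ^ 2) ^ k := by
    intro j
    have e : (M ^ k) j j = ∑ i, P j i ^ 2 * μ i ^ k := by
      rw [hk, Matrix.mul_apply]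
      refine Finset.sum_congr rfl fun i _ => ?_
      rw [Matrix.mul_diagonal, Matrix.transpose_apply]; ring
    have hs : ∑ i, P j i ^ 2 = 1 := by
      have := congrFun (congrFun hP1 j) j
      simp [Matrix.mul_apply] at this
      rw [← this]; refine Finset.sum_congr rfl fun j _ => by ring
    have hμ0 : ∀ i, 0 ≤ μ i := fun i => le_trans (sq_nonneg _) (hb i).1
    rw [e, abs_of_nonneg (Finset.sum_nonneg fun i _ =>
      mul_nonneg (sq_nonneg _) (pow_nonneg (hμ0 i) _))]
    calc _ ≤ ∑ i, P j i ^ 2 * ((1 + a) ^ 2) ^ k := Finset.sum_le_sum fun i _ =>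
            mul_le_mul_of_nonneg_left (pow_le_pow_left₀ (hμ0 i) (hb i).2 k) (sq_nonneg _)
      _ = _ := by rw [← Finset.sum_mul, hs, one_mul]
  have e2 : ∑ i, μ i ^ k - n * c = ∑ j, ((M ^ k) j j - c) := by
    rw [htr, Finset.sum_sub_distrib]; simp
  rw [e2]
  set C := ((1 + a) ^ 2) ^ k + |c| with hC
  have hC0 : 0 ≤ C := by positivity
  let T : Finset (Fin n) := Finset.univ.filter fun j => ¬ (k ≤ (j : ℕ) ∧ (j : ℕ) + k < n)
  have hT : T.card ≤ 2 * k := by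
    have : (T.map Fin.valEmbedding) ⊆ Finset.range k ∪ Finset.Ico (n - k) n := by
      intro x hx
      simp [T] at hx
      obtain ⟨y, hy, rfl⟩ := hx
      have := y.2
      simp only [Finset.mem_union, Finset.mem_range, Finset.mem_Ico]
      by_cases h : k ≤ (y : ℕ)
      · have := hy h; omega
      · omega
    have h2 := Finset.card_le_card this
    rw [Finset.card_map] at h2
    have h3 := Finset.card_union_le (Finset.range k) (Finset.Ico (n - k) n)
    simp at h3
    omega
  calc |∑ j, ((M ^ k) j j - c)| ≤ ∑ j, |(M ^ k) j j - c| := Finset.abs_sum_le_sum_abs _ _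
    _ = ∑ j ∈ T, |(M ^ k) j j - c| := by
        symm
        refine Finset.sum_subset (Finset.subset_univ _) fun j _ hj => ?_
        simp only [T, Finset.mem_filter, Finset.mem_univ, true_and, not_not] at hj
        rw [hMdef, Mpow_diag a n k j hj.1 hj.2]; simp [hc]
    _ ≤ ∑ j ∈ T, C := Finset.sum_le_sum fun j _ => by
        refine (abs_sub _ _).trans ?_
        have := hent j
        rw [hC]; linarith
    _ = T.card * C := by simp
    _ ≤ 2 * k * C := by
        gcongr
        exact_mod_cast hT

lemma moment_tendsto (a : ℝ) (ha0 : 0 ≤ a) (ha1 : a < 1) (k : ℕ) (μ : (n : ℕ) → Fin n → ℝ)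
    (h : ∀ n, IsEigs (μ n) ((Amat a n)ᵀ * Amat a n)) :
    Tendsto (fun n : ℕ => (1 / (n : ℝ)) * ∑ i : Fin n, μ n i ^ k) atTop
      (nhds (cm a (fun x => x ^ k))) := by
  rw [tendsto_iff_norm_sub_tendsto_zero]
  set C := 2 * k * (((1 + a) ^ 2) ^ k + |cm a (fun x => x ^ k)|) with hC
  refine squeeze_zero' (Eventually.of_forall fun _ => norm_nonneg _) ?_
    (tendsto_const_div_atTop_nhds_zero_nat C)
  filter_upwards [eventually_gt_atTop 0] with n hn
  have hn' : (0 : ℝ) < n := by exact_mod_cast hn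
  have e : (1 / (n : ℝ)) * ∑ i : Fin n, μ n i ^ k - cm a (fun x => x ^ k) =
      (∑ i : Fin n, μ n i ^ k - n * cm a (fun x => x ^ k)) / n := by
    field_simp
  rw [e, norm_div, Real.norm_eq_abs, Real.norm_eq_abs, abs_of_pos hn']
  gcongr
  exact moment_bound a ha0 ha1 n k (μ n) (h n)

end GM
namespace GM

lemma g_mem (a : ℝ) (ha0 : 0 ≤ a) (w : ℝ) :
    1 + a ^ 2 - 2 * a * Real.cos w ∈ Set.Icc ((1 - a) ^ 2) ((1 + a) ^ 2) := by
  have h1 := Real.cos_le_one w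
  have h2 := Real.neg_one_le_cos w
  constructor <;> nlinarith

lemma g_pos (a : ℝ) (ha0 : 0 ≤ a) (ha1 : a < 1) (w : ℝ) :
    0 < 1 + a ^ 2 - 2 * a * Real.cos w :=
  lt_of_lt_of_le (by have : 0 < 1 - a := by linarith
                     positivity) (g_mem a ha0 w).1

lemma comp_cont (a : ℝ) (ha0 : 0 ≤ a) (F : ℝ → ℝ)
    (hF : ContinuousOn F (Set.Icc ((1 - a) ^ 2) ((1 + a) ^ 2))) :
    Continuous fun w => F (1 + a ^ 2 - 2 * a * Real.cos w) :=
  hF.comp_continuous (by fun_prop) (g_mem a ha0)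

lemma poly_tendsto (a : ℝ) (ha0 : 0 ≤ a) (ha1 : a < 1) (μ : (n : ℕ) → Fin n → ℝ)
    (h : ∀ n, IsEigs (μ n) ((Amat a n)ᵀ * Amat a n)) (p : Polynomial ℝ) :
    Tendsto (fun n : ℕ => (1 / (n : ℝ)) * ∑ i : Fin n, p.eval (μ n i)) atTop
      (nhds (cm a (fun x => p.eval x))) := by
  have e1 : ∀ n : ℕ, (1 / (n : ℝ)) * ∑ i : Fin n, p.eval (μ n i) =
      ∑ k ∈ Finset.range (p.natDegree + 1),
        p.coeff k * ((1 / (n : ℝ)) * ∑ i : Fin n, μ n i ^ k) := by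
    intro n
    simp only [Polynomial.eval_eq_sum_range, Finset.mul_sum]
    rw [Finset.sum_comm]
    refine Finset.sum_congr rfl fun k _ => Finset.sum_congr rfl fun i _ => by ring
  have e2 : cm a (fun x => p.eval x) =
      ∑ k ∈ Finset.range (p.natDegree + 1), p.coeff k * cm a (fun x => x ^ k) := by
    simp only [cm, Polynomial.eval_eq_sum_range]
    rw [intervalIntegral.integral_finsetSum]
    · simp only [intervalIntegral.integral_const_mul, Finset.mul_sum]
      refine Finset.sum_congr rfl fun k _ => by ring
    · intro i _
      exact Continuous.intervalIntegrable (by fun_prop) _ _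
  simp only [e1, e2]
  exact tendsto_finsetSum _ fun k _ => (moment_tendsto a ha0 ha1 k μ h).const_mul _

lemma cm_sub_le (a : ℝ) (ha0 : 0 ≤ a) (F G : ℝ → ℝ)
    (hF : ContinuousOn F (Set.Icc ((1 - a) ^ 2) ((1 + a) ^ 2)))
    (hG : ContinuousOn G (Set.Icc ((1 - a) ^ 2) ((1 + a) ^ 2))) (ε : ℝ)
    (h : ∀ x ∈ Set.Icc ((1 - a) ^ 2) ((1 + a) ^ 2), |F x - G x| ≤ ε) :
    |cm a F - cm a G| ≤ ε := by
  unfold cm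
  rw [← mul_sub, ← intervalIntegral.integral_sub
    ((comp_cont a ha0 F hF).intervalIntegrable _ _) ((comp_cont a ha0 G hG).intervalIntegrable _ _)]
  have := intervalIntegral.norm_integral_le_of_norm_le_const (a := -π) (b := π) (C := ε)
    (f := fun w => F (1 + a ^ 2 - 2 * a * Real.cos w) - G (1 + a ^ 2 - 2 * a * Real.cos w))
    (fun w _ => by rw [Real.norm_eq_abs]; exact h _ (g_mem a ha0 w))
  rw [Real.norm_eq_abs] at this
  have hpi := Real.pi_pos
  rw [abs_mul, abs_of_pos (by positivity : 0 < 1 / (2 * π))]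
  rw [abs_of_pos (by linarith : 0 < π - -π)] at this
  calc _ ≤ 1 / (2 * π) * (ε * (π - -π)) := by gcongr
    _ = ε := by field_simp; ring

lemma szego (a : ℝ) (ha0 : 0 ≤ a) (ha1 : a < 1) (μ : (n : ℕ) → Fin n → ℝ)
    (h : ∀ n, IsEigs (μ n) ((Amat a n)ᵀ * Amat a n)) (F : ℝ → ℝ)
    (hF : ContinuousOn F (Set.Icc ((1 - a) ^ 2) ((1 + a) ^ 2))) :
    Tendsto (fun n : ℕ => (1 / (n : ℝ)) * ∑ i : Fin n, F (μ n i)) atTop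
      (nhds (cm a F)) := by
  rw [Metric.tendsto_atTop]
  intro ε hε
  obtain ⟨p, hp⟩ := exists_polynomial_near_of_continuousOn _ _ F hF (ε / 4) (by linarith)
  obtain ⟨N, hN⟩ := Metric.tendsto_atTop.1 (poly_tendsto a ha0 ha1 μ h p) (ε / 4) (by linarith)
  refine ⟨N, fun n hn => ?_⟩
  have h1 := hN n hn
  have h2 := cm_sub_le a ha0 (fun x => p.eval x) F p.continuous.continuousOn hF (ε / 4)
    (fun x hx => (hp x hx).le)
  have h3 : |(1 / (n : ℝ)) * ∑ i : Fin n, p.eval (μ n i) - (1 / (n : ℝ)) * ∑ i : Fin n, F (μ n i)|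
      ≤ ε / 4 := by
    rw [← mul_sub, ← Finset.sum_sub_distrib, abs_mul, abs_of_nonneg (by positivity)]
    calc _ ≤ 1 / (n : ℝ) * ∑ i : Fin n, ε / 4 := by
          gcongr
          refine (Finset.abs_sum_le_sum_abs _ _).trans (Finset.sum_le_sum fun i _ => ?_)
          exact (hp _ (eig_bounds a ha0 ha1 n (μ n) (h n) i)).le
      _ ≤ ε / 4 := by
          rcases Nat.eq_zero_or_pos n with h0 | h0
          · subst h0; simp; linarith
          · have : (0 : ℝ) < n := by exact_mod_cast h0
            simp; field_simp; rfl
  rw [Real.dist_eq] at h1 ⊢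
  rw [abs_lt] at h1 ⊢
  rw [abs_le] at h2 h3
  constructor <;> linarith

lemma cm_mono_lt (a : ℝ) (ha0 : 0 ≤ a) (F G : ℝ → ℝ)
    (hF : ContinuousOn F (Set.Icc ((1 - a) ^ 2) ((1 + a) ^ 2)))
    (hG : ContinuousOn G (Set.Icc ((1 - a) ^ 2) ((1 + a) ^ 2)))
    (hle : ∀ x, F x ≤ G x) (hlt : F ((1 - a) ^ 2) < G ((1 - a) ^ 2)) :
    cm a F < cm a G := by
  have hpi := Real.pi_pos
  unfold cm
  refine mul_lt_mul_of_pos_left ?_ (by positivity)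
  refine intervalIntegral.integral_lt_integral_of_continuousOn_of_le_of_exists_lt (by linarith)
    (comp_cont a ha0 F hF).continuousOn (comp_cont a ha0 G hG).continuousOn
    (fun x _ => hle _) ⟨0, ⟨by linarith, by linarith⟩, ?_⟩
  have : 1 + a ^ 2 - 2 * a * Real.cos 0 = (1 - a) ^ 2 := by rw [Real.cos_zero]; ring
  rw [this]; exact hlt

lemma cm_inv (a : ℝ) (ha0 : 0 ≤ a) (ha1 : a < 1) :
    cm a (fun x => x⁻¹) = 1 / (1 - a ^ 2) := by
  have hP := DiffContOnCl.circleAverage_poissonKernel_smul (f := fun _ => (1 : ℂ)) (c := 0)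
    (R := 1) (w := (a : ℂ)) diffContOnCl_const (by simp [abs_of_nonneg ha0, ha1])
  have hk : ∀ t : ℝ, poissonKernel 0 (a : ℂ) (circleMap 0 1 t) =
      (1 - a ^ 2) * (1 + a ^ 2 - 2 * a * Real.cos t)⁻¹ := by
    intro t
    rw [poissonKernel_def, div_eq_mul_inv]
    congr 2
    · simp
    · simp
    · have : circleMap 0 1 t = ⟨Real.cos t, Real.sin t⟩ := by
        apply Complex.ext <;> simp [circleMap, Complex.exp_ofReal_mul_I_re, Complex.exp_ofReal_mul_I_im]
      rw [this, ← Complex.normSq_eq_norm_sq, Complex.normSq_apply]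
      simp
      nlinarith [Real.sin_sq_add_cos_sq t]
  rw [Real.circleAverage_def] at hP
  simp only [Pi.smul_apply', hk, Complex.real_smul, mul_one] at hP
  rw [intervalIntegral.integral_ofReal, ← Complex.ofReal_mul] at hP
  have hP' := Complex.ofReal_eq_one.1 hP
  rw [intervalIntegral.integral_const_mul] at hP'
  have hper : Function.Periodic (fun t : ℝ => (1 + a ^ 2 - 2 * a * Real.cos t)⁻¹) (2 * π) := by
    intro t; simp
  have := hper.intervalIntegral_add_eq (-π) 0
  rw [zero_add, show -π + 2 * π = π by ring] at this
  unfold cm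
  rw [this]
  have h1 : 1 - a ^ 2 ≠ 0 := by nlinarith
  rw [eq_div_iff h1]
  refine Eq.trans ?_ hP'
  ring

lemma Icc_eq_cm (F : ℝ → ℝ) :
    ∫ w in Set.Icc (-π) π, F w = ∫ w in (-π)..π, F w := by
  rw [intervalIntegral.integral_of_le (by linarith [Real.pi_pos]), integral_Icc_eq_integral_Ioc]

end GM
namespace GM

lemma cont_H (a σ t : ℝ) (ha1 : a < 1) :
    ContinuousOn (fun x : ℝ => min t (σ ^ 2 / x)) (Set.Icc ((1 - a) ^ 2) ((1 + a) ^ 2)) := by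
  have h1 : 0 < 1 - a := by linarith
  refine ContinuousOn.inf continuousOn_const (continuousOn_const.div continuousOn_id fun x hx => ?_)
  exact (lt_of_lt_of_le (by positivity) hx.1).ne'

lemma cont_V (a σ t : ℝ) (ha1 : a < 1) :
    ContinuousOn (fun x : ℝ => (1 / 2) * min 1 ((σ ^ 2 / x / t) ^ 2))
      (Set.Icc ((1 - a) ^ 2) ((1 + a) ^ 2)) := by
  have h1 : 0 < 1 - a := by linarith
  refine continuousOn_const.mul (ContinuousOn.inf continuousOn_const
    (((continuousOn_const.div continuousOn_id fun x hx => ?_).div_const _).pow 2))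
  exact (lt_of_lt_of_le (by positivity) hx.1).ne'

lemma VU_eq (a σ t : ℝ) :
    VU a σ t = cm a (fun x : ℝ => (1 / 2) * min 1 ((σ ^ 2 / x / t) ^ 2)) := by
  unfold VU cm S
  rw [Icc_eq_cm, intervalIntegral.integral_const_mul]
  ring

lemma VU_cont (a σ θ : ℝ) (ha0 : 0 ≤ a) (ha1 : a < 1) (hθ : 0 < θ) :
    ContinuousAt (fun t => VU a σ t) θ := by
  unfold VU
  refine ContinuousAt.mul continuousAt_const ?_
  have hS : Continuous fun w => S a σ w := by
    unfold S
    exact continuous_const.div (by fun_prop) fun w => (g_pos a ha0 ha1 w).ne'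
  refine tendsto_integral_filter_of_dominated_convergence (fun _ => (1 : ℝ)) ?_ ?_ ?_ ?_
  · refine Eventually.of_forall fun t => ?_
    have : Continuous fun w => min 1 ((S a σ w / t) ^ 2) := by fun_prop
    exact this.aestronglyMeasurable
  · refine Eventually.of_forall fun t => Eventually.of_forall fun w => ?_
    rw [Real.norm_eq_abs, abs_of_nonneg (by positivity)]
    exact min_le_left _ _
  · exact integrableOn_const (by simp)
  · refine Eventually.of_forall fun w => ?_
    have : ContinuousAt (fun t => min 1 ((S a σ w / t) ^ 2)) θ :=
      continuousAt_const.min ((continuousAt_const.div continuousAt_id hθ.ne').pow 2)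
    exact this

end GM

theorem stmt3 (a σ d θ : ℝ) (ha0 : 0 ≤ a) (ha1 : a < 1) (hσ : 0 < σ)
    (hd0 : 0 < d) (hdmax : d < σ ^ 2 / (1 - a ^ 2))
    (μv : (n : ℕ) → Fin n → ℝ)
    (hμ : ∀ n, GM.IsEigs (μv n) ((GM.Amat a n)ᵀ * GM.Amat a n))
    (θn : ℕ → ℝ)
    (hθn : ∀ n, 0 < n → 0 < θn n ∧
      d = (1 / (n : ℝ)) * ∑ i : Fin n, min (θn n) (σ ^ 2 / μv n i))
    (hθ : 0 < θ) (hwater : GM.waterEq a σ θ d) :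
    Filter.Tendsto
      (fun n : ℕ => (1 / (n : ℝ)) * ∑ i : Fin n, (1 / 2) * min 1 ((σ ^ 2 / μv n i / θn n) ^ 2))
      Filter.atTop (nhds (GM.VU a σ θ)) := by
  have hb := fun n i => GM.eig_bounds a ha0 ha1 n (μv n) (hμ n) i
  have h1a : 0 < 1 - a := by linarith
  have hμ0 : ∀ n i, 0 < μv n i := fun n i => lt_of_lt_of_le (by positivity) (hb n i).1
  have hd : d = GM.cm a (fun x => min θ (σ ^ 2 / x)) := by
    unfold GM.waterEq GM.S at hwater
    rw [hwater, GM.Icc_eq_cm]; rfl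
  -- the water level is below the maximum of the spectrum
  have hθS : θ < σ ^ 2 / (1 - a) ^ 2 := by
    by_contra hcon
    push Not at hcon
    have : d = σ ^ 2 / (1 - a ^ 2) := by
      have e : GM.cm a (fun x => min θ (σ ^ 2 / x)) = σ ^ 2 * GM.cm a (fun x => x⁻¹) := by
        have : ∀ w : ℝ, min θ (σ ^ 2 / (1 + a ^ 2 - 2 * a * Real.cos w)) =
            σ ^ 2 * (1 + a ^ 2 - 2 * a * Real.cos w)⁻¹ := by
          intro w
          rw [← div_eq_mul_inv]
          refine min_eq_right (le_trans ?_ hcon)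
          have := (GM.g_mem a ha0 w).1
          gcongr
        unfold GM.cm
        simp only [this]
        rw [intervalIntegral.integral_const_mul]
        ring
      rw [hd, e, GM.cm_inv a ha0 ha1]; ring
    linarith
  have hlow : ∀ t, t < θ → ∀ᶠ n in atTop, t < θn n := by
    intro t ht
    have hlt : GM.cm a (fun x => min t (σ ^ 2 / x)) < d := by
      rw [hd]
      refine GM.cm_mono_lt a ha0 _ _ (GM.cont_H a σ t ha1) (GM.cont_H a σ θ ha1)
        (fun x => min_le_min_right _ ht.le) ?_
      rw [min_eq_left hθS.le, min_eq_left (ht.trans hθS).le]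
      exact ht
    filter_upwards [(GM.szego a ha0 ha1 μv hμ _ (GM.cont_H a σ t ha1)).eventually_lt_const hlt,
      eventually_gt_atTop 0] with n hn hn0
    by_contra hc
    push Not at hc
    rw [(hθn n hn0).2] at hn
    refine absurd hn (not_lt.2 ?_)
    gcongr
  have hhigh : ∀ t, θ < t → ∀ᶠ n in atTop, θn n < t := by
    intro t ht
    have hlt : d < GM.cm a (fun x => min t (σ ^ 2 / x)) := by
      rw [hd]
      refine GM.cm_mono_lt a ha0 _ _ (GM.cont_H a σ θ ha1) (GM.cont_H a σ t ha1)
        (fun x => min_le_min_right _ ht.le) ?_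
      rw [min_eq_left hθS.le]
      exact lt_min ht hθS
    filter_upwards [(GM.szego a ha0 ha1 μv hμ _ (GM.cont_H a σ t ha1)).eventually_const_lt hlt,
      eventually_gt_atTop 0] with n hn hn0
    by_contra hc
    push Not at hc
    rw [(hθn n hn0).2] at hn
    refine absurd hn (not_lt.2 ?_)
    gcongr
  have hV : ∀ t, Tendsto
      (fun n : ℕ => (1 / (n : ℝ)) * ∑ i : Fin n, (1 / 2) * min 1 ((σ ^ 2 / μv n i / t) ^ 2))
      atTop (nhds (GM.VU a σ t)) := by
    intro t
    rw [GM.VU_eq]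
    exact GM.szego a ha0 ha1 μv hμ _ (GM.cont_V a σ t ha1)
  have hanti : ∀ (n : ℕ) (s t : ℝ), 0 < s → s ≤ t →
      (1 / (n : ℝ)) * ∑ i : Fin n, (1 / 2) * min 1 ((σ ^ 2 / μv n i / t) ^ 2) ≤
      (1 / (n : ℝ)) * ∑ i : Fin n, (1 / 2) * min 1 ((σ ^ 2 / μv n i / s) ^ 2) := by
    intro n s t hs hst
    have ht : 0 < t := hs.trans_le hst
    refine mul_le_mul_of_nonneg_left (Finset.sum_le_sum fun i _ => ?_) (by positivity)
    have := hμ0 n i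
    refine mul_le_mul_of_nonneg_left (min_le_min_left _ ?_) (by norm_num)
    gcongr
  have hc := GM.VU_cont a σ θ ha0 ha1 hθ
  rw [tendsto_order]
  constructor
  · intro y hy
    have ev : ∀ᶠ t in nhdsWithin θ (Set.Ioi θ), y < GM.VU a σ t ∧ θ < t :=
      ((hc.eventually_const_lt hy).filter_mono nhdsWithin_le_nhds).and self_mem_nhdsWithin
    obtain ⟨t, hyt, ht⟩ := ev.exists
    filter_upwards [hhigh t ht, (hV t).eventually_const_lt hyt, eventually_gt_atTop 0]
      with n h1 h2 h3
    exact h2.trans_le (hanti n _ _ (hθn n h3).1 h1.le)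
  · intro y hy
    have ev : ∀ᶠ t in nhdsWithin θ (Set.Iio θ), GM.VU a σ t < y ∧ t < θ :=
      ((hc.eventually_lt_const hy).filter_mono nhdsWithin_le_nhds).and self_mem_nhdsWithin
    have ev2 : ∀ᶠ t in nhdsWithin θ (Set.Iio θ), 0 < t :=
      Filter.Eventually.filter_mono nhdsWithin_le_nhds (lt_mem_nhds hθ)
    obtain ⟨t, ⟨hyt, ht⟩, ht0⟩ := (ev.and ev2).exists
    filter_upwards [hlow t ht, (hV t).eventually_lt_const hyt] with n h1 h2
    exact (hanti n _ _ ht0 h1.le).trans_lt h2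

end
end
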